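/- arXiv:2007.14623 — 6 statements merged into one kernel-verified Lean document; each statement's English description precedes it below -/
import Mathlib

section
/- Let G be a K_4-free regular graph on n vertices. If every vertex set S ⊆ V(G) with |S| = ⌊n/2⌋ spans at least n²/18 edges (i.e., e(S) ≥ n²/18), then n is divisible by 6 and G is isomorphic to the Turán graph T_3(n). -/
open Finset

/-- Number of edges of `G` with both endpoints in `S`. -/
def edgesIn {V : Type*} [Fintype V] [DecidableEq V] (G : SimpleGraph V) [DecidableRel G.Adj]
    (S : Finset V) : ℕ :=
  (G.edgeFinset.filter fun e => ∀ v ∈ e, v ∈ S).card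

/-- Number of edges of `G` with one endpoint in `A` and the other in `B`. -/
def edgesBetween {V : Type*} [Fintype V] [DecidableEq V] (G : SimpleGraph V) [DecidableRel G.Adj]
    (A B : Finset V) : ℕ :=
  (G.edgeFinset.filter fun e => ∃ a ∈ A, ∃ b ∈ B, e = s(a, b)).card

section Weights

variable {V : Type*} [Fintype V] [DecidableEq V] (G : SimpleGraph V) [DecidableRel G.Adj]

/-- The indicator of adjacency. -/
def adjInd (u w : V) : ℝ := if G.Adj u w then 1 else 0

/-- The quadratic form of the adjacency matrix. -/
def adjForm (x : V → ℝ) : ℝ := ∑ u, ∑ w, x u * x w * adjInd G u w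

/-- The coordinates of `x` that are neither `0` nor `1`. -/
noncomputable def fractionalCoords (x : V → ℝ) : Finset V := by
  classical exact univ.filter fun u => x u ≠ 0 ∧ x u ≠ 1

/-- Moving weight `t` from `k` to `i`. -/
def shiftWeight (x : V → ℝ) (i k : V) (t : ℝ) : V → ℝ :=
  fun u => x u + t * ((if u = i then 1 else 0) - (if u = k then 1 else 0))

lemma sum_shiftWeight (x : V → ℝ) (i k : V) (t : ℝ) :
    ∑ u, shiftWeight x i k t u = ∑ u, x u := by
  simp [shiftWeight, sum_add_distrib, ← mul_sum, sum_sub_distrib]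

lemma adjForm_shiftWeight (x : V → ℝ) (i k : V) (t : ℝ) :
    adjForm G (shiftWeight x i k t) = adjForm G x
      + 2 * t * (∑ w, x w * adjInd G i w - ∑ w, x w * adjInd G k w)
      - 2 * t ^ 2 * adjInd G i k := by
  have hs : ∀ u w, adjInd G u w = adjInd G w u := by
    intro u w; simp [adjInd, G.adj_comm]
  have hd : ∀ u, adjInd G u u = 0 := by intro u; simp [adjInd]
  have e : ∀ u w, shiftWeight x i k t u * shiftWeight x i k t w * adjInd G u w =
      x u * x w * adjInd G u w
      + t * (if u = i then x w * adjInd G u w else 0)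
      - t * (if u = k then x w * adjInd G u w else 0)
      + t * (if w = i then x u * adjInd G w u else 0)
      - t * (if w = k then x u * adjInd G w u else 0)
      + t ^ 2 * (if u = i then if w = i then adjInd G u w else 0 else 0)
      + t ^ 2 * (if u = k then if w = k then adjInd G u w else 0 else 0)
      - t ^ 2 * (if u = i then if w = k then adjInd G u w else 0 else 0)
      - t ^ 2 * (if u = k then if w = i then adjInd G u w else 0 else 0) := by
    intro u w
    rw [hs w u]
    unfold shiftWeight
    split_ifs <;> ring
  unfold adjForm
  simp only [e, sum_add_distrib, sum_sub_distrib, ← mul_sum]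
  have c1 : ∀ a : V, ∑ u, ∑ w, (if u = a then x w * adjInd G u w else 0)
      = ∑ w, x w * adjInd G a w := by
    intro a; rw [sum_comm]; simp
  have c2 : ∀ a : V, ∑ u, ∑ w, (if w = a then x u * adjInd G w u else 0)
      = ∑ w, x w * adjInd G a w := by
    intro a; simp
  have c3 : ∀ a b : V, ∑ u, ∑ w, (if u = a then if w = b then adjInd G u w else 0 else 0)
      = adjInd G a b := by
    intro a b; rw [sum_comm]; simp
  rw [c1, c1, c2, c2, c3, c3, c3, c3, hd, hd, hs k i]
  ring

lemma exists_fractionalCoords_card_lt (x : V → ℝ) (hx : ∀ u, x u ∈ Set.Icc (0 : ℝ) 1)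
    (h : 1 < (fractionalCoords x).card) :
    ∃ y : V → ℝ, (∀ u, y u ∈ Set.Icc (0 : ℝ) 1) ∧ ∑ u, y u = ∑ u, x u ∧
      adjForm G y ≤ adjForm G x ∧ (fractionalCoords y).card < (fractionalCoords x).card := by
  obtain ⟨i, hi, k, hk, hik, hle⟩ : ∃ i ∈ fractionalCoords x, ∃ k ∈ fractionalCoords x, i ≠ k ∧
      ∑ w, x w * adjInd G i w - ∑ w, x w * adjInd G k w ≤ 0 := by
    obtain ⟨a, ha, b, hb, hab⟩ := one_lt_card.1 h
    rcases le_total (∑ w, x w * adjInd G a w) (∑ w, x w * adjInd G b w) with h1 | h1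
    · exact ⟨a, ha, b, hb, hab, by linarith⟩
    · exact ⟨b, hb, a, ha, hab.symm, by linarith⟩
  have hi' := hx i
  have hk' := hx k
  simp only [Set.mem_Icc] at hi' hk'
  set t := min (1 - x i) (x k) with ht
  have ht0 : 0 ≤ t := le_min (by linarith) hk'.1
  have ht1 : t ≤ 1 - x i := min_le_left _ _
  have ht2 : t ≤ x k := min_le_right _ _
  have yi : shiftWeight x i k t i = x i + t := by simp [shiftWeight, hik]
  have yk : shiftWeight x i k t k = x k - t := by simp [shiftWeight, hik.symm]; ring
  have yo : ∀ u, u ≠ i → u ≠ k → shiftWeight x i k t u = x u := by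
    intro u h1 h2; simp [shiftWeight, h1, h2]
  refine ⟨shiftWeight x i k t, ?_, sum_shiftWeight x i k t, ?_, ?_⟩
  · intro u
    by_cases h1 : u = i
    · subst h1; rw [yi]; exact ⟨by linarith, by linarith⟩
    by_cases h2 : u = k
    · subst h2; rw [yk]; exact ⟨by linarith, by linarith⟩
    rw [yo u h1 h2]; exact hx u
  · rw [adjForm_shiftWeight]
    have : 0 ≤ adjInd G i k := by
      unfold adjInd; split_ifs <;> norm_num
    have h3 : 0 ≤ 2 * t ^ 2 * adjInd G i k := by positivity
    nlinarith [mul_nonneg ht0 (neg_nonneg.2 hle)]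
  · apply card_lt_card
    rw [ssubset_iff_of_subset]
    · rcases min_choice (1 - x i) (x k) with h1 | h1
      · refine ⟨i, hi, ?_⟩
        have : x i + t = 1 := by rw [ht, h1]; ring
        simp [fractionalCoords, yi, this]
      · refine ⟨k, hk, ?_⟩
        have : x k - t = 0 := by rw [ht, h1]; ring
        simp [fractionalCoords, yk, this]
    · intro u hu
      by_cases h1 : u = i
      · subst h1; exact hi
      by_cases h2 : u = k
      · subst h2; exact hk
      simpa [fractionalCoords, yo u h1 h2] using hu

lemma exists_fractionalCoords_card_le_one (x : V → ℝ) (hx : ∀ u, x u ∈ Set.Icc (0 : ℝ) 1) :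
    ∃ y : V → ℝ, (∀ u, y u ∈ Set.Icc (0 : ℝ) 1) ∧ ∑ u, y u = ∑ u, x u ∧
      adjForm G y ≤ adjForm G x ∧ (fractionalCoords y).card ≤ 1 := by
  induction hc : (fractionalCoords x).card using Nat.strong_induction_on generalizing x with
  | _ c ih =>
    rcases Nat.lt_or_ge 1 c with h | h
    · obtain ⟨y, hy, hsum, hform, hlt⟩ := exists_fractionalCoords_card_lt G x hx (hc ▸ h)
      obtain ⟨z, hz, hsz, hfz, hcz⟩ := ih _ (hc ▸ hlt) y hy rfl
      exact ⟨z, hz, hsz.trans hsum, hfz.trans hform, hcz⟩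
    · exact ⟨x, hx, rfl, le_rfl, hc ▸ h⟩

/-- Every fractional half weighs at least as much as some set of `⌊n/2⌋` vertices. -/
lemma exists_half_adjForm_le (x : V → ℝ) (hx : ∀ u, x u ∈ Set.Icc (0 : ℝ) 1)
    (hsum : ∑ u, x u = (Fintype.card V : ℝ) / 2) :
    ∃ S : Finset V, S.card = Fintype.card V / 2 ∧
      ∑ u ∈ S, ∑ w ∈ S, adjInd G u w ≤ adjForm G x := by
  classical
  obtain ⟨y, hy, hys, hyf, hyc⟩ := exists_fractionalCoords_card_le_one G x hx
  set S : Finset V := univ.filter fun u => y u = 1 with hS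
  refine ⟨S, ?_, le_trans ?_ hyf⟩
  · have hsplit : ∑ u, y u = (S.card : ℝ) + ∑ u ∈ fractionalCoords y, y u := by
      have : ∀ u, y u = (if y u = 1 then 1 else 0) + (if y u ≠ 0 ∧ y u ≠ 1 then y u else 0) := by
        intro u
        by_cases h1 : y u = 1
        · simp [h1]
        by_cases h0 : y u = 0
        · simp [h0]
        simp [h1, h0]
      rw [sum_congr rfl fun u _ => this u, sum_add_distrib, ← sum_filter, ← sum_filter]
      simp [hS, fractionalCoords]
    have h2 : (Fintype.card V : ℝ) = 2 * S.card + 2 * ∑ u ∈ fractionalCoords y, y u := by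
      linarith
    have hlo : 0 ≤ ∑ u ∈ fractionalCoords y, y u := sum_nonneg fun u _ => (hy u).1
    have hhi : ∑ u ∈ fractionalCoords y, y u < 1 := by
      rcases Nat.le_one_iff_eq_zero_or_eq_one.1 hyc with h | h
      · rw [card_eq_zero.1 h]; simp
      · obtain ⟨a, ha⟩ := card_eq_one.1 h
        have hmem : a ∈ fractionalCoords y := by simp [ha]
        rw [ha, sum_singleton]
        simp only [fractionalCoords, mem_filter, mem_univ, true_and] at hmem
        exact lt_of_le_of_ne (hy a).2 hmem.2
    have l1 : 2 * S.card ≤ Fintype.card V := by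
      have : (2 * S.card : ℝ) ≤ Fintype.card V := by linarith
      exact_mod_cast this
    have l2 : Fintype.card V < 2 * S.card + 2 := by
      have : (Fintype.card V : ℝ) < 2 * S.card + 2 := by linarith
      exact_mod_cast this
    omega
  · have hA : ∀ u w, 0 ≤ adjInd G u w := by
      intro u w; unfold adjInd; split_ifs <;> norm_num
    have hnn : ∀ u w, 0 ≤ y u * y w * adjInd G u w := fun u w =>
      mul_nonneg (mul_nonneg (hy u).1 (hy w).1) (hA u w)
    calc ∑ u ∈ S, ∑ w ∈ S, adjInd G u w
        = ∑ u ∈ S, ∑ w ∈ S, y u * y w * adjInd G u w := by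
          refine sum_congr rfl fun u hu => sum_congr rfl fun w hw => ?_
          rw [(mem_filter.1 hu).2, (mem_filter.1 hw).2]; ring
      _ ≤ ∑ u ∈ S, ∑ w, y u * y w * adjInd G u w := by
          refine sum_le_sum fun u _ => ?_
          exact sum_le_sum_of_subset_of_nonneg (subset_univ _) fun w _ _ => hnn u w
      _ ≤ adjForm G y := by
          exact sum_le_sum_of_subset_of_nonneg (subset_univ _) fun u _ _ =>
            sum_nonneg fun w _ => hnn u w

/-- The number of ordered pairs `(u, w) ∈ X × Y` of adjacent vertices. -/
def arcs (X Y : Finset V) : ℝ := ∑ u ∈ X, ∑ w ∈ Y, adjInd G u w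

lemma arcs_self_eq (S : Finset V) : arcs G S S = 2 * (edgesIn G S : ℝ) := by
  classical
  let H : SimpleGraph V :=
    { Adj := fun u w => G.Adj u w ∧ u ∈ S ∧ w ∈ S
      symm := ⟨fun u w h => ⟨h.1.symm, h.2.2, h.2.1⟩⟩
      loopless := ⟨fun u h => G.loopless.irrefl u h.1⟩ }
  have h1 : H.edgeFinset = G.edgeFinset.filter fun e => ∀ v ∈ e, v ∈ S := by
    ext e
    induction e with
    | _ u w => simp [H]
  have h2 := H.sum_degrees_eq_twice_card_edges
  have h3 : arcs G S S = ∑ u, (H.degree u : ℝ) := by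
    have : ∀ u, (H.degree u : ℝ) = ∑ w, adjInd H u w := by
      intro u
      rw [← SimpleGraph.card_neighborFinset_eq_degree]
      rw [SimpleGraph.neighborFinset_eq_filter, card_filter]
      push_cast
      rfl
    simp_rw [this]
    unfold arcs
    rw [← sum_filter_add_sum_filter_not univ (fun u => u ∈ S)]
    have z : ∑ u ∈ univ.filter (fun u => u ∉ S), ∑ w, adjInd H u w = 0 := by
      refine sum_eq_zero fun u hu => sum_eq_zero fun w _ => ?_
      have := (mem_filter.1 hu).2
      simp [adjInd, H, this]
    rw [z, add_zero, filter_univ_mem]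
    refine sum_congr rfl fun u hu => ?_
    rw [← sum_filter_add_sum_filter_not univ (fun w => w ∈ S)]
    have z : ∑ w ∈ univ.filter (fun w => w ∉ S), adjInd H u w = 0 := by
      refine sum_eq_zero fun w hw => ?_
      have := (mem_filter.1 hw).2
      simp [adjInd, H, this]
    rw [z, add_zero, filter_univ_mem]
    refine sum_congr rfl fun w hw => ?_
    simp [adjInd, H, hu, hw]
  rw [h3, edgesIn, ← h1]
  exact_mod_cast h2

end Weights

section Arcs

variable {V : Type*} (G : SimpleGraph V) [DecidableRel G.Adj]

lemma adjInd_comm (u w : V) : adjInd G u w = adjInd G w u := by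
  simp [adjInd, G.adj_comm]

lemma adjInd_nonneg (u w : V) : 0 ≤ adjInd G u w := by
  unfold adjInd; split_ifs <;> norm_num

lemma adjInd_le_one (u w : V) : adjInd G u w ≤ 1 := by
  unfold adjInd; split_ifs <;> norm_num

lemma arcs_comm (X Y : Finset V) : arcs G X Y = arcs G Y X := by
  unfold arcs
  rw [sum_comm]
  exact sum_congr rfl fun u _ => sum_congr rfl fun w _ => adjInd_comm G w u

lemma arcs_nonneg (X Y : Finset V) : 0 ≤ arcs G X Y :=
  sum_nonneg fun u _ => sum_nonneg fun w _ => adjInd_nonneg G u w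

lemma arcs_le_card_mul_card (X Y : Finset V) : arcs G X Y ≤ X.card * Y.card := by
  calc arcs G X Y ≤ ∑ _u ∈ X, ∑ _w ∈ Y, (1 : ℝ) :=
        sum_le_sum fun u _ => sum_le_sum fun w _ => adjInd_le_one G u w
    _ = X.card * Y.card := by simp

lemma arcs_eq_zero {X Y : Finset V} (h : ∀ u ∈ X, ∀ w ∈ Y, ¬ G.Adj u w) : arcs G X Y = 0 :=
  sum_eq_zero fun u hu => sum_eq_zero fun w hw => by simp [adjInd, h u hu w hw]

lemma sum_adjInd_eq_card (u : V) (Y : Finset V) :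
    ∑ w ∈ Y, adjInd G u w = ((Y.filter fun w => G.Adj u w).card : ℝ) := by
  simp [adjInd]

lemma arcs_univ_right [Fintype V] {d : ℕ} (hd : G.IsRegularOfDegree d) (X : Finset V) :
    arcs G X univ = d * X.card := by
  unfold arcs
  have : ∀ u, ∑ w, adjInd G u w = d := by
    intro u
    rw [sum_adjInd_eq_card, ← SimpleGraph.neighborFinset_eq_filter,
      SimpleGraph.card_neighborFinset_eq_degree, hd u]
  simp [this, mul_comm]

variable [DecidableEq V]

lemma arcs_union_left {X Y : Finset V} (h : Disjoint X Y) (Z : Finset V) :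
    arcs G (X ∪ Y) Z = arcs G X Z + arcs G Y Z := sum_union h

lemma arcs_union_right {X Y : Finset V} (h : Disjoint X Y) (Z : Finset V) :
    arcs G Z (X ∪ Y) = arcs G Z X + arcs G Z Y := by
  rw [arcs_comm, arcs_union_left G h, arcs_comm G X, arcs_comm G Y]

variable [Fintype V]

/-- The constraint imposed on densities by weights constant on `A`, on `B` and elsewhere, where
`a`, `b` are the densities of `A`, `B`, and `jA`, `jB`, `g` the arc densities inside `A`, inside
`B` and from `A` to `B`, in a regular graph of degree density `δ`. -/
def BlockTest (δ a b jA jB g : ℝ) : Prop :=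
  ∀ α β γ : ℝ, α ∈ Set.Icc (0 : ℝ) 1 → β ∈ Set.Icc (0 : ℝ) 1 → γ ∈ Set.Icc (0 : ℝ) 1 →
    α * a + β * b + γ * (1 - a - b) = 1 / 2 →
    1 / 9 ≤ α ^ 2 * jA + β ^ 2 * jB + 2 * α * β * g + 2 * α * γ * (δ * a - jA - g)
      + 2 * β * γ * (δ * b - jB - g)
      + γ ^ 2 * (δ * (1 - a - b) - (δ * a - jA - g) - (δ * b - jB - g))

lemma blockTest {d : ℕ} (hd : G.IsRegularOfDegree d)
    (hsparse : ∀ S : Finset V, S.card = Fintype.card V / 2 →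
      (Fintype.card V : ℝ) ^ 2 / 18 ≤ (edgesIn G S : ℝ))
    {n : ℝ} (hn : n = Fintype.card V) (hn0 : 0 < n) {A B : Finset V} (hAB : Disjoint A B) :
    BlockTest (d / n) (A.card / n) (B.card / n) (arcs G A A / n ^ 2) (arcs G B B / n ^ 2)
      (arcs G A B / n ^ 2) := by
  intro α β γ hα hβ hγ hsum
  set R : Finset V := (A ∪ B)ᶜ with hR
  have hdis : Disjoint (A ∪ B) R := disjoint_compl_right
  have hun : A ∪ B ∪ R = univ := union_compl _
  have hcard : (A.card : ℝ) + B.card + R.card = n := by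
    have := card_union_of_disjoint hdis
    rw [hun, card_union_of_disjoint hAB, card_univ] at this
    rw [hn, this]; push_cast; ring
  set x : V → ℝ := fun u => if u ∈ A then α else if u ∈ B then β else γ with hx
  have xA : ∀ u ∈ A, x u = α := by intro u hu; simp [hx, hu]
  have xB : ∀ u ∈ B, x u = β := by
    intro u hu
    have : u ∉ A := fun h => disjoint_left.1 hAB h hu
    simp [hx, hu, this]
  have xR : ∀ u ∈ R, x u = γ := by
    intro u hu
    simp only [hR, mem_compl, mem_union, not_or] at hu
    simp [hx, hu]
  have hsplit : ∀ f : V → ℝ, ∑ u, f u = ∑ u ∈ A, f u + ∑ u ∈ B, f u + ∑ u ∈ R, f u := by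
    intro f
    rw [← hun, sum_union hdis, sum_union hAB]
  have hxs : ∑ u, x u = (Fintype.card V : ℝ) / 2 := by
    rw [hsplit, sum_congr rfl xA, sum_congr rfl xB, sum_congr rfl xR]
    simp only [sum_const, nsmul_eq_mul]
    have h1 : (R.card : ℝ) / n = 1 - A.card / n - B.card / n := by
      field_simp; linarith
    rw [← h1] at hsum
    field_simp at hsum
    rw [← hn]; linarith
  have hblock : ∀ (X Y : Finset V) (ξ η : ℝ), (∀ u ∈ X, x u = ξ) → (∀ u ∈ Y, x u = η) →
      ∑ u ∈ X, ∑ w ∈ Y, x u * x w * adjInd G u w = ξ * η * arcs G X Y := by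
    intro X Y ξ η hX hY
    unfold arcs
    rw [mul_sum]
    refine sum_congr rfl fun u hu => ?_
    rw [mul_sum]
    exact sum_congr rfl fun w hw => by rw [hX u hu, hY w hw]
  have hform : adjForm G x = α ^ 2 * arcs G A A + β ^ 2 * arcs G B B + γ ^ 2 * arcs G R R
      + 2 * α * β * arcs G A B + 2 * α * γ * arcs G A R + 2 * β * γ * arcs G B R := by
    unfold adjForm
    rw [hsplit]
    simp_rw [hsplit, sum_add_distrib]
    rw [hblock A A α α xA xA, hblock A B α β xA xB, hblock A R α γ xA xR,
      hblock B A β α xB xA, hblock B B β β xB xB, hblock B R β γ xB xR,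
      hblock R A γ α xR xA, hblock R B γ β xR xB, hblock R R γ γ xR xR,
      arcs_comm G B A, arcs_comm G R A, arcs_comm G R B]
    ring
  have hdeg : ∀ X : Finset V, arcs G X A + arcs G X B + arcs G X R = d * X.card := by
    intro X
    rw [← arcs_univ_right G hd, ← hun, arcs_union_right G hdis, arcs_union_right G hAB]
  have hA := hdeg A
  have hB := hdeg B
  have hR' := hdeg R
  rw [arcs_comm G B A] at hB
  rw [arcs_comm G R A, arcs_comm G R B] at hR'
  obtain ⟨S, hS, hSf⟩ := exists_half_adjForm_le G x (by
    intro u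
    simp only [hx]
    split_ifs
    exacts [hα, hβ, hγ]) hxs
  have h1 := hsparse S hS
  have h2 : arcs G S S ≤ adjForm G x := hSf
  rw [arcs_self_eq, hform] at h2
  have eAR : arcs G A R = d * A.card - arcs G A A - arcs G A B := by linarith
  have eBR : arcs G B R = d * B.card - arcs G B B - arcs G A B := by linarith
  have eRR : arcs G R R = d * (n - A.card - B.card) - arcs G A R - arcs G B R := by
    rw [← hcard]; linarith
  rw [eRR, eAR, eBR] at h2
  rw [← hn] at h1
  have h3 : n ^ 2 / 9 ≤ _ := le_trans (by linarith) h2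
  have h4 := div_le_div_of_nonneg_right h3 (sq_nonneg n)
  rw [show n ^ 2 / 9 / n ^ 2 = 1 / 9 by field_simp] at h4
  refine h4.trans_eq ?_
  field_simp
  ring

end Arcs

section Cuts

variable {V : Type*} [DecidableEq V] (G : SimpleGraph V) [DecidableRel G.Adj]

/-- No triangle of `G` lies inside `N`. -/
def TriangleFreeOn (N : Finset V) : Prop :=
  ∀ u ∈ N, ∀ v ∈ N, ∀ w ∈ N, G.Adj u v → G.Adj v w → ¬ G.Adj u w

lemma arcs_eq_add_sdiff {S N : Finset V} (h : S ⊆ N) (X : Finset V) :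
    arcs G X N = arcs G X S + arcs G X (N \ S) := by
  rw [← arcs_union_right G disjoint_sdiff, union_sdiff_of_subset h]

lemma arcs_self_eq_add_sdiff {S N : Finset V} (h : S ⊆ N) :
    arcs G N N = arcs G S S + arcs G (N \ S) (N \ S) + 2 * arcs G S (N \ S) := by
  rw [arcs_eq_add_sdiff G h N, arcs_comm G N S, arcs_comm G N (N \ S), arcs_eq_add_sdiff G h S,
    arcs_eq_add_sdiff G h (N \ S), arcs_comm G (N \ S) S]
  ring

/-- Cutting along the neighbourhood of a suitable vertex. -/
lemma exists_neighborhood_cut {N : Finset V} (hT : TriangleFreeOn G N) (hN : N.Nonempty) :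
    ∃ A ⊆ N, (arcs G A A + arcs G (N \ A) (N \ A)) * (N.card : ℝ) ^ 2
      ≤ arcs G N N * (N.card : ℝ) ^ 2 - 2 * arcs G N N ^ 2 := by
  set T := arcs G N N with hTdef
  have hpos : (0 : ℝ) < N.card := by exact_mod_cast hN.card_pos
  set deg : V → ℝ := fun u => ∑ w ∈ N, adjInd G u w with hdeg
  have hsum : ∑ x ∈ N, ∑ u ∈ N, adjInd G x u * deg u = ∑ u ∈ N, deg u ^ 2 := by
    rw [sum_comm]
    refine sum_congr rfl fun u _ => ?_
    rw [← sum_mul, sq, hdeg]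
    congr 1
    exact sum_congr rfl fun x _ => adjInd_comm G x u
  have hcs : T ^ 2 ≤ N.card * ∑ u ∈ N, deg u ^ 2 := sq_sum_le_card_mul_sum_sq
  obtain ⟨x, hx, hle⟩ : ∃ x ∈ N, T ^ 2 / (N.card : ℝ) ^ 2 ≤ ∑ u ∈ N, adjInd G x u * deg u := by
    apply exists_le_of_sum_le hN
    rw [hsum, sum_const, nsmul_eq_mul]
    rw [show (N.card : ℝ) * (T ^ 2 / (N.card : ℝ) ^ 2) = T ^ 2 / N.card by field_simp]
    rw [div_le_iff₀ hpos]
    linarith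
  set A := N.filter fun u => G.Adj x u with hA
  have hAN : A ⊆ N := filter_subset _ _
  have hD : ∑ u ∈ N, adjInd G x u * deg u = arcs G A N := by
    unfold arcs
    rw [hA, sum_filter]
    refine sum_congr rfl fun u _ => ?_
    by_cases h : G.Adj x u <;> simp [adjInd, h, hdeg]
  have hAA : arcs G A A = 0 := by
    refine arcs_eq_zero G fun u hu w hw => ?_
    have hu' := mem_filter.1 hu
    have hw' := mem_filter.1 hw
    intro huw
    exact hT x hx u hu'.1 w hw'.1 hu'.2 huw hw'.2
  refine ⟨A, hAN, ?_⟩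
  have h1 := arcs_self_eq_add_sdiff G hAN
  have h2 := arcs_eq_add_sdiff G hAN A
  rw [hD, div_le_iff₀ (by positivity)] at hle
  have h3 : arcs G A A + arcs G (N \ A) (N \ A) = T - 2 * arcs G A N := by
    rw [h2, hTdef, h1, hAA]; ring
  rw [h3]
  linarith

/-- Twice the arcs leaving an independent subset of `P` lie inside `P`. -/
lemma two_mul_arcs_le {S P : Finset V} (hS : S ⊆ P) (h0 : arcs G S S = 0) :
    2 * arcs G S P ≤ arcs G P P := by
  have h1 := arcs_self_eq_add_sdiff G hS
  have h2 := arcs_eq_add_sdiff G hS S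
  have h3 := arcs_nonneg G (P \ S) (P \ S)
  linarith

/-- An edge inside `P` misses at least `|Q|` of the pairs between its endpoints and `Q`. -/
lemma arcs_mul_card_le {P Q : Finset V} (hT : TriangleFreeOn G (P ∪ Q)) :
    arcs G P P * Q.card ≤
      2 * ∑ u ∈ P, ∑ v ∈ Q, (1 - adjInd G u v) * ∑ x ∈ P, adjInd G u x := by
  set o : V → ℝ := fun u => ∑ v ∈ Q, adjInd G u v with ho
  have h1 : ∑ u ∈ P, ∑ v ∈ Q, (1 - adjInd G u v) * ∑ x ∈ P, adjInd G u x
      = arcs G P P * Q.card - ∑ u ∈ P, ∑ x ∈ P, adjInd G u x * o u := by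
    unfold arcs
    rw [sum_mul, ← sum_sub_distrib]
    refine sum_congr rfl fun u _ => ?_
    rw [← sum_mul, ← sum_mul, sum_sub_distrib, sum_const, nsmul_eq_mul, mul_one]
    ring
  have h2 : ∑ u ∈ P, ∑ x ∈ P, adjInd G u x * o u = ∑ u ∈ P, ∑ x ∈ P, adjInd G u x * o x := by
    rw [sum_comm]
    exact sum_congr rfl fun u _ => sum_congr rfl fun x _ => by rw [adjInd_comm]
  have h3 : ∑ u ∈ P, ∑ x ∈ P, adjInd G u x * o u + ∑ u ∈ P, ∑ x ∈ P, adjInd G u x * o x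
      ≤ arcs G P P * Q.card := by
    unfold arcs
    rw [sum_mul, ← sum_add_distrib]
    refine sum_le_sum fun u hu => ?_
    rw [sum_mul, ← sum_add_distrib]
    refine sum_le_sum fun x hx => ?_
    rw [← mul_add]
    by_cases hux : G.Adj u x
    · refine mul_le_mul_of_nonneg_left ?_ (adjInd_nonneg G u x)
      rw [ho, ← sum_add_distrib, ← mul_one (Q.card : ℝ), ← nsmul_eq_mul, ← sum_const]
      refine sum_le_sum fun v hv => ?_
      by_cases huv : G.Adj u v
      · have : ¬ G.Adj x v := fun hxv => hT u (mem_union_left _ hu) x (mem_union_left _ hx) v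
          (mem_union_right _ hv) hux hxv huv
        simp [adjInd, huv, this]
      · have := adjInd_le_one G x v
        simpa [adjInd, huv] using this
    · simp [adjInd, hux]
  rw [h1]
  linarith

/-- The inequalities satisfied by a locally maximum cut of a triangle-free graph, where `p`, `q`
are the sizes of the two sides, `jP`, `jQ` the numbers of arcs inside them and `g` the number of
arcs from one to the other; `I` is the largest degree inside a side. -/
def CutBound (p q jP jQ g : ℝ) : Prop :=
  ∃ I : ℝ, 0 ≤ I ∧ jP * q + jQ * p ≤ 4 * I * (p * q - g) ∧
    I * (jP * q + jQ * p) ≤ 2 * (I ^ 2 * (p * q - g) + jP * jQ) ∧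
    (jP + jQ ≤ 4 * I ^ 2 → I * (jP * q + jQ * p) ≤
      2 * (I ^ 2 * (p * q - g) + jP * jQ - (I ^ 2 - jP / 2) * (I ^ 2 - jQ / 2)))

lemma CutBound.symm {p q jP jQ g : ℝ} (h : CutBound p q jP jQ g) : CutBound q p jQ jP g := by
  obtain ⟨I, h0, h1, h2, h3⟩ := h
  refine ⟨I, h0, by linarith, by linarith, fun h => ?_⟩
  have := h3 (by linarith)
  linarith

lemma cutBound_of_max {P Q : Finset V} (hT : TriangleFreeOn G (P ∪ Q)) {w : V} (hw : w ∈ P)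
    (hP : ∀ u ∈ P, ∑ x ∈ P, adjInd G u x ≤ ∑ x ∈ P, adjInd G w x)
    (hQ : ∀ u ∈ Q, ∑ x ∈ Q, adjInd G u x ≤ ∑ x ∈ P, adjInd G w x)
    (hopt : ∑ x ∈ P, adjInd G w x ≤ ∑ x ∈ Q, adjInd G w x) :
    CutBound P.card Q.card (arcs G P P) (arcs G Q Q) (arcs G P Q) := by
  set I := ∑ x ∈ P, adjInd G w x with hI
  set iP : V → ℝ := fun u => ∑ x ∈ P, adjInd G u x with hiP
  set iQ : V → ℝ := fun u => ∑ x ∈ Q, adjInd G u x with hiQ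
  have hI0 : 0 ≤ I := sum_nonneg fun x _ => adjInd_nonneg G w x
  have iP0 : ∀ u, 0 ≤ iP u := fun u => sum_nonneg fun x _ => adjInd_nonneg G u x
  have iQ0 : ∀ u, 0 ≤ iQ u := fun u => sum_nonneg fun x _ => adjInd_nonneg G u x
  have hm0 : ∀ u v, 0 ≤ 1 - adjInd G u v := fun u v => sub_nonneg.2 (adjInd_le_one G u v)
  set M : ℝ := P.card * Q.card - arcs G P Q with hM
  have hMs : M = ∑ u ∈ P, ∑ v ∈ Q, (1 - adjInd G u v) := by
    simp only [hM, arcs, sum_sub_distrib, sum_const, nsmul_eq_mul, mul_one]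
  set S : ℝ := ∑ u ∈ P, ∑ v ∈ Q, (1 - adjInd G u v) * (iP u + iQ v) with hS
  have hL : arcs G P P * Q.card + arcs G Q Q * P.card ≤ 2 * S := by
    have h1 := arcs_mul_card_le G hT
    have h2 := arcs_mul_card_le G (P := Q) (Q := P) (by rwa [union_comm])
    have h3 : ∑ u ∈ Q, ∑ v ∈ P, (1 - adjInd G u v) * ∑ x ∈ Q, adjInd G u x
        = ∑ u ∈ P, ∑ v ∈ Q, (1 - adjInd G u v) * iQ v := by
      rw [sum_comm]
      exact sum_congr rfl fun u _ => sum_congr rfl fun v _ => by rw [adjInd_comm]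
    have h4 : S = ∑ u ∈ P, ∑ v ∈ Q, (1 - adjInd G u v) * iP u
        + ∑ u ∈ P, ∑ v ∈ Q, (1 - adjInd G u v) * iQ v := by
      simp only [hS, mul_add, sum_add_distrib]
    rw [h3] at h2
    linarith
  have hS1 : S ≤ 2 * I * M := by
    rw [hMs, mul_sum]
    refine sum_le_sum fun u hu => ?_
    rw [mul_sum]
    refine sum_le_sum fun v hv => ?_
    nlinarith [hP u hu, hQ v hv, hm0 u v]
  set K : ℝ := ∑ u ∈ P, ∑ v ∈ Q, (1 - adjInd G u v) * ((I - iP u) * (I - iQ v)) with hK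
  have hK0 : ∀ u ∈ P, ∀ v ∈ Q, 0 ≤ (1 - adjInd G u v) * ((I - iP u) * (I - iQ v)) :=
    fun u hu v hv => mul_nonneg (hm0 u v)
      (mul_nonneg (sub_nonneg.2 (hP u hu)) (sub_nonneg.2 (hQ v hv)))
  have hSK : I * S ≤ I ^ 2 * M + arcs G P P * arcs G Q Q - K := by
    have h1 : arcs G P P * arcs G Q Q = ∑ u ∈ P, ∑ v ∈ Q, iP u * iQ v := by
      unfold arcs
      rw [sum_mul_sum]
    rw [h1, hMs, hS, hK]
    simp only [mul_sum, ← sum_add_distrib, ← sum_sub_distrib]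
    refine sum_le_sum fun u hu => sum_le_sum fun v hv => ?_
    nlinarith [mul_nonneg (adjInd_nonneg G u v) (mul_nonneg (iP0 u) (iQ0 v))]
  have hKnn : 0 ≤ K := sum_nonneg fun u hu => sum_nonneg fun v hv => hK0 u hu v hv
  refine ⟨I, hI0, by linarith, ?_, fun hj => ?_⟩
  · nlinarith [mul_le_mul_of_nonneg_left hL hI0]
  set A := P.filter fun u => G.Adj w u with hA
  have hAc : (A.card : ℝ) = I := (sum_adjInd_eq_card G w P).symm
  obtain ⟨B, hBsub, hBc⟩ : ∃ B ⊆ Q.filter (fun u => G.Adj w u), B.card = A.card := by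
    apply exists_subset_card_eq
    have : (A.card : ℝ) ≤ ((Q.filter fun u => G.Adj w u).card : ℝ) := by
      rw [hAc, ← sum_adjInd_eq_card]; exact hopt
    exact_mod_cast this
  have hAP : A ⊆ P := filter_subset _ _
  have hBQ : B ⊆ Q := hBsub.trans (filter_subset _ _)
  have hAw : ∀ u ∈ A, G.Adj w u := fun u hu => (mem_filter.1 hu).2
  have hBw : ∀ u ∈ B, G.Adj w u := fun u hu => (mem_filter.1 (hBsub hu)).2
  have hAN : ∀ u ∈ A, u ∈ P ∪ Q := fun u hu => mem_union_left _ (hAP hu)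
  have hBN : ∀ u ∈ B, u ∈ P ∪ Q := fun u hu => mem_union_right _ (hBQ hu)
  have hind : ∀ u ∈ P ∪ Q, ∀ v ∈ P ∪ Q, G.Adj w u → G.Adj w v → ¬ G.Adj u v :=
    fun u hu v hv h1 h2 h3 => hT w (mem_union_left _ hw) u hu v hv h1 h3 h2
  have hX := two_mul_arcs_le G hAP (arcs_eq_zero G fun u hu v hv =>
    hind u (hAN u hu) v (hAN v hv) (hAw u hu) (hAw v hv))
  have hY := two_mul_arcs_le G hBQ (arcs_eq_zero G fun u hu v hv =>
    hind u (hBN u hu) v (hBN v hv) (hBw u hu) (hBw v hv))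
  have eX : ∑ u ∈ A, (I - iP u) = I ^ 2 - arcs G A P := by
    rw [sum_sub_distrib, sum_const, nsmul_eq_mul, hAc, sq]; rfl
  have eY : ∑ u ∈ B, (I - iQ u) = I ^ 2 - arcs G B Q := by
    rw [sum_sub_distrib, sum_const, nsmul_eq_mul, hBc, hAc, sq]; rfl
  have hX0 : 0 ≤ I ^ 2 - arcs G A P := by
    rw [← eX]; exact sum_nonneg fun u hu => sub_nonneg.2 (hP u (hAP hu))
  have hY0 : 0 ≤ I ^ 2 - arcs G B Q := by
    rw [← eY]; exact sum_nonneg fun u hu => sub_nonneg.2 (hQ u (hBQ hu))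
  have hKb : (I ^ 2 - arcs G A P) * (I ^ 2 - arcs G B Q) ≤ K := by
    rw [← eX, ← eY, sum_mul_sum]
    calc ∑ u ∈ A, ∑ v ∈ B, (I - iP u) * (I - iQ v)
        = ∑ u ∈ A, ∑ v ∈ B, (1 - adjInd G u v) * ((I - iP u) * (I - iQ v)) := by
          refine sum_congr rfl fun u hu => sum_congr rfl fun v hv => ?_
          have := hind u (hAN u hu) v (hBN v hv) (hAw u hu) (hBw v hv)
          simp [adjInd, this]
      _ ≤ ∑ u ∈ A, ∑ v ∈ Q, (1 - adjInd G u v) * ((I - iP u) * (I - iQ v)) :=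
          sum_le_sum fun u hu => sum_le_sum_of_subset_of_nonneg hBQ
            fun v hv _ => hK0 u (hAP hu) v hv
      _ ≤ K := sum_le_sum_of_subset_of_nonneg hAP
            fun u hu _ => sum_nonneg fun v hv => hK0 u hu v hv
  have hprod : (I ^ 2 - arcs G P P / 2) * (I ^ 2 - arcs G Q Q / 2)
      ≤ (I ^ 2 - arcs G A P) * (I ^ 2 - arcs G B Q) := by
    rcases le_total (arcs G P P / 2) (I ^ 2) with h1 | h1
    · rcases le_total (arcs G Q Q / 2) (I ^ 2) with h2 | h2
      · exact mul_le_mul (by linarith) (by linarith) (by linarith) hX0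
      · exact le_trans (mul_nonpos_of_nonneg_of_nonpos (by linarith) (by linarith))
          (mul_nonneg hX0 hY0)
    · exact le_trans (mul_nonpos_of_nonpos_of_nonneg (by linarith) (by linarith))
          (mul_nonneg hX0 hY0)
  nlinarith [mul_le_mul_of_nonneg_left hL hI0]

lemma arcs_insert_self {w : V} {S : Finset V} (hw : w ∉ S) :
    arcs G (insert w S) (insert w S) = arcs G S S + 2 * ∑ x ∈ S, adjInd G w x := by
  have h0 : adjInd G w w = 0 := by simp [adjInd]
  have h1 : ∑ u ∈ S, adjInd G u w = ∑ x ∈ S, adjInd G w x :=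
    sum_congr rfl fun u _ => adjInd_comm G u w
  unfold arcs
  rw [sum_insert hw, sum_insert hw, h0]
  simp_rw [sum_insert hw]
  rw [sum_add_distrib, h1]
  ring

lemma sum_adjInd_le_of_cut_optimal {P Q : Finset V} (hPQ : Disjoint P Q)
    (hmin : ∀ A ⊆ P ∪ Q, arcs G P P + arcs G Q Q
      ≤ arcs G A A + arcs G ((P ∪ Q) \ A) ((P ∪ Q) \ A)) {w : V} (hw : w ∈ P) :
    ∑ x ∈ P, adjInd G w x ≤ ∑ x ∈ Q, adjInd G w x := by
  have hwQ : w ∉ Q := disjoint_left.1 hPQ hw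
  have h1 := hmin (P.erase w) ((erase_subset _ _).trans subset_union_left)
  have h2 : (P ∪ Q) \ P.erase w = insert w Q := by
    ext x
    have := fun h : x ∈ P => disjoint_left.1 hPQ h
    by_cases hx : x = w
    · subst hx; simp [hw]
    · simp only [mem_sdiff, mem_union, mem_erase, mem_insert, hx]; tauto
  have h3 := arcs_insert_self G (notMem_erase w P)
  rw [insert_erase hw] at h3
  rw [h2, arcs_insert_self G hwQ] at h1
  have h4 : ∑ x ∈ P, adjInd G w x = ∑ x ∈ P.erase w, adjInd G w x := by
    rw [← add_sum_erase P _ hw]; simp [adjInd]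
  rw [h4]
  linarith

/-- A maximum cut of a triangle-free graph. -/
lemma exists_cutBound {N : Finset V} (hT : TriangleFreeOn G N) (hN : N.Nonempty) :
    ∃ P Q : Finset V, Disjoint P Q ∧ P ∪ Q = N ∧
      CutBound P.card Q.card (arcs G P P) (arcs G Q Q) (arcs G P Q) ∧
      (arcs G P P + arcs G Q Q) * (N.card : ℝ) ^ 2
        ≤ arcs G N N * (N.card : ℝ) ^ 2 - 2 * arcs G N N ^ 2 := by
  obtain ⟨P, hP, hmin⟩ := exists_min_image N.powerset
    (fun A => arcs G A A + arcs G (N \ A) (N \ A)) ⟨∅, by simp⟩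
  rw [mem_powerset] at hP
  set Q := N \ P with hQ
  have hPQ : Disjoint P Q := disjoint_sdiff
  have hun : P ∪ Q = N := union_sdiff_of_subset hP
  have hmin' : ∀ A ⊆ P ∪ Q, arcs G P P + arcs G Q Q
      ≤ arcs G A A + arcs G ((P ∪ Q) \ A) ((P ∪ Q) \ A) := by
    intro A hA
    rw [hun] at hA ⊢
    exact hmin A (mem_powerset.2 hA)
  have hT' : TriangleFreeOn G (P ∪ Q) := by rwa [hun]
  refine ⟨P, Q, hPQ, hun, ?_, ?_⟩
  · set i : V → ℝ := fun u => if u ∈ P then ∑ x ∈ P, adjInd G u x else ∑ x ∈ Q, adjInd G u x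
      with hi
    obtain ⟨w, hw, hmax⟩ := exists_max_image N i hN
    have iP : ∀ u ∈ P, i u = ∑ x ∈ P, adjInd G u x := fun u hu => by simp [hi, hu]
    have iQ : ∀ u ∈ Q, i u = ∑ x ∈ Q, adjInd G u x := fun u hu => by
      have : u ∉ P := (mem_sdiff.1 hu).2
      simp [hi, this]
    have hPm : ∀ u ∈ P, ∑ x ∈ P, adjInd G u x ≤ i w := fun u hu => by
      rw [← iP u hu]; exact hmax u (hP hu)
    have hQm : ∀ u ∈ Q, ∑ x ∈ Q, adjInd G u x ≤ i w := fun u hu => by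
      rw [← iQ u hu]; exact hmax u (mem_sdiff.1 hu).1
    by_cases hwP : w ∈ P
    · rw [iP w hwP] at hPm hQm
      exact cutBound_of_max G hT' hwP hPm hQm (sum_adjInd_le_of_cut_optimal G hPQ hmin' hwP)
    · have hwQ : w ∈ Q := mem_sdiff.2 ⟨hw, hwP⟩
      rw [iQ w hwQ] at hPm hQm
      have := cutBound_of_max G (by rwa [union_comm]) hwQ hQm hPm
        (sum_adjInd_le_of_cut_optimal G hPQ.symm (by
          intro A hA
          rw [union_comm] at hA ⊢
          linarith [hmin' A hA]) hwQ)
      rw [arcs_comm G Q P] at this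
      exact this.symm
  · obtain ⟨A, hA, hAb⟩ := exists_neighborhood_cut G hT hN
    refine le_trans ?_ hAb
    exact mul_le_mul_of_nonneg_right (hmin A (mem_powerset.2 hA)) (by positivity)

end Cuts

section RealInequalities

lemma BlockTest.symm {δ a b jA jB g : ℝ} (h : BlockTest δ a b jA jB g) :
    BlockTest δ b a jB jA g := by
  intro α β γ hα hβ hγ hs
  have := h β α γ hβ hα hγ (by linarith)
  linarith

/-- Testing with the value `1` on `A`, `0` on `B` and a constant elsewhere. -/
lemma BlockTest.cut {δ a b jA jB g : ℝ} (h : BlockTest δ a b jA jB g) (hab : a + b = δ)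
    (hδ : δ < 1) (h1 : a - b ≤ 1 - δ) (h2 : b - a ≤ 1 - δ) :
    (2 * g - jA - jB) * (1 - δ) ^ 2 + (a - b) ^ 2 * (δ - (jA + jB + 2 * g))
      - 2 * (1 - δ) * (a - b) * (jA - jB) ≤ (δ - 4 / 9) * (1 - δ) ^ 2 := by
  have hpos : 0 < 1 - δ := by linarith
  obtain ⟨γ, hγ⟩ : ∃ γ : ℝ, 2 * γ * (1 - δ) = 1 - δ - (a - b) :=
    ⟨(1 - δ - (a - b)) / (2 * (1 - δ)), by field_simp⟩
  have hγ0 : 0 ≤ γ := by nlinarith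
  have hγ1 : γ ≤ 1 := by nlinarith
  have key := h 1 0 γ (by simp) (by simp) ⟨hγ0, hγ1⟩ (by
    rw [show 1 - a - b = 1 - δ by linarith]; linarith)
  subst hab
  have key2 := mul_le_mul_of_nonneg_right key (sq_nonneg (1 - (a + b)))
  have e1 : γ ^ 2 * (1 - (a + b)) ^ 2 = (1 - (a + b) - (a - b)) ^ 2 / 4 := by
    linear_combination (2 * γ * (1 - (a + b)) + (1 - (a + b) - (a - b))) / 4 * hγ
  have e2 : γ * (1 - (a + b)) ^ 2 = (1 - (a + b) - (a - b)) * (1 - (a + b)) / 2 := by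
    linear_combination (1 - (a + b)) / 2 * hγ
  have e3 : (1 ^ 2 * jA + 0 ^ 2 * jB + 2 * 1 * 0 * g + 2 * 1 * γ * ((a + b) * a - jA - g)
      + 2 * 0 * γ * ((a + b) * b - jB - g)
      + γ ^ 2 * ((a + b) * (1 - a - b) - ((a + b) * a - jA - g) - ((a + b) * b - jB - g)))
        * (1 - (a + b)) ^ 2
      = jA * (1 - (a + b)) ^ 2
      + 2 * ((1 - (a + b) - (a - b)) * (1 - (a + b)) / 2) * ((a + b) * a - jA - g)
      + ((1 - (a + b) - (a - b)) ^ 2 / 4) * ((a + b) * (1 - a - b) - ((a + b) * a - jA - g)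
        - ((a + b) * b - jB - g)) := by
    rw [← e1, ← e2]; ring
  rw [e3] at key2
  linarith

lemma BlockTest.weighted_of_le {δ a b jA jB g : ℝ} (h : BlockTest δ a b jA jB g)
    (hab : a + b = δ) (hle : b ≤ a) (hb : 0 ≤ b) (hδ : 1 / 2 ≤ δ) (hδ' : δ ≤ 5 / 8)
    (hA : 0 ≤ jA) (hB : 0 ≤ jB) (hg : 0 ≤ g) :
    δ ^ 2 / 9 ≤ δ * (1 - δ) * (jA + jB + 2 * g) + (2 * δ - 1) ^ 2 * (jA + jB) := by
  have hpos : 0 < δ := by linarith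
  obtain ⟨m, hm⟩ : ∃ m : ℝ, m * δ = a - b := ⟨(a - b) / δ, by field_simp⟩
  obtain ⟨c₀, hc⟩ : ∃ c₀ : ℝ, c₀ * δ = 1 / 2 := ⟨1 / 2 / δ, by field_simp⟩
  have hm0 : 0 ≤ m := by nlinarith
  have hm1 : m ≤ 1 := by nlinarith
  obtain ⟨s₀, hs⟩ : ∃ s₀ : ℝ, s₀ = 1 - c₀ := ⟨_, rfl⟩
  have hc1 : c₀ ≤ 1 := by nlinarith
  have hc2 : 4 / 5 ≤ c₀ := by nlinarith
  have hs0 : 0 ≤ s₀ := by linarith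
  obtain ⟨t, ht⟩ : ∃ t : ℝ, t = jA + jB + 2 * g := ⟨_, rfl⟩
  have ht0 : 0 ≤ t := by linarith
  have htj : jA + jB ≤ t := by linarith
  rw [← ht]
  have test : ∀ c s : ℝ, c + s ∈ Set.Icc (0 : ℝ) 1 → c - s ∈ Set.Icc (0 : ℝ) 1 →
      c * δ + s * (a - b) = 1 / 2 →
      1 / 9 ≤ c ^ 2 * t + 2 * c * s * (jA - jB) - s ^ 2 * (t - 2 * (jA + jB)) := by
    intro c s h1 h2 h3
    have := h (c + s) (c - s) 0 h1 h2 (by simp) (by subst hab; linarith)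
    rw [ht]
    linarith
  clear h ht
  have hms : m * s₀ ≤ s₀ := by nlinarith
  have hms0 : 0 ≤ m * s₀ := by positivity
  suffices hsuff : 1 / 9 ≤ (c₀ ^ 2 - s₀ ^ 2) * t + 4 * s₀ ^ 2 * (jA + jB) by
    have h1 := mul_le_mul_of_nonneg_right hsuff (sq_nonneg δ)
    have e1 : (c₀ ^ 2 - s₀ ^ 2) * δ ^ 2 = δ * (1 - δ) := by
      rw [hs]; linear_combination 2 * δ * hc
    have e2 : 4 * s₀ ^ 2 * δ ^ 2 = (2 * δ - 1) ^ 2 := by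
      rw [hs]; linear_combination (-8 * δ + 4 * c₀ * δ + 2) * hc
    calc δ ^ 2 / 9 = 1 / 9 * δ ^ 2 := by ring
      _ ≤ _ := h1
      _ = (c₀ ^ 2 - s₀ ^ 2) * δ ^ 2 * t + 4 * s₀ ^ 2 * δ ^ 2 * (jA + jB) := by ring
      _ = _ := by rw [e1, e2]
  rcases le_total (jA - jB) (m * t) with hcase | hcase
  · have h1 := test (c₀ - s₀ * m) s₀ ⟨by nlinarith, by nlinarith⟩ ⟨by nlinarith, by nlinarith⟩ (by
      rw [← hm]; linear_combination hc)
    have h2 : 0 ≤ (c₀ - s₀ * m) * s₀ := mul_nonneg (by nlinarith) hs0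
    have h3 := mul_le_mul_of_nonneg_left hcase h2
    have h4 : 0 ≤ s₀ ^ 2 * m ^ 2 * t := by positivity
    have h5 : 0 ≤ s₀ ^ 2 * (jA + jB) := by positivity
    linarith
  · obtain ⟨s, hsm⟩ : ∃ s : ℝ, s * (1 + m) = s₀ := ⟨s₀ / (1 + m), by field_simp⟩
    have hsn : 0 ≤ s := by nlinarith
    have hss : s ≤ s₀ := by nlinarith
    have hmsn : 0 ≤ m * s := by positivity
    have h1 := test (c₀ + s * m) (-s) ⟨by nlinarith, by nlinarith⟩ ⟨by nlinarith, by nlinarith⟩ (by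
      rw [← hm]; linear_combination hc)
    have h2 : 0 ≤ (c₀ + s * m) * s := by positivity
    have h3 := mul_le_mul_of_nonneg_left hcase h2
    have h4 : 0 ≤ s ^ 2 * m ^ 2 * t := by positivity
    have h6 : 1 / 9 ≤ c₀ ^ 2 * t - s ^ 2 * (t - 2 * (jA + jB)) := by linarith
    rcases le_total (t - 2 * (jA + jB)) 0 with hF | hF
    · have : s ^ 2 * -(t - 2 * (jA + jB)) ≤ s₀ ^ 2 * -(t - 2 * (jA + jB)) :=
        mul_le_mul_of_nonneg_right (pow_le_pow_left₀ hsn hss 2) (by linarith)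
      have h5 : 0 ≤ s₀ ^ 2 * (jA + jB) := by positivity
      linarith
    · have h7 : s₀ ^ 2 * (1 - 2 * m) ≤ s ^ 2 := by
        have : (1 + m) ^ 2 * (1 - 2 * m) ≤ 1 := by
          linarith [pow_nonneg hm0 3, sq_nonneg m]
        have := mul_le_mul_of_nonneg_left this (sq_nonneg s)
        rw [← hsm]
        linarith
      have h8 : m * (t - 2 * (jA + jB)) ≤ jA + jB := by
        have := mul_nonneg hm0 (add_nonneg hA hB)
        linarith
      have h9 := mul_le_mul_of_nonneg_right h7 hF
      have h10 := mul_le_mul_of_nonneg_left h8 (sq_nonneg s₀)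
      linarith

/-- Testing with weights `c ± s` on the two sides of a cut of a neighbourhood. -/
lemma BlockTest.weighted {δ a b jA jB g : ℝ} (h : BlockTest δ a b jA jB g)
    (hab : a + b = δ) (ha : 0 ≤ a) (hb : 0 ≤ b) (hδ : 1 / 2 ≤ δ) (hδ' : δ ≤ 5 / 8)
    (hA : 0 ≤ jA) (hB : 0 ≤ jB) (hg : 0 ≤ g) :
    δ ^ 2 / 9 ≤ δ * (1 - δ) * (jA + jB + 2 * g) + (2 * δ - 1) ^ 2 * (jA + jB) := by
  rcases le_total b a with hle | hle
  · exact h.weighted_of_le hab hle hb hδ hδ' hA hB hg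
  · have := h.symm.weighted_of_le (by linarith) hle ha hδ hδ' hB hA hg
    linarith

end RealInequalities

section Numerics

lemma quintic_lt {s : ℝ} (hs0 : 0 ≤ s) (hs : s ≤ 1 / 4) :
    (29806 / 1000000 - 94850 / 200000 * s ^ 2) * ((1 + s) * (205 / 100 + 195 / 100 * s ^ 2))
      < (105 / 100 - 505 / 100 * s ^ 2) * (2 * (1 / 3 - s) ^ 2) := by
  have bern {p q : ℝ} (h1 : p ≤ s) (h2 : s ≤ q) (i j : ℕ) : 0 ≤ (s - p) ^ i * (q - s) ^ j :=
    mul_nonneg (pow_nonneg (sub_nonneg.2 h1) i) (pow_nonneg (sub_nonneg.2 h2) j)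
  rcases le_total s (1 / 5) with h | h
  · linarith [bern hs0 h 0 5, bern hs0 h 1 4, bern hs0 h 2 3, bern hs0 h 3 2, bern hs0 h 4 1,
      bern hs0 h 5 0]
  · linarith [bern h hs 0 5, bern h hs 1 4, bern h hs 2 3, bern h hs 3 2, bern h hs 4 1,
      bern h hs 5 0]

lemma arc_density_bounds {s τ j : ℝ} (hs0 : 0 ≤ s) (hs : s ≤ 1 / 4) (hj : 0 ≤ j)
    (hweight : 4 / 9 ≤ (1 - s ^ 2) * τ + 4 * s ^ 2 * j)
    (hcut : (τ - 2 * j - j ^ 2) * (1 + s) ^ 2 ≤ 2 / 9 + 2 * s)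
    (hnbhd : j ≤ τ - 2 * τ ^ 2) :
    1 - 2 * τ ≤ 103 / 2000 + 21 / 10 * j ∧ 1 - 2 * τ ≤ 108 / 1000 ∧ 52 / 10000 ≤ j ∧
      j ≤ 1 / 20 := by
  have hs2 : s ^ 2 ≤ 1 / 16 := by nlinarith
  have j8 : j ≤ 1 / 8 := by nlinarith [sq_nonneg (τ - 1 / 4)]
  have τ1 : 44 / 100 ≤ τ := by
    by_contra! h
    nlinarith [mul_nonneg (sq_nonneg s) hj]
  have j1 : j ≤ 1 / 18 := by nlinarith
  have τ2 : 4 / 9 ≤ τ := by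
    by_contra! h
    nlinarith [mul_nonneg (sq_nonneg s) hj]
  have j2 : j ≤ 1 / 20 := by nlinarith
  have τ3 : 446 / 1000 ≤ τ := by
    by_contra! h
    have h1 : s ^ 2 ≤ 67 / 10000 := by nlinarith [mul_nonneg (sq_nonneg s) hj]
    have h2 : s ≤ 82 / 1000 := by nlinarith
    have h3 : 34 / 100 ≤ τ - 2 * j - j ^ 2 := by nlinarith
    nlinarith
  have hD : 2 * (1 / 3 - s) ^ 2 ≤ j * (1 + s) * ((1 - s ^ 2) * (2 + j) + 4 * s ^ 2) := by
    have h1 : (1 + s) * (2 * (1 / 3 - s) ^ 2 - j * (1 + s) * ((1 - s ^ 2) * (2 + j) + 4 * s ^ 2))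
        ≤ 0 := by
      have e1 := mul_le_mul_of_nonneg_right hweight (sq_nonneg (1 + s))
      have e2 := mul_le_mul_of_nonneg_left hcut (show 0 ≤ 1 - s ^ 2 by linarith)
      linarith
    by_contra! h
    nlinarith
  have j3 : 52 / 10000 ≤ j := by
    by_contra! h
    have h1 : (1 + s) * ((1 - s ^ 2) * (2 + j) + 4 * s ^ 2)
        ≤ (5 / 4) * ((2 + 52 / 10000) + 2 * (1 / 16)) := by
      apply mul_le_mul (by linarith) _ (by nlinarith) (by norm_num)
      nlinarith
    have h2 : (1 : ℝ) / 144 ≤ (1 / 3 - s) ^ 2 := by nlinarith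
    have h3 := mul_le_mul_of_nonneg_left h1 hj
    linarith
  refine ⟨?_, by linarith, j3, j2⟩
  by_contra! h
  have h1 : s ^ 2 * (94850 / 200000 - 505 / 100 * j) < 29806 / 1000000 - 105 / 100 * j := by
    have := mul_lt_mul_of_pos_left h (show 0 < 1 - s ^ 2 by linarith)
    linarith
  have h2 : 2 * (1 / 3 - s) ^ 2 ≤ j * ((1 + s) * (205 / 100 + 195 / 100 * s ^ 2)) := by
    refine hD.trans ?_
    rw [mul_assoc]
    apply mul_le_mul_of_nonneg_left _ hj
    apply mul_le_mul_of_nonneg_left _ (by linarith)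
    nlinarith
  have h3 : 0 < 105 / 100 - 505 / 100 * s ^ 2 := by linarith
  have h4 := mul_le_mul_of_nonneg_left h2 h3.le
  have h5 : 0 < (1 + s) * (205 / 100 + 195 / 100 * s ^ 2) := by positivity
  have h6 : j * (105 / 100 - 505 / 100 * s ^ 2) ≤ 29806 / 1000000 - 94850 / 200000 * s ^ 2 := by
    linarith
  have h7 := mul_le_mul_of_nonneg_right h6 h5.le
  have h8 : (105 / 100 - 505 / 100 * s ^ 2) * (2 * (1 / 3 - s) ^ 2)
      ≤ (29806 / 1000000 - 94850 / 200000 * s ^ 2) *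
        ((1 + s) * (205 / 100 + 195 / 100 * s ^ 2)) := by linarith
  linarith [quintic_lt hs0 hs]

lemma cut_ratio_false {I u κ : ℝ} (hI : 0 < I) (hu : 0 < u) (huI : u ≤ 4 * I)
    (h1 : κ ≤ 103 / 2000 + 21 / 10 * (u * I)) (h2 : κ ≤ 108 / 1000) (h3 : 52 / 10000 ≤ u * I)
    (h4 : u * I ≤ 1 / 20) (h : u ≤ κ + 4 * (u * I) + 3 / 4 * u ^ 2 - 4 * I ^ 2) : False := by
  have hu2 : u ^ 2 ≤ 1 / 5 := by nlinarith
  have hu3 : u ≤ 4473 / 10000 := by nlinarith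
  rcases le_total (4268 / 10000) u with hc | hc
  · have hI' : 1067 / 10000 ≤ I := by linarith
    have : 1 / 100 ≤ I ^ 2 := by nlinarith
    have : κ + 4 * (u * I) - 4 * I ^ 2 ≤ 108 / 1000 + 155 / 1000 := by nlinarith
    nlinarith
  · have hu4 : u ≤ 643 / 10000 := by
      by_contra! hlt
      rcases le_total u (1446 / 10000 + 5 / 1000) with h5 | h5
      · have : u ≤ 103 / 2000 + 38 / 16 * u ^ 2 := by nlinarith [sq_nonneg (I - 61 / 80 * u)]
        nlinarith
      · have : u ≤ 108 / 1000 + 7 / 4 * u ^ 2 := by nlinarith [sq_nonneg (2 * I - u)]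
        nlinarith
    have e1 := mul_le_mul_of_nonneg_left h (sq_nonneg u)
    have e2 := mul_le_mul_of_nonneg_left h1 (sq_nonneg u)
    have e3 : (u * I - 52 / 10000) * (61 / 10 * u ^ 2) ≤
        (u * I - 52 / 10000) * (4 * (u * I + 52 / 10000)) :=
      mul_le_mul_of_nonneg_left (by nlinarith) (by linarith)
    have e4 := mul_le_mul_of_nonneg_left hu4 (pow_pos hu 3).le
    linarith [mul_nonneg hu.le (sq_nonneg (u - 583 / 10000)), sq_nonneg (u - 583 / 10000)]

lemma cut_false_of_lt {I j κ : ℝ} (hI : 0 < I) (h2 : κ ≤ 108 / 1000) (h3 : 52 / 10000 ≤ j)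
    (h4 : j ≤ 1 / 20) (h5 : j ≤ 11 / 5 * (κ + 2 * j) * I) (hlt : 4 * I ^ 2 < j)
    (h : I * j ≤ I ^ 2 * (κ + 2 * j) + j ^ 2) : False := by
  have a1 : 1442 / 10000 * I ≤ j := by
    by_contra! hc
    nlinarith
  have a2 : j ≤ 45764 / 100000 * I := by nlinarith
  have a3 : I * j ≤ 108 / 1000 * I ^ 2 + 3 / 2 * j ^ 2 := by nlinarith [sq_nonneg I]
  nlinarith [mul_nonneg (sub_nonneg.2 a1) (sub_nonneg.2 a2), mul_pos hI hI]

lemma CutBound.false {p q jP jQ g : ℝ} (h : CutBound p q jP jQ g) (hpq : p + q = 1)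
    (hP : 0 ≤ jP) (hQ : 0 ≤ jQ) (hg : g ≤ p * q)
    (h1 : 1 - 2 * (jP + jQ + 2 * g) ≤ 103 / 2000 + 21 / 10 * (jP + jQ))
    (h2 : 1 - 2 * (jP + jQ + 2 * g) ≤ 108 / 1000) (h3 : 52 / 10000 ≤ jP + jQ)
    (h4 : jP + jQ ≤ 1 / 20) : False := by
  obtain ⟨I, hI0, c1, c2, c3⟩ := h
  obtain ⟨j, hj⟩ : ∃ j, j = jP + jQ := ⟨_, rfl⟩
  obtain ⟨ε, hε⟩ : ∃ ε, ε = jP - jQ := ⟨_, rfl⟩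
  obtain ⟨Δ, hΔ⟩ : ∃ Δ, Δ = p - q := ⟨_, rfl⟩
  obtain ⟨κ, hκ⟩ : ∃ κ, κ = 1 - 2 * (jP + jQ + 2 * g) := ⟨_, rfl⟩
  have ep : p = (1 + Δ) / 2 := by linarith
  have eq : q = (1 - Δ) / 2 := by linarith
  have eP : jP = (j + ε) / 2 := by linarith
  have eQ : jQ = (j - ε) / 2 := by linarith
  have eg : g = (1 - (κ + 2 * j)) / 4 := by linarith
  have hεj : |ε| ≤ j := abs_le.2 ⟨by linarith, by linarith⟩
  rw [← hκ] at h1 h2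
  rw [← hj] at h1 h3 h4
  rw [ep, eq, eg] at hg
  rw [ep, eq, eP, eQ, eg] at c1 c2 c3
  clear ep eq eP eQ eg hκ hΔ hε hj hpq hP hQ
  have hK : Δ ^ 2 ≤ κ + 2 * j := by linarith
  have d1 : j ≤ 11 / 5 * (κ + 2 * j) * I := by
    have habs : Δ * ε ≤ |Δ| * j := by
      calc Δ * ε ≤ |Δ * ε| := le_abs_self _
        _ = |Δ| * |ε| := abs_mul _ _
        _ ≤ _ := mul_le_mul_of_nonneg_left hεj (abs_nonneg _)
    have hd : |Δ| < 1 := by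
      rw [← sq_lt_one_iff₀ (abs_nonneg _), sq_abs]
      linarith
    have e1 : j * (1 - |Δ|) ≤ 2 * I * (κ + 2 * j - Δ ^ 2) := by linarith
    have e2 : κ + 2 * j - Δ ^ 2 ≤ 11 / 10 * (κ + 2 * j) * (1 - |Δ|) := by
      have : 0 ≤ κ + 2 * j := (sq_nonneg _).trans hK
      nlinarith [sq_nonneg (|Δ| - 11 / 20 * (κ + 2 * j)), sq_abs Δ]
    have e3 := mul_le_mul_of_nonneg_left e2 (show 0 ≤ 2 * I by linarith)
    have e4 : j * (1 - |Δ|) ≤ (11 / 5 * (κ + 2 * j) * I) * (1 - |Δ|) := by linarith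
    exact le_of_mul_le_mul_right e4 (by linarith)
  have hI : 0 < I := by
    rcases hI0.eq_or_lt with rfl | hI
    · linarith
    · exact hI
  have d2 : I * j ≤ I ^ 2 * (κ + 2 * j) + j ^ 2 := by
    linarith [sq_nonneg (I * Δ - ε / 2), sq_nonneg ε]
  rcases lt_or_ge (4 * I ^ 2) j with hlt | hge
  · exact cut_false_of_lt hI h2 h3 h4 d1 hlt d2
  · have d3 : I * j ≤ I ^ 2 * (κ + 4 * j) + 3 / 4 * j ^ 2 - 4 * I ^ 4 := by
      have := c3 (by linarith)
      linarith [sq_nonneg (I * Δ - ε / 2), sq_nonneg ε]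
    obtain ⟨u, rfl⟩ : ∃ u, j = u * I := ⟨j / I, by field_simp⟩
    have hu : 0 < u := by
      by_contra! hu
      nlinarith
    refine cut_ratio_false hI hu (le_of_mul_le_mul_right (a := I) (by linarith) hI) h1 h2 h3 h4
      (le_of_mul_le_mul_left (a := I ^ 2) (by linarith) (by positivity))

end Numerics

section Contradiction

lemma CutBound.scale {p q jP jQ g r : ℝ} (h : CutBound p q jP jQ g) (hr : 0 ≤ r) :
    CutBound (r * p) (r * q) (r ^ 2 * jP) (r ^ 2 * jQ) (r ^ 2 * g) := by
  obtain ⟨I, hI, h1, h2, h3⟩ := h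
  refine ⟨r * I, by positivity, ?_, ?_, ?_⟩
  · linarith [mul_le_mul_of_nonneg_left h1 (pow_nonneg hr 3)]
  · linarith [mul_le_mul_of_nonneg_left h2 (pow_nonneg hr 4)]
  · intro h
    rcases hr.eq_or_lt with rfl | hr'
    · simp
    · have := h3 (le_of_mul_le_mul_left (a := r ^ 2) (by linarith) (by positivity))
      linarith [mul_le_mul_of_nonneg_left this (pow_nonneg hr 4)]

/-- Consequence of `BlockTest.cut` in terms of densities relative to a neighbourhood. -/
lemma BlockTest.relative_cut {δ p q jP jQ g : ℝ} (h : BlockTest δ (δ * p) (δ * q) (δ ^ 2 * jP)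
    (δ ^ 2 * jQ) (δ ^ 2 * g)) (hpq : p + q = 1) (hP : 0 ≤ jP) (hQ : 0 ≤ jQ) (hδ0 : 0 < δ)
    (hδ : δ ≤ 5 / 8) (hτ : jP + jQ + 2 * g ≤ 1 / 2) (h1 : δ * (p - q) ≤ 1 - δ)
    (h2 : δ * (q - p) ≤ 1 - δ) :
    δ ^ 2 * (jP + jQ + 2 * g - 2 * (jP + jQ) - (jP + jQ) ^ 2) ≤ δ - 4 / 9 := by
  have key := h.cut (by linear_combination δ * hpq) (by linarith) (by linarith) (by linarith)
  have hpos : 0 < (1 - δ) ^ 2 := by nlinarith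
  have e1 : δ ^ 2 ≤ δ - δ ^ 2 * (jP + jQ + 2 * g) := by nlinarith
  have e2 := mul_le_mul_of_nonneg_left e1 (sq_nonneg (δ * p - δ * q))
  have e3 := mul_nonneg (sq_nonneg δ) (sq_nonneg (δ * p - δ * q - (1 - δ) * (jP - jQ)))
  have e4 : δ ^ 2 * (1 - δ) ^ 2 * (jP - jQ) ^ 2 ≤ δ ^ 2 * (1 - δ) ^ 2 * (jP + jQ) ^ 2 :=
    mul_le_mul_of_nonneg_left (by nlinarith) (by positivity)
  exact le_of_mul_le_mul_right (a := (1 - δ) ^ 2) (by linarith) hpos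

lemma BlockTest.four_ninths_le {δ a b jA jB g : ℝ} (h : BlockTest δ a b jA jB g) : 4 / 9 ≤ δ := by
  have := h (1 / 2) (1 / 2) (1 / 2) (by norm_num) (by norm_num) (by norm_num) (by ring)
  linarith

lemma BlockTest.false_of_half_le {δ p q jP jQ g : ℝ} (h : BlockTest δ (δ * p) (δ * q) (δ ^ 2 * jP)
    (δ ^ 2 * jQ) (δ ^ 2 * g)) (hcut : CutBound p q jP jQ g) (hpq : p + q = 1) (hp : 0 ≤ p)
    (hq : 0 ≤ q) (hP : 0 ≤ jP) (hQ : 0 ≤ jQ) (hg : 0 ≤ g) (hgpq : g ≤ p * q)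
    (hnbhd : jP + jQ ≤ (jP + jQ + 2 * g) - 2 * (jP + jQ + 2 * g) ^ 2)
    (hδ : 1 / 2 ≤ δ) (hδ' : δ ≤ 5 / 8) : False := by
  have hδ0 : 0 < δ := by linarith
  have hw := h.weighted (by linear_combination δ * hpq) (by positivity) (by positivity) hδ hδ'
    (by positivity) (by positivity) (by positivity)
  have hcut' := h.relative_cut hpq hP hQ hδ0 hδ'
  obtain ⟨j, hj⟩ : ∃ j, j = jP + jQ := ⟨_, rfl⟩
  obtain ⟨τ, hτ⟩ : ∃ τ, τ = jP + jQ + 2 * g := ⟨_, rfl⟩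
  have hw' : 1 / 9 ≤ δ * (1 - δ) * τ + (2 * δ - 1) ^ 2 * j :=
    le_of_mul_le_mul_left (a := δ ^ 2) (by rw [hj, hτ]; linarith) (by positivity)
  have hj0 : 0 ≤ j := by linarith
  have hpq' : (p - q) ^ 2 ≤ 1 - 2 * τ + 2 * j := by
    rw [show (p - q) ^ 2 = (p + q) ^ 2 - 4 * (p * q) by ring, hpq]; linarith
  rw [← hτ, ← hj] at hnbhd hcut'
  have hτ0 : 0 ≤ τ := by rw [hτ]; positivity
  have hs2 : (2 * δ - 1) ^ 2 ≤ 1 / 16 := by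
    linarith [mul_nonneg (sub_nonneg.2 hδ) (sub_nonneg.2 hδ')]
  have hτ2 : τ ≤ 1 / 2 := by
    by_contra! hlt
    linarith [mul_pos (sub_pos.2 hlt) (show 0 < τ by linarith)]
  have hj8 : j ≤ 1 / 8 := by linarith [sq_nonneg (τ - 1 / 4)]
  have hτ1 : 41 / 100 ≤ τ := by
    have h1 := mul_le_mul_of_nonneg_left hj8 (sq_nonneg (2 * δ - 1))
    have h2 := mul_nonneg hτ0 (sq_nonneg (2 * δ - 1))
    linarith
  have hjs : j ≤ 9 / 100 := by
    linarith [mul_nonneg (sub_nonneg.2 hτ1) hτ0]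
  have habs : |p - q| ≤ 6 / 10 := abs_le_of_sq_le_sq (by linarith) (by norm_num)
  obtain ⟨h1, h2⟩ := abs_le.1 habs
  have h3 := mul_le_mul_of_nonneg_left h1 hδ0.le
  have h4 := mul_le_mul_of_nonneg_left h2 hδ0.le
  have hc := hcut' hτ2 (by linarith) (by linarith)
  obtain ⟨b1, b2, b3, b4⟩ := arc_density_bounds (s := 2 * δ - 1) (τ := τ) (j := j) (by linarith)
    (by linarith) hj0 (by linarith) (by linarith) hnbhd
  rw [hτ, hj] at b1
  rw [hτ] at b2
  rw [hj] at b3 b4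
  exact hcut.false hpq hP hQ hgpq b1 b2 b3 b4

lemma BlockTest.false_of_le_half {δ p q jP jQ g : ℝ} (h : BlockTest δ (δ * p) (δ * q) (δ ^ 2 * jP)
    (δ ^ 2 * jQ) (δ ^ 2 * g)) (h0 : BlockTest δ δ 0 (δ ^ 2 * (jP + jQ + 2 * g)) 0 0)
    (hpq : p + q = 1) (hp : 0 ≤ p) (hq : 0 ≤ q) (hP : 0 ≤ jP) (hQ : 0 ≤ jQ)
    (hnbhd : jP + jQ ≤ (jP + jQ + 2 * g) - 2 * (jP + jQ + 2 * g) ^ 2)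
    (hδ : δ ≤ 1 / 2) : False := by
  have hδ4 := h.four_ninths_le
  have hδ0 : 0 < δ := by linarith
  have hcut' := h.relative_cut hpq hP hQ hδ0 (by linarith)
  have hcut0 := h0.cut (by ring) (by linarith) (by linarith) (by linarith)
  obtain ⟨j, hj⟩ : ∃ j, j = jP + jQ := ⟨_, rfl⟩
  obtain ⟨τ, hτ⟩ : ∃ τ, τ = jP + jQ + 2 * g := ⟨_, rfl⟩
  have hj0 : 0 ≤ j := by linarith
  rw [← hτ, ← hj] at hnbhd hcut'
  rw [← hτ] at hcut0
  have hτ2 : τ ≤ 1 / 2 := by nlinarith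
  have hc := hcut' hτ2 (by nlinarith) (by nlinarith)
  have hτ1 : 42 / 100 ≤ τ := by
    have : δ ^ 3 - δ ^ 2 * τ ≤ (δ - 4 / 9) * (1 - δ) ^ 2 := by linarith
    by_contra! hlt
    have := mul_lt_mul_of_pos_left hlt (pow_pos hδ0 2)
    linarith [sq_nonneg (δ - 4665 / 10000)]
  have hjs : j ≤ 7 / 100 := by nlinarith
  have : 25 / 100 ≤ τ - 2 * j - j ^ 2 := by nlinarith
  nlinarith

end Contradiction

section Colouring

variable {V : Type*} [Fintype V] {G : SimpleGraph V}

/-- The vertices of colour `i`. -/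
def colorFinset (C : G.Coloring (Fin 3)) (i : Fin 3) : Finset V := univ.filter fun v => C v = i

lemma arcs_colorFinset_self [DecidableRel G.Adj] (C : G.Coloring (Fin 3)) (i : Fin 3) :
    arcs G (colorFinset C i) (colorFinset C i) = 0 := by
  refine arcs_eq_zero G fun u hu w hw h => C.valid h ?_
  simp only [colorFinset, mem_filter, mem_univ, true_and] at hu hw
  rw [hu, hw]

lemma disjoint_colorFinset (C : G.Coloring (Fin 3)) {i j : Fin 3} (hij : i ≠ j) :
    Disjoint (colorFinset C i) (colorFinset C j) := by
  rw [disjoint_left]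
  intro v hi hj
  simp only [colorFinset, mem_filter, mem_univ, true_and] at hi hj
  exact hij (hi.symm.trans hj)

variable [DecidableEq V]

lemma union_colorFinset (C : G.Coloring (Fin 3)) (i : Fin 3) :
    colorFinset C i ∪ colorFinset C (i + 1) ∪ colorFinset C (i + 2) = univ := by
  ext v
  simp only [colorFinset, mem_union, mem_filter, mem_univ, true_and, iff_true]
  generalize C v = c
  revert c i
  decide

lemma card_colorFinset_add (C : G.Coloring (Fin 3)) (i : Fin 3) :
    (colorFinset C i).card + (colorFinset C (i + 1)).card + (colorFinset C (i + 2)).card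
      = Fintype.card V := by
  rw [← card_union_of_disjoint, ← card_union_of_disjoint, union_colorFinset, card_univ]
  · rw [disjoint_union_left]
    exact ⟨disjoint_colorFinset C (by revert i; decide),
      disjoint_colorFinset C (by revert i; decide)⟩
  · exact disjoint_colorFinset C (by revert i; decide)

end Colouring

section Assembly

variable {V : Type*} [Fintype V] (G : SimpleGraph V) [DecidableRel G.Adj]

lemma isTuranMaximal_three {d : ℕ} (hd : G.IsRegularOfDegree d) (hK4 : G.CliqueFree 4)
    (h : 2 * Fintype.card V = 3 * d) : G.IsTuranMaximal 3 := by
  refine ⟨hK4, fun H _ hH => ?_⟩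
  have h1 := SimpleGraph.CliqueFree.card_edgeFinset_le hH
  have h2 := G.sum_degrees_eq_twice_card_edges
  simp only [hd.degree_eq, sum_const, card_univ, smul_eq_mul] at h2
  obtain ⟨m, hm⟩ : ∃ m, Fintype.card V = 3 * m := ⟨Fintype.card V / 3, by omega⟩
  obtain rfl : d = 2 * m := by omega
  dsimp only at h1
  rw [hm] at h1 h2
  rw [Nat.mul_mod_right] at h1
  have h3 : ((3 * m) ^ 2 - 0 ^ 2) * (3 - 1) / (2 * 3) = 3 * m ^ 2 := by
    rw [show ((3 * m) ^ 2 - 0 ^ 2) * (3 - 1) = 3 * m ^ 2 * (2 * 3) by simp; ring]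
    simp
  rw [h3] at h1
  simp only [Nat.choose_zero_succ, add_zero] at h1
  nlinarith

variable [DecidableEq V]

lemma triangleFreeOn_neighborFinset (hK4 : G.CliqueFree 4) (v : V) :
    TriangleFreeOn G (G.neighborFinset v) := by
  intro x hx y hy z hz hxy hyz hxz
  rw [SimpleGraph.mem_neighborFinset] at hx hy hz
  have h3 : G.IsNClique 3 {x, y, z} := SimpleGraph.is3Clique_triple_iff.2 ⟨hxy, hxz, hyz⟩
  refine hK4 _ (h3.insert (a := v) ?_)
  simp [hx, hy, hz]

lemma false_of_degree_le [Nonempty V] {d : ℕ} (hd : G.IsRegularOfDegree d) (hK4 : G.CliqueFree 4)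
    (hsparse : ∀ S : Finset V, S.card = Fintype.card V / 2 →
      (Fintype.card V : ℝ) ^ 2 / 18 ≤ (edgesIn G S : ℝ))
    (hle : 8 * d ≤ 5 * Fintype.card V) : False := by
  obtain ⟨v⟩ := ‹Nonempty V›
  obtain ⟨n, hn⟩ : ∃ n : ℝ, n = Fintype.card V := ⟨_, rfl⟩
  have hn0 : 0 < n := by rw [hn]; exact_mod_cast Fintype.card_pos_iff.2 ⟨v⟩
  obtain ⟨N, hN⟩ : ∃ N, N = G.neighborFinset v := ⟨_, rfl⟩
  have hT : TriangleFreeOn G N := hN ▸ triangleFreeOn_neighborFinset G hK4 v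
  have hNd : N.card = d := by rw [hN, SimpleGraph.card_neighborFinset_eq_degree, hd v]
  have hblock {A B : Finset V} (h : Disjoint A B) := blockTest G hd hsparse hn hn0 h
  have hd0 : 0 < (d : ℝ) := by
    have h1 := (hblock (disjoint_empty_right N)).four_ninths_le
    by_contra! h2
    have := div_nonpos_of_nonpos_of_nonneg h2 hn0.le
    linarith
  have hNne : N.Nonempty := by
    rw [← card_pos, hNd]
    exact_mod_cast hd0
  obtain ⟨P, Q, hPQ, hun, hcut, hnb⟩ := exists_cutBound G hT hNne
  have hcard : (P.card : ℝ) + Q.card = d := by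
    rw [← hNd, ← hun, card_union_of_disjoint hPQ]
    push_cast
    rfl
  have harcs : arcs G N N = arcs G P P + arcs G Q Q + 2 * arcs G P Q := by
    rw [← hun, arcs_union_left G hPQ, arcs_union_right G hPQ, arcs_union_right G hPQ,
      arcs_comm G Q P]
    ring
  rw [hNd, harcs] at hnb
  have hcut' := hcut.scale (r := (d : ℝ)⁻¹) (by positivity)
  have e1 (x : ℝ) : x / n = d / n * ((d : ℝ)⁻¹ * x) := by field_simp
  have e2 (x : ℝ) : x / n ^ 2 = (d / n) ^ 2 * ((d : ℝ)⁻¹ ^ 2 * x) := by field_simp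
  have htest := hblock hPQ
  have h0 := hblock (disjoint_empty_right N)
  rw [e1 P.card, e1 Q.card, e2 (arcs G P P), e2 (arcs G Q Q), e2 (arcs G P Q)] at htest
  rw [harcs, e2 (_ + _)] at h0
  have hempty : arcs G ∅ ∅ = 0 := by simp [arcs]
  have hempty' : arcs G N ∅ = 0 := by simp [arcs]
  rw [hempty, hempty', hNd, card_empty, Nat.cast_zero, zero_div, zero_div,
    show (d : ℝ)⁻¹ ^ 2 * (arcs G P P + arcs G Q Q + 2 * arcs G P Q) =
      (d : ℝ)⁻¹ ^ 2 * arcs G P P + (d : ℝ)⁻¹ ^ 2 * arcs G Q Q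
        + 2 * ((d : ℝ)⁻¹ ^ 2 * arcs G P Q) by ring] at h0
  have hsum : (d : ℝ)⁻¹ * P.card + (d : ℝ)⁻¹ * Q.card = 1 := by
    rw [← mul_add, hcard, inv_mul_cancel₀ hd0.ne']
  have hPP := mul_nonneg (sq_nonneg (d : ℝ)⁻¹) (arcs_nonneg G P P)
  have hQQ := mul_nonneg (sq_nonneg (d : ℝ)⁻¹) (arcs_nonneg G Q Q)
  have hPQ0 := mul_nonneg (sq_nonneg (d : ℝ)⁻¹) (arcs_nonneg G P Q)
  have hPQ1 := mul_le_mul_of_nonneg_left (arcs_le_card_mul_card G P Q) (sq_nonneg (d : ℝ)⁻¹)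
  have hnb' := mul_le_mul_of_nonneg_left hnb (pow_nonneg (inv_nonneg.2 hd0.le) 4)
  have e3 : (d : ℝ)⁻¹ ^ 4 * (d : ℝ) ^ 2 = (d : ℝ)⁻¹ ^ 2 := by field_simp
  have hδ : d / n ≤ 5 / 8 := by
    rw [div_le_iff₀ hn0, hn]
    have : (8 : ℝ) * d ≤ 5 * Fintype.card V := by exact_mod_cast hle
    linarith
  have hnb2 : (d : ℝ)⁻¹ ^ 2 * arcs G P P + (d : ℝ)⁻¹ ^ 2 * arcs G Q Q ≤
      ((d : ℝ)⁻¹ ^ 2 * arcs G P P + (d : ℝ)⁻¹ ^ 2 * arcs G Q Q + 2 * ((d : ℝ)⁻¹ ^ 2 * arcs G P Q))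
      - 2 * ((d : ℝ)⁻¹ ^ 2 * arcs G P P + (d : ℝ)⁻¹ ^ 2 * arcs G Q Q
        + 2 * ((d : ℝ)⁻¹ ^ 2 * arcs G P Q)) ^ 2 := by
    linear_combination hnb' + (2 * arcs G P Q) * e3
  have hP0 := mul_nonneg (inv_nonneg.2 hd0.le) (Nat.cast_nonneg (α := ℝ) P.card)
  have hQ0 := mul_nonneg (inv_nonneg.2 hd0.le) (Nat.cast_nonneg (α := ℝ) Q.card)
  rcases le_total (d / n) (1 / 2) with hhalf | hhalf
  · exact htest.false_of_le_half h0 hsum hP0 hQ0 hPP hQQ hnb2 hhalf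
  · exact htest.false_of_half_le hcut' hsum hP0 hQ0 hPP hQQ hPQ0
      (by linarith) hnb2 hhalf hδ

lemma card_colorFinset_add_degree_le [Nonempty V] {d : ℕ} (hd : G.IsRegularOfDegree d)
    (C : G.Coloring (Fin 3)) (i : Fin 3) : (colorFinset C i).card + d ≤ Fintype.card V := by
  obtain ⟨v⟩ := ‹Nonempty V›
  rcases (colorFinset C i).eq_empty_or_nonempty with h | ⟨u, hu⟩
  · rw [h, card_empty, zero_add, ← hd v]
    exact (G.degree_lt_card_verts v).le
  · rw [← hd u, ← SimpleGraph.card_neighborFinset_eq_degree, ← card_union_of_disjoint]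
    · exact card_le_univ _
    · rw [disjoint_left]
      intro w hw hn
      simp only [colorFinset, mem_filter, mem_univ, true_and] at hu hw
      rw [SimpleGraph.mem_neighborFinset] at hn
      exact C.valid hn (hu.trans hw.symm)

lemma two_mul_card_eq_of_coloring [Nonempty V] {d : ℕ} (hd : G.IsRegularOfDegree d)
    (hsparse : ∀ S : Finset V, S.card = Fintype.card V / 2 →
      (Fintype.card V : ℝ) ^ 2 / 18 ≤ (edgesIn G S : ℝ))
    (C : G.Coloring (Fin 3)) (hlt : 5 * Fintype.card V < 8 * d) :
    2 * Fintype.card V = 3 * d := by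
  obtain ⟨n, hn⟩ : ∃ n : ℝ, n = Fintype.card V := ⟨_, rfl⟩
  have hn0 : 0 < n := by rw [hn]; exact_mod_cast Fintype.card_pos
  obtain ⟨i, -, hi⟩ := exists_min_image univ (fun i => (colorFinset C i).card)
    ⟨(0 : Fin 3), mem_univ _⟩
  have hsum := card_colorFinset_add C i
  have hun := union_colorFinset C i
  have hdis : Disjoint (colorFinset C i) (colorFinset C (i + 1)) :=
    disjoint_colorFinset C (by clear hi hsum hun; revert i; decide)
  have hdis' : Disjoint (colorFinset C i ∪ colorFinset C (i + 1)) (colorFinset C (i + 2)) := by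
    rw [disjoint_union_left]
    constructor <;> exact disjoint_colorFinset C (by clear hi hsum hun hdis; revert i; decide)
  have hA := card_colorFinset_add_degree_le G hd C i
  have hB := card_colorFinset_add_degree_le G hd C (i + 1)
  have hC := card_colorFinset_add_degree_le G hd C (i + 2)
  have hi1 := hi (i + 1) (mem_univ _)
  have hi2 := hi (i + 2) (mem_univ _)
  have hAA := arcs_colorFinset_self C i
  have hBB := arcs_colorFinset_self C (i + 1)
  have hCC := arcs_colorFinset_self C (i + 2)
  have htest := blockTest G hd hsparse hn hn0 hdis
  set A := colorFinset C i
  set B := colorFinset C (i + 1)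
  set D := colorFinset C (i + 2)
  have hrow (X : Finset V) : arcs G X A + arcs G X B + arcs G X D = d * X.card := by
    rw [← arcs_union_right G hdis, ← arcs_union_right G hdis', hun, arcs_univ_right G hd]
  have hrA := hrow A
  have hrB := hrow B
  have hrD := hrow D
  rw [arcs_comm G D A, arcs_comm G D B] at hrD
  rw [arcs_comm G B A] at hrB
  have hsum' : (A.card : ℝ) + B.card + D.card = n := by rw [hn]; exact_mod_cast hsum
  have hA0 : 0 < (A.card : ℝ) := by
    have : 0 < A.card := by omega
    exact_mod_cast this
  obtain ⟨α, hα⟩ : ∃ α : ℝ, 2 * α * A.card = A.card + D.card - B.card :=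
    ⟨(A.card + D.card - B.card) / (2 * A.card), by field_simp⟩
  have hBn : (B.card : ℝ) ≤ A.card + D.card := by
    have : B.card ≤ A.card + D.card := by omega
    exact_mod_cast this
  have hDn : (D.card : ℝ) ≤ A.card + B.card := by
    have : D.card ≤ A.card + B.card := by omega
    exact_mod_cast this
  have hα0 : 0 ≤ α := by
    by_contra! h
    nlinarith
  have hα1 : α ≤ 1 := by
    by_contra! h
    nlinarith
  have key := htest α 1 0 ⟨hα0, hα1⟩ (by simp) (by simp) (by
    field_simp
    linarith)
  rw [hAA, hBB] at key
  have key2 : n ^ 2 / 9 ≤ 2 * α * arcs G A B := by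
    have := mul_le_mul_of_nonneg_right key (sq_nonneg n)
    have e : arcs G A B / n ^ 2 * n ^ 2 = arcs G A B := by field_simp
    linear_combination this + 2 * α * e
  have key3 : n ^ 2 / 9 * (2 * A.card) ≤ d * A.card ^ 2 := by
    have h1 := mul_le_mul_of_nonneg_right key2 hA0.le
    have h2 : 0 ≤ (d : ℝ) * (D.card - B.card) ^ 2 := by positivity
    have h3 : 2 * α * arcs G A B * A.card =
        (A.card + D.card - B.card) * (d * (A.card + B.card - D.card) / 2) := by
      rw [← hα]
      linear_combination (α * A.card) * (hrA + hrB - hrD - hAA - hBB + hCC)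
    linarith
  have key4 : 2 * n ^ 2 ≤ 9 * (d * A.card) :=
    le_of_mul_le_mul_right (a := (A.card : ℝ)) (by linarith) hA0
  have h3A : 3 * (A.card : ℝ) ≤ n := by
    rw [hn]
    have : 3 * A.card ≤ Fintype.card V := by omega
    exact_mod_cast this
  have key5 : 2 * n ≤ 3 * d := by
    have := mul_le_mul_of_nonneg_left h3A (Nat.cast_nonneg (α := ℝ) d)
    exact le_of_mul_le_mul_right (a := n) (by linarith) hn0
  have key6 : 2 * Fintype.card V ≤ 3 * d := by
    rw [hn] at key5
    exact_mod_cast key5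
  omega

lemma two_dvd_of_card_colorFinset {C : G.Coloring (Fin 3)} {m : ℕ}
    (hsparse : ∀ S : Finset V, S.card = Fintype.card V / 2 →
      (Fintype.card V : ℝ) ^ 2 / 18 ≤ (edgesIn G S : ℝ))
    (hm : Fintype.card V = 3 * m) (hC : ∀ i, (colorFinset C i).card = m) : 2 ∣ m := by
  by_contra hodd
  obtain ⟨k, rfl⟩ : ∃ k, m = 2 * k + 1 := ⟨m / 2, by omega⟩
  obtain ⟨T, hT, hTk⟩ := exists_subset_card_eq
    (show k ≤ (colorFinset C 1).card by rw [hC]; omega)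
  set X := colorFinset C 0 with hX
  have hdis : Disjoint X T :=
    disjoint_of_subset_right hT (disjoint_colorFinset C (by decide))
  have hXX : arcs G X X = 0 := arcs_colorFinset_self C 0
  have hTT : arcs G T T = 0 := by
    refine le_antisymm ?_ (arcs_nonneg G T T)
    rw [← arcs_colorFinset_self C 1]
    unfold arcs
    exact (sum_le_sum fun u _ => sum_le_sum_of_subset_of_nonneg hT fun w _ _ =>
      adjInd_nonneg G u w).trans (sum_le_sum_of_subset_of_nonneg hT fun u _ _ =>
        sum_nonneg fun w _ => adjInd_nonneg G u w)
  have h1 := hsparse (X ∪ T) (by rw [card_union_of_disjoint hdis, hC, hTk, hm]; omega)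
  have h2 := arcs_self_eq G (X ∪ T)
  rw [arcs_union_left G hdis, arcs_union_right G hdis, arcs_union_right G hdis, hXX, hTT,
    arcs_comm G T X] at h2
  have h3 := arcs_le_card_mul_card G X T
  rw [hC, hTk] at h3
  rw [hm] at h1
  push_cast at h1 h3
  nlinarith [Nat.cast_nonneg (α := ℝ) k]

end Assembly

/-- A `K₄`-free regular graph on `n` vertices in which every vertex set of size
`⌊n/2⌋` spans at least `n²/18` edges satisfies `6 ∣ n` and is isomorphic to `T₃(n)`. -/
theorem sparse_halves_K4_regular {n : ℕ} (G : SimpleGraph (Fin n)) [DecidableRel G.Adj]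
    (hK4 : G.CliqueFree 4) (hreg : ∃ d, G.IsRegularOfDegree d)
    (hsparse : ∀ S : Finset (Fin n), S.card = n / 2 →
      (n : ℝ) ^ 2 / 18 ≤ (edgesIn G S : ℝ)) :
    6 ∣ n ∧ Nonempty (G ≃g SimpleGraph.turanGraph n 3) := by
  obtain ⟨d, hd⟩ := hreg
  rcases Nat.eq_zero_or_pos n with rfl | hn
  · exact ⟨dvd_zero 6, ⟨⟨Equiv.refl _, fun {a} => a.elim0⟩⟩⟩
  have : Nonempty (Fin n) := ⟨⟨0, hn⟩⟩
  have hcard : Fintype.card (Fin n) = n := Fintype.card_fin n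
  have hsparse' : ∀ S : Finset (Fin n), S.card = Fintype.card (Fin n) / 2 →
      (Fintype.card (Fin n) : ℝ) ^ 2 / 18 ≤ (edgesIn G S : ℝ) := by simpa using hsparse
  have hlt : 5 * Fintype.card (Fin n) < 8 * d := by
    by_contra! hle
    exact false_of_degree_le G hd hK4 hsparse' hle
  have hmin : d = G.minDegree := hd.minDegree_eq.symm
  obtain ⟨C⟩ : G.Colorable 3 :=
    SimpleGraph.colorable_of_cliqueFree_lt_minDegree hK4 (by rw [← hmin]; omega)
  have h2 := two_mul_card_eq_of_coloring G hd hsparse' C hlt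
  have hiso := (isTuranMaximal_three G hd hK4 h2).nonempty_iso_turanGraph
  rw [hcard] at hiso h2
  refine ⟨?_, hiso⟩
  obtain ⟨m, hm⟩ : ∃ m, n = 3 * m := ⟨n / 3, by omega⟩
  have := two_dvd_of_card_colorFinset G (C := C) (m := m) hsparse' (by omega) fun i => by
    have h3 := card_colorFinset_add C i
    have hA := card_colorFinset_add_degree_le G hd C i
    have hB := card_colorFinset_add_degree_le G hd C (i + 1)
    have hC := card_colorFinset_add_degree_le G hd C (i + 2)
    omega
  omega
end

section
/- Let n be an even natural number. Then every regular K_4-free graph G on n vertices admits a partition of its vertex set into two parts A and B with |A| = |B| = n/2 such that e(A) + e(B) ≤ n²/9; that is, G can be made bipartite by removing at most n²/9 edges so that the two resulting parts each have size exactly n/2. -/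
open Finset

namespace SimpleGraph

section

section

variable {V : Type*} (G : SimpleGraph V) [DecidableRel G.Adj]

/-- The number of neighbours of `x` in `S`, as a real number. -/
def degIn (S : Finset V) (x : V) : ℝ := (#{y ∈ S | G.Adj x y} : ℝ)

lemma degIn_eq_sum (S : Finset V) (x : V) :
    G.degIn S x = ∑ y ∈ S, if G.Adj x y then (1 : ℝ) else 0 := by
  simp [degIn, Finset.sum_boole]

lemma degIn_nonneg (S : Finset V) (x : V) : 0 ≤ G.degIn S x := Nat.cast_nonneg _

end

variable {V : Type*} [Fintype V] [DecidableEq V] (G : SimpleGraph V) [DecidableRel G.Adj]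

/-- The bilinear form of the adjacency matrix of `G`. -/
noncomputable def adjForm : LinearMap.BilinForm ℝ (V → ℝ) := Matrix.toBilin' (G.adjMatrix ℝ)

/-- The indicator vector of `S`. -/
def indVec (S : Finset V) : V → ℝ := fun x => if x ∈ S then 1 else 0

lemma adjForm_apply (f g : V → ℝ) :
    G.adjForm f g = ∑ x, ∑ y, f x * (if G.Adj x y then 1 else 0) * g y := by
  simp [adjForm, Matrix.toBilin'_apply]

lemma adjForm_comm (f g : V → ℝ) : G.adjForm f g = G.adjForm g f := by
  rw [adjForm_apply, adjForm_apply, sum_comm]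
  refine sum_congr rfl fun x _ => sum_congr rfl fun y _ => ?_
  simp only [G.adj_comm x y]
  ring

lemma adjForm_indVec_right (f : V → ℝ) (S : Finset V) :
    G.adjForm f (indVec S) = ∑ x, f x * G.degIn S x := by
  rw [adjForm_apply]
  refine sum_congr rfl fun x _ => ?_
  rw [degIn_eq_sum, mul_sum]
  simp [indVec]

lemma adjForm_indVec (S T : Finset V) :
    G.adjForm (indVec S) (indVec T) = ∑ x ∈ S, G.degIn T x := by
  simp [adjForm_indVec_right, indVec]

lemma adjForm_indVec_nonneg (S T : Finset V) : 0 ≤ G.adjForm (indVec S) (indVec T) := by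
  rw [adjForm_indVec]
  exact sum_nonneg fun x _ => G.degIn_nonneg T x

lemma adjForm_one_left {k : ℕ} (h : G.IsRegularOfDegree k) (f : V → ℝ) :
    G.adjForm 1 f = k * ∑ x, f x := by
  rw [adjForm_comm, adjForm_apply, mul_sum]
  refine sum_congr rfl fun x _ => ?_
  have := h x
  rw [← card_neighborFinset_eq_degree, neighborFinset_eq_filter] at this
  rw [← this]
  simp [Finset.sum_ite, mul_comm]

lemma two_mul_edgesIn (S : Finset V) :
    2 * (edgesIn G S : ℝ) = G.adjForm (indVec S) (indVec S) := by
  classical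
  let H : SimpleGraph V :=
    { Adj := fun x y => G.Adj x y ∧ x ∈ S ∧ y ∈ S
      symm := ⟨fun x y h => ⟨h.1.symm, h.2.2, h.2.1⟩⟩
      loopless := ⟨fun x h => G.loopless.irrefl x h.1⟩ }
  have h1 : edgesIn G S = #H.edgeFinset := by
    unfold edgesIn
    congr 1
    ext e
    induction e with | _ x y => simp [H]
  have h2 := H.sum_degrees_eq_twice_card_edges
  rw [h1, adjForm_indVec]
  have h3 : ((∑ v, H.degree v : ℕ) : ℝ) = 2 * #H.edgeFinset := by exact_mod_cast h2
  rw [← h3]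
  push_cast
  rw [← Finset.sum_subset (Finset.subset_univ S)]
  · refine sum_congr rfl fun x hx => ?_
    rw [← card_neighborFinset_eq_degree, neighborFinset_eq_filter, degIn]
    congr 2
    ext y
    simp [H, hx, and_comm]
  · intro x _ hx
    rw [← card_neighborFinset_eq_degree, neighborFinset_eq_filter]
    simp [H, hx]

lemma exists_sign_vector (hV : Even (Fintype.card V)) (z : V → ℝ) (hz : ∀ x, |z x| ≤ 1)
    (hs : ∑ x, z x = 0) :
    ∃ s : V → ℝ, (∀ x, s x = 1 ∨ s x = -1) ∧ ∑ x, s x = 0 ∧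
      G.adjForm s s ≤ G.adjForm z z := by
  induction hm : #{x | z x ≠ 1 ∧ z x ≠ -1} using Nat.strong_induction_on generalizing z with
  | _ m ih =>
  by_cases h0 : ∀ x, z x = 1 ∨ z x = -1
  · exact ⟨z, h0, hs, le_rfl⟩
  push Not at h0
  obtain ⟨u, hu⟩ := h0
  have step : ∀ u v, (z u ≠ 1 ∧ z u ≠ -1) → (z v ≠ 1 ∧ z v ≠ -1) → u ≠ v →
      G.adjForm z (Pi.single u 1 - Pi.single v 1) ≤ 0 →
      ∃ s : V → ℝ, (∀ x, s x = 1 ∨ s x = -1) ∧ ∑ x, s x = 0 ∧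
      G.adjForm s s ≤ G.adjForm z z := by
    intro u v hu hv huv hL
    set t := min (1 - z u) (1 + z v) with ht
    have hzu := abs_le.1 (hz u)
    have hzv := abs_le.1 (hz v)
    have hu1 : z u < 1 := lt_of_le_of_ne hzu.2 hu.1
    have hv1 : -1 < z v := lt_of_le_of_ne hzv.1 hv.2.symm
    have ht0 : 0 < t := lt_min (by linarith) (by linarith)
    have htu : t ≤ 1 - z u := min_le_left _ _
    have htv : t ≤ 1 + z v := min_le_right _ _
    set w : V → ℝ := z + t • (Pi.single u 1 - Pi.single v 1) with hw
    have hwu : w u = z u + t := by simp [hw, huv]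
    have hwv : w v = z v - t := by simp [hw, huv.symm]; ring
    have hwx : ∀ x, x ≠ u → x ≠ v → w x = z x := by
      intro x hxu hxv; simp [hw, hxu, hxv]
    have hw1 : ∀ x, |w x| ≤ 1 := by
      intro x
      by_cases hxu : x = u
      · subst hxu; rw [hwu, abs_le]; constructor <;> linarith
      by_cases hxv : x = v
      · subst hxv; rw [hwv, abs_le]; constructor <;> linarith
      rw [hwx x hxu hxv]; exact hz x
    have hws : ∑ x, w x = 0 := by
      simp [hw, sum_add_distrib, hs, ← mul_sum, sum_sub_distrib]
    have hQ : G.adjForm w w ≤ G.adjForm z z := by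
      have hd : G.adjForm (Pi.single u 1 - Pi.single v 1) (Pi.single u 1 - Pi.single v 1) ≤ 0 := by
        simp only [map_sub, LinearMap.sub_apply, adjForm, Matrix.toBilin'_single,
          adjMatrix_apply, SimpleGraph.irrefl, if_false]
        split_ifs <;> norm_num
      rw [hw]
      simp only [map_add, LinearMap.add_apply, map_smul, LinearMap.smul_apply, smul_eq_mul]
      rw [G.adjForm_comm (_ - _) z]
      nlinarith [mul_pos ht0 ht0, mul_nonneg ht0.le (neg_nonneg.2 hL),
        mul_nonneg (mul_pos ht0 ht0).le (neg_nonneg.2 hd)]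
    have hlt : #{x | w x ≠ 1 ∧ w x ≠ -1} < m := by
      rw [← hm]
      apply card_lt_card
      rw [ssubset_iff_of_subset]
      · rcases min_choice (1 - z u) (1 + z v) with h | h
        · refine ⟨u, by simp [hu], ?_⟩
          have : w u = 1 := by rw [hwu, ht, h]; ring
          simp [this]
        · refine ⟨v, by simp [hv], ?_⟩
          have : w v = -1 := by rw [hwv, ht, h]; ring
          simp [this]
      · intro x hx
        by_cases hxu : x = u
        · simp [hxu, hu]
        by_cases hxv : x = v
        · simp [hxv, hv]
        simpa [hwx x hxu hxv] using hx
    obtain ⟨s, h1, h2, h3⟩ := ih _ hlt w hw1 hws rfl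
    exact ⟨s, h1, h2, h3.trans hQ⟩
  by_cases h1 : ∃ v, v ≠ u ∧ (z v ≠ 1 ∧ z v ≠ -1)
  · obtain ⟨v, hvu, hv⟩ := h1
    rcases le_total (G.adjForm z (Pi.single u 1 - Pi.single v 1)) 0 with h | h
    · exact step u v hu hv hvu.symm h
    · refine step v u hv hu hvu ?_
      rw [← neg_sub, map_neg]
      linarith
  · exfalso
    push Not at h1
    have key : ∑ x, (z x + 1 - 2 * (if z x = 1 then 1 else 0)) = z u + 1 := by
      rw [sum_eq_single u]
      · simp [hu.1]
      · intro x _ hx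
        by_cases hx1 : z x = 1
        · simp [hx1]; norm_num
        · have := h1 x hx hx1
          simp [this]; norm_num
      · simp
    rw [sum_sub_distrib, sum_add_distrib, hs, ← mul_sum, Finset.sum_boole] at key
    obtain ⟨c, hc⟩ := hV
    simp only [sum_const, card_univ, hc] at key
    have hzu := abs_le.1 (hz u)
    have hu1 : z u < 1 := lt_of_le_of_ne hzu.2 hu.1
    have hu2 : -1 < z u := lt_of_le_of_ne hzu.1 hu.2.symm
    set p := #{x | z x = 1}
    simp only [nsmul_eq_mul, mul_one, Nat.cast_add] at key
    have e1 : (p : ℝ) < c := by linarith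
    have e2 : (c : ℝ) < p + 1 := by linarith
    have e1' : p < c := by exact_mod_cast e1
    have e2' : c < p + 1 := by exact_mod_cast e2
    omega

lemma exists_balanced_cut {k : ℕ} (hV : Even (Fintype.card V)) (hreg : G.IsRegularOfDegree k)
    (z : V → ℝ) (hz : ∀ x, |z x| ≤ 1) (hs : ∑ x, z x = 0) :
    ∃ A B : Finset V, Disjoint A B ∧ A ∪ B = univ ∧
      #A = Fintype.card V / 2 ∧ #B = Fintype.card V / 2 ∧
      4 * ((edgesIn G A : ℝ) + (edgesIn G B : ℝ)) ≤ k * Fintype.card V + G.adjForm z z := by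
  obtain ⟨s, h1, h2, h3⟩ := G.exists_sign_vector hV z hz hs
  set A : Finset V := {x | s x = 1} with hA
  have hAc : ∀ x, x ∈ Aᶜ ↔ s x = -1 := by
    intro x
    rcases h1 x with h | h <;> simp [hA, h] <;> norm_num
  have hsv : s = indVec A - indVec Aᶜ := by
    funext x
    rcases h1 x with h | h
    · simp [indVec, hA, h]
    · have : ¬ (-1 : ℝ) = 1 := by norm_num
      simp [indVec, hA, h, this]
  have hone : (1 : V → ℝ) = indVec A + indVec Aᶜ := by
    funext x
    by_cases hx : x ∈ A <;> simp [indVec, hx]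
  have hcard : (#A : ℝ) = #Aᶜ := by
    have : ∑ x, s x = #A - #Aᶜ := by
      rw [hsv]; simp [indVec, sum_sub_distrib, -mem_compl]
    linarith
  have hcard' : #A = #Aᶜ := by exact_mod_cast hcard
  have hsum := card_add_card_compl A
  refine ⟨A, Aᶜ, disjoint_compl_right, union_compl A, by omega, by omega, ?_⟩
  have hQ1 := G.adjForm_one_left hreg 1
  have hcomm := G.adjForm_comm (indVec A) (indVec Aᶜ)
  have hA2 := G.two_mul_edgesIn A
  have hB2 := G.two_mul_edgesIn Aᶜ
  refine le_trans ?_ (add_le_add_right h3 _)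
  have hQ2 : G.adjForm (1 : V → ℝ) 1 = k * Fintype.card V := by rw [hQ1]; simp
  rw [← hQ2, hone, hsv]
  simp only [map_add, map_sub, LinearMap.add_apply, LinearMap.sub_apply]
  linarith

end

section

variable {V : Type*} [Fintype V] [DecidableEq V] (G : SimpleGraph V) [DecidableRel G.Adj]

/-- Every fractional balanced cut of the `k`-regular graph `G` on `n` vertices leaves more than
`n² / 9` edges inside its parts. -/
def FractionalCutsLarge (k : ℕ) : Prop :=
  ∀ z : V → ℝ, (∀ x, |z x| ≤ 1) → ∑ x, z x = 0 →
    4 / 9 * (Fintype.card V : ℝ) ^ 2 - k * Fintype.card V < G.adjForm z z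

variable {G}

omit [Fintype V] in
lemma indVec_union {P Q : Finset V} (h : Disjoint P Q) :
    indVec (P ∪ Q) = indVec P + indVec Q := by
  funext x
  have : x ∈ P → x ∉ Q := fun hP hQ => Finset.disjoint_left.1 h hP hQ
  by_cases hP : x ∈ P <;> by_cases hQ : x ∈ Q <;> simp_all [indVec]

lemma sum_indVec (S : Finset V) : ∑ x, indVec S x = #S := by
  simp [indVec]

lemma adjForm_mul_lt_of_partition {k : ℕ} (hreg : G.IsRegularOfDegree k)
    (hbad : G.FractionalCutsLarge k) {P Q : Finset V} (hPQ : Disjoint P Q)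
    (hk : #(P ∪ Q) = k) (hkn : (k : ℝ) < Fintype.card V)
    (hP : (#P : ℝ) - #Q ≤ Fintype.card V - k) (hQ : (#Q : ℝ) - #P ≤ Fintype.card V - k)
    {t q : ℝ} (ht : G.adjForm (indVec (P ∪ Q)) (indVec (P ∪ Q)) = t)
    (hq : G.adjForm (indVec P) (indVec P) + G.adjForm (indVec Q) (indVec Q) = q)
    (htk : t < k * Fintype.card V) :
    (4 / 9 * (Fintype.card V : ℝ) ^ 2 - k * Fintype.card V + t - 2 * q)
      * (k * Fintype.card V - t) < q ^ 2 := by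
  set n : ℝ := (Fintype.card V : ℝ) with hn
  have hcard : (#P : ℝ) + #Q = k := by
    rw [← hk, card_union_of_disjoint hPQ]; push_cast; ring
  set s : ℝ := -((#P : ℝ) - #Q) / (n - k) with hs
  have hpos : 0 < n - k := by linarith
  have hsn : s * (n - k) = -((#P : ℝ) - #Q) := by rw [hs]; field_simp
  have hs1 : |s| ≤ 1 := by
    rw [hs, abs_div, abs_of_pos hpos, div_le_one hpos, abs_le]
    constructor <;> linarith
  set z : V → ℝ := indVec P - indVec Q + s • (1 - indVec (P ∪ Q)) with hz
  have h1 : ∀ x, |z x| ≤ 1 := by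
    intro x
    have : x ∈ P → x ∉ Q := fun hP hQ => Finset.disjoint_left.1 hPQ hP hQ
    by_cases hP : x ∈ P <;> by_cases hQ : x ∈ Q <;> simp_all [indVec]
  have h2 : ∑ x, z x = 0 := by
    simp only [hz, Pi.add_apply, Pi.sub_apply, Pi.smul_apply, smul_eq_mul, sum_add_distrib,
      sum_sub_distrib, ← mul_sum, sum_indVec, hk, Pi.one_apply, sum_const, card_univ,
      nsmul_eq_mul, mul_one]
    rw [← hn, hsn]; ring
  have h3 := hbad z h1 h2
  have e11 := G.adjForm_one_left hreg 1
  have e1P := G.adjForm_one_left hreg (indVec P)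
  have e1Q := G.adjForm_one_left hreg (indVec Q)
  have cP := G.adjForm_comm (indVec P) 1
  have cQ := G.adjForm_comm (indVec Q) 1
  have cPQ := G.adjForm_comm (indVec Q) (indVec P)
  have nP := G.adjForm_indVec_nonneg P P
  have nQ := G.adjForm_indVec_nonneg Q Q
  rw [sum_indVec] at e1P e1Q
  simp only [Pi.one_apply, sum_const, card_univ, nsmul_eq_mul, mul_one] at e11
  rw [← hn] at e11 h3
  rw [indVec_union hPQ] at ht
  simp only [map_add, LinearMap.add_apply] at ht
  set p := G.adjForm (indVec P) (indVec P)
  set r := G.adjForm (indVec Q) (indVec Q)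
  have h4 : G.adjForm z z = 2 * q - t - 2 * s * (p - r) - s ^ 2 * (k * n - t) := by
    rw [hz, indVec_union hPQ]
    simp only [map_add, map_sub, map_smul, LinearMap.add_apply, LinearMap.sub_apply,
      LinearMap.smul_apply, smul_eq_mul, e11, cP, cQ, e1P, e1Q, cPQ]
    rw [cPQ] at ht
    have hr : (#P : ℝ) = (k - s * (n - k)) / 2 := by linarith
    have hr' : (#Q : ℝ) = (k + s * (n - k)) / 2 := by linarith
    rw [hr, hr', ← ht, ← hq]
    simp only [p, r]
    ring
  rw [h4] at h3
  have hD : 0 < k * n - t := by linarith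
  nlinarith [mul_pos hD (sub_pos.2 h3), sq_nonneg (s * (k * n - t) + (p - r)),
    mul_nonneg nP nQ]

lemma lt_adjForm_neighborFinset {k : ℕ} (hreg : G.IsRegularOfDegree k)
    (hbad : G.FractionalCutsLarge k) (hk : (Fintype.card V : ℝ) ≤ 2 * k) (hn : 0 < Fintype.card V)
    {S : Finset V} (hS : #S = k) :
    4 / 9 * (k : ℝ) ^ 2 < G.adjForm (indVec S) (indVec S) := by
  have hn' : (0 : ℝ) < Fintype.card V := by exact_mod_cast hn
  set n : ℝ := (Fintype.card V : ℝ) with hndef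
  have hk0 : (0 : ℝ) < k := by linarith
  have h3 := hbad (1 - (n / k) • indVec S) ?_ ?_
  · have e11 := G.adjForm_one_left hreg 1
    have e1S := G.adjForm_one_left hreg (indVec S)
    have cS := G.adjForm_comm (indVec S) 1
    rw [sum_indVec, hS] at e1S
    simp only [Pi.one_apply, sum_const, card_univ, nsmul_eq_mul, mul_one] at e11
    rw [← hndef] at e11 h3
    simp only [map_sub, map_smul, LinearMap.sub_apply,
      LinearMap.smul_apply, smul_eq_mul, e11, cS, e1S] at h3
    set t := G.adjForm (indVec S) (indVec S)
    have : 4 / 9 * n ^ 2 < n ^ 2 * (t / k ^ 2) := by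
      have e : n / k * (k * k) = n * k := by field_simp
      have e' : n / k * (n / k * t) = n ^ 2 * (t / k ^ 2) := by field_simp
      linarith
    have : 4 / 9 < t / k ^ 2 := by
      have hn2 : 0 < n ^ 2 := by positivity
      nlinarith
    rwa [lt_div_iff₀ (by positivity)] at this
  · intro x
    have h1 : n / k ≤ 2 := by rw [div_le_iff₀ hk0]; linarith
    have h0 : 0 ≤ n / k := by positivity
    by_cases hx : x ∈ S <;> simp [indVec, hx]
    rw [abs_le]; constructor <;> linarith
  · simp only [Pi.sub_apply, Pi.smul_apply, smul_eq_mul,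
      sum_sub_distrib, ← mul_sum, sum_indVec, hS, Pi.one_apply, sum_const, card_univ,
      nsmul_eq_mul, mul_one]
    rw [← hndef]; field_simp; ring

lemma lt_adjForm_neighborFinset_of_sparse {k : ℕ} (hreg : G.IsRegularOfDegree k)
    (hbad : G.FractionalCutsLarge k) (hk : 2 * (k : ℝ) ≤ Fintype.card V) (hn : 0 < Fintype.card V)
    {S : Finset V} (hS : #S = k) :
    (4 / 9 * (Fintype.card V : ℝ) ^ 2 - k * Fintype.card V) * (Fintype.card V - k) ^ 2
      + k ^ 3 * Fintype.card V
      < Fintype.card V ^ 2 * G.adjForm (indVec S) (indVec S) := by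
  have hn' : (0 : ℝ) < Fintype.card V := by exact_mod_cast hn
  set n : ℝ := (Fintype.card V : ℝ) with hndef
  have hk0 : (0 : ℝ) ≤ k := by positivity
  have hpos : 0 < n - k := by linarith
  have hs : n / (n - k) = 1 + k / (n - k) := by field_simp; ring
  have hc1 : k / (n - k) ≤ 1 := by rw [div_le_one hpos]; linarith
  have hc0 : 0 ≤ k / (n - k) := by positivity
  have h3 := hbad ((k / (n - k)) • 1 - (n / (n - k)) • indVec S) ?_ ?_
  · have e11 := G.adjForm_one_left hreg 1
    have e1S := G.adjForm_one_left hreg (indVec S)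
    have cS := G.adjForm_comm (indVec S) 1
    rw [sum_indVec, hS] at e1S
    simp only [Pi.one_apply, sum_const, card_univ, nsmul_eq_mul, mul_one] at e11
    rw [← hndef] at e11 h3
    simp only [map_sub, map_smul, LinearMap.sub_apply,
      LinearMap.smul_apply, smul_eq_mul, e11, cS, e1S] at h3
    set t := G.adjForm (indVec S) (indVec S)
    have e : (k / (n - k)) * (k / (n - k) * (k * n) - n / (n - k) * (k * k))
      - n / (n - k) * (k / (n - k) * (k * k) - n / (n - k) * t)
        = (n ^ 2 * t - k ^ 3 * n) / (n - k) ^ 2 := by field_simp; ring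
    have h4 : 4 / 9 * n ^ 2 - k * n < (n ^ 2 * t - k ^ 3 * n) / (n - k) ^ 2 := by
      rw [← e]; linarith
    rw [lt_div_iff₀ (by positivity)] at h4
    linarith
  · intro x
    by_cases hx : x ∈ S <;> simp [indVec, hx]
    · rw [hs]; simp
    · rwa [abs_of_nonneg hc0]
  · simp only [Pi.sub_apply, Pi.smul_apply, smul_eq_mul,
      sum_sub_distrib, ← mul_sum, sum_indVec, hS, Pi.one_apply, sum_const, card_univ,
      nsmul_eq_mul, mul_one]
    rw [← hndef]; field_simp; ring

lemma card_inter_neighborFinset (S : Finset V) (x : V) :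
    (#(S ∩ G.neighborFinset x) : ℝ) = G.degIn S x := by
  rw [degIn, neighborFinset_eq_filter, inter_filter, inter_univ]

lemma lt_adjForm_add_adjForm {k : ℕ} (hreg : G.IsRegularOfDegree k)
    (hbad : G.FractionalCutsLarge k) (hk : (Fintype.card V : ℝ) ≤ 2 * k)
    {S T : Finset V} (hS : #S = k) (hT : #T = k) (hST : 0 < #(S ∩ T))
    (hind : G.adjForm (indVec (S ∩ T)) (indVec (S ∩ T)) = 0) :
    4 / 9 * (Fintype.card V : ℝ) ^ 2 + 4 * k ^ 2 - 2 * k * Fintype.card V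
      - 2 * (2 * k - Fintype.card V) * (#(S ∩ T) - 2 * k + Fintype.card V)
      < 2 * (G.adjForm (indVec S) (indVec S) + G.adjForm (indVec T) (indVec T)) := by
  set N := S ∩ T with hN
  set M := (S ∪ T)ᶜ with hM
  set n : ℝ := (Fintype.card V : ℝ) with hn
  set c : ℝ := (#N : ℝ) with hc
  set m : ℝ := (#M : ℝ) with hm
  have hmc : m = c - (2 * k - n) := by
    have h1 := card_compl_add_card (S ∪ T)
    have h2 := card_union_add_card_inter S T
    rw [← hM] at h1
    rw [← hN, hS, hT] at h2
    have h1' : m + (#(S ∪ T) : ℝ) = n := by rw [hm, hn]; exact_mod_cast h1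
    have h2' : (#(S ∪ T) : ℝ) + c = k + k := by rw [hc]; exact_mod_cast h2
    linarith
  have hc0 : 0 < c := by rw [hc]; exact_mod_cast hST
  have hm0 : 0 ≤ m := Nat.cast_nonneg _
  have hmc1 : m / c ≤ 1 := by rw [div_le_one hc0]; linarith
  have hmc0 : 0 ≤ m / c := by positivity
  set f : V → ℝ := indVec S - indVec T with hf
  set w : V → ℝ := (m / c) • indVec N - indVec M with hw
  have hsum : indVec S + indVec T = 1 + indVec N - indVec M := by
    funext x
    by_cases h1 : x ∈ S <;> by_cases h2 : x ∈ T <;> simp [indVec, hN, hM, h1, h2]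
  have hfs : ∑ x, f x = 0 := by
    simp [hf, sum_sub_distrib, sum_indVec, hS, hT]
  have hws : ∑ x, w x = 0 := by
    simp only [hw, Pi.sub_apply, Pi.smul_apply, smul_eq_mul, sum_sub_distrib, ← mul_sum,
      sum_indVec]
    rw [← hc, ← hm]; field_simp; ring
  have h1 := hbad (f + w) ?_ (by simp [sum_add_distrib, hfs, hws])
  have h2 := hbad (w - f) ?_ (by simp [sum_sub_distrib, hfs, hws])
  · have e11 := G.adjForm_one_left hreg 1
    have e1N := G.adjForm_one_left hreg (indVec N)
    have e1M := G.adjForm_one_left hreg (indVec M)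
    have cN := G.adjForm_comm (indVec N) 1
    have cM := G.adjForm_comm (indVec M) 1
    have cNM := G.adjForm_comm (indVec M) (indVec N)
    rw [sum_indVec] at e1N e1M
    simp only [Pi.one_apply, sum_const, card_univ, nsmul_eq_mul, mul_one] at e11
    have q1 : G.adjForm (indVec S + indVec T) (indVec S + indVec T)
        = k * n + 2 * k * (c - m) - 2 * G.adjForm (indVec N) (indVec M)
          + G.adjForm (indVec M) (indVec M) := by
      rw [hsum]
      simp only [map_add, map_sub, LinearMap.add_apply, LinearMap.sub_apply, e11, cN, cM, e1N,
        e1M, cNM, hind]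
      ring
    have q2 : G.adjForm (indVec S + indVec T) (indVec S + indVec T)
        = 2 * (G.adjForm (indVec S) (indVec S) + G.adjForm (indVec T) (indVec T))
          - G.adjForm f f := by
      rw [hf]
      simp only [map_add, map_sub, LinearMap.add_apply, LinearMap.sub_apply]
      ring
    have q3 : G.adjForm w w = - 2 * (m / c) * G.adjForm (indVec N) (indVec M)
        + G.adjForm (indVec M) (indVec M) := by
      rw [hw]
      simp only [map_sub, map_smul, LinearMap.sub_apply, LinearMap.smul_apply, smul_eq_mul, hind,
        cNM]
      ring
    have q4 : G.adjForm (f + w) (f + w) + G.adjForm (w - f) (w - f)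
        = 2 * (G.adjForm f f + G.adjForm w w) := by
      simp only [map_add, map_sub, LinearMap.add_apply, LinearMap.sub_apply]
      ring
    have q5 : G.adjForm (indVec N) (indVec M) ≤ c * m := by
      rw [adjForm_indVec]
      calc ∑ x ∈ N, G.degIn M x ≤ ∑ x ∈ N, m :=
            sum_le_sum fun x _ => by
              rw [hm, degIn]; exact_mod_cast card_filter_le _ _
        _ = c * m := by simp [hc]
    have q6 : (1 - m / c) * G.adjForm (indVec N) (indVec M) ≤ (1 - m / c) * (c * m) :=
      mul_le_mul_of_nonneg_left q5 (by linarith)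
    have q7 : (1 - m / c) * (c * m) = (2 * k - n) * m := by
      have : (1 - m / c) * (c * m) = (c - m) * m := by field_simp
      rw [this, hmc]; ring
    rw [hmc] at q7 q1
    rw [hmc] at q3 q6
    rw [← hn] at h1 h2
    nlinarith
  all_goals
    intro x
    have hx := congrFun hsum x
    by_cases h1 : x ∈ S <;> by_cases h2 : x ∈ T <;>
      simp [indVec, hf, hw, hN, hM, h1, h2, abs_of_nonneg hmc0, hmc1]

end

section

section

variable {V : Type*} {G : SimpleGraph V}

/-- No triangle of `G` has all its vertices in `S`. -/
def TriangleFreeOn (G : SimpleGraph V) (S : Finset V) : Prop :=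
  ∀ x ∈ S, ∀ y ∈ S, ∀ z ∈ S, G.Adj x y → G.Adj x z → ¬ G.Adj y z

lemma TriangleFreeOn.mono {S T : Finset V} (h : G.TriangleFreeOn T) (hST : S ⊆ T) :
    G.TriangleFreeOn S :=
  fun x hx y hy z hz => h x (hST hx) y (hST hy) z (hST hz)

variable [DecidableRel G.Adj]

lemma degIn_le_card (S : Finset V) (x : V) : G.degIn S x ≤ #S := by
  rw [degIn]
  exact_mod_cast card_filter_le _ _

variable [DecidableEq V]

lemma degIn_union {P Q : Finset V} (h : Disjoint P Q) (x : V) :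
    G.degIn (P ∪ Q) x = G.degIn P x + G.degIn Q x := by
  simp only [degIn_eq_sum, sum_union h]

lemma TriangleFreeOn.degIn_add_degIn_le {S : Finset V} (h : G.TriangleFreeOn S) {x y : V}
    (hx : x ∈ S) (hy : y ∈ S) (hxy : G.Adj x y) : G.degIn S x + G.degIn S y ≤ #S := by
  have hd : Disjoint {z ∈ S | G.Adj x z} {z ∈ S | G.Adj y z} := by
    rw [Finset.disjoint_left]
    intro z hz hz'
    rw [mem_filter] at hz hz'
    exact h x hx y hy z hz.1 hxy hz.2 hz'.2
  have := card_union_of_disjoint hd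
  have h2 : #({z ∈ S | G.Adj x z} ∪ {z ∈ S | G.Adj y z}) ≤ #S :=
    card_le_card (union_subset (filter_subset _ _) (filter_subset _ _))
  rw [this] at h2
  rw [degIn, degIn]
  exact_mod_cast h2

omit [DecidableEq V] in
lemma TriangleFreeOn.degIn_eq_zero_of_subset_neighbors {S I : Finset V} (h : G.TriangleFreeOn S)
    {x : V} (hx : x ∈ S) (hI : I ⊆ {z ∈ S | G.Adj x z}) {y : V} (hy : y ∈ I) :
    G.degIn I y = 0 := by
  rw [degIn, Nat.cast_eq_zero, card_eq_zero, filter_eq_empty_iff]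
  intro z hz
  have h1 := mem_filter.1 (hI hy)
  have h2 := mem_filter.1 (hI hz)
  exact h x hx y h1.1 z h2.1 h1.2 h2.2

end

variable {V : Type*} [Fintype V] [DecidableEq V] {G : SimpleGraph V} [DecidableRel G.Adj]

lemma exists_adj_le_degIn_add_degIn {S : Finset V}
    (hS : 0 < G.adjForm (indVec S) (indVec S)) :
    ∃ x ∈ S, ∃ y ∈ S, G.Adj x y ∧
      2 * G.adjForm (indVec S) (indVec S) ≤ #S * (G.degIn S x + G.degIn S y) := by
  rw [adjForm_indVec] at *
  set t := ∑ x ∈ S, G.degIn S x with ht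
  by_contra! hcon
  have hcs : t ^ 2 ≤ #S * ∑ x ∈ S, G.degIn S x ^ 2 := sq_sum_le_card_mul_sum_sq
  obtain ⟨x, hx, hdx⟩ := exists_lt_of_sum_lt (s := S) (f := fun _ => (0 : ℝ))
    (g := G.degIn S) (by simpa using hS)
  have hpos : 0 < ∑ x ∈ S, ∑ y ∈ S, (if G.Adj x y then (1 : ℝ) else 0) *
      (2 * t - #S * (G.degIn S x + G.degIn S y)) := by
    have hnn : ∀ x ∈ S, ∀ y ∈ S, 0 ≤ (if G.Adj x y then (1 : ℝ) else 0) *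
        (2 * t - #S * (G.degIn S x + G.degIn S y)) := by
      intro x hx y hy
      by_cases h : G.Adj x y
      · have := hcon x hx y hy h
        simp only [h, if_true]; linarith
      · simp [h]
    refine sum_pos' (fun x hx => sum_nonneg (hnn x hx)) ⟨x, hx, ?_⟩
    rw [degIn, Nat.cast_pos, card_pos] at hdx
    obtain ⟨y, hy⟩ := hdx
    rw [mem_filter] at hy
    refine sum_pos' (hnn x hx) ⟨y, hy.1, ?_⟩
    have := hcon x hx y hy.1 hy.2
    simp only [hy.2, if_true]; linarith
  have e1 : ∑ x ∈ S, ∑ y ∈ S, (if G.Adj x y then (1 : ℝ) else 0) * G.degIn S x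
      = ∑ x ∈ S, G.degIn S x ^ 2 := by
    refine sum_congr rfl fun x _ => ?_
    rw [← sum_mul, ← degIn_eq_sum, sq]
  have e2 : ∑ x ∈ S, ∑ y ∈ S, (if G.Adj x y then (1 : ℝ) else 0) * G.degIn S y
      = ∑ x ∈ S, G.degIn S x ^ 2 := by
    rw [← e1, sum_comm]
    simp only [G.adj_comm]
  have e3 : ∑ x ∈ S, ∑ y ∈ S, (if G.Adj x y then (1 : ℝ) else 0) = t := by
    simp only [ht, degIn_eq_sum]
  have e4 : ∑ x ∈ S, ∑ y ∈ S, (if G.Adj x y then (1 : ℝ) else 0) *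
      (2 * t - #S * (G.degIn S x + G.degIn S y))
      = 2 * t * t - #S * (2 * ∑ x ∈ S, G.degIn S x ^ 2) := by
    calc _ = ∑ x ∈ S, ∑ y ∈ S, (2 * t * (if G.Adj x y then (1 : ℝ) else 0)
          - #S * ((if G.Adj x y then (1 : ℝ) else 0) * G.degIn S x
            + (if G.Adj x y then (1 : ℝ) else 0) * G.degIn S y)) :=
          sum_congr rfl fun x _ => sum_congr rfl fun y _ => by ring
      _ = _ := by
          simp only [sum_sub_distrib, ← mul_sum, sum_add_distrib]
          rw [e1, e2, e3]; ring
  rw [e4] at hpos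
  nlinarith

lemma TriangleFreeOn.two_mul_adjForm_le {S : Finset V} (h : G.TriangleFreeOn S) :
    2 * G.adjForm (indVec S) (indVec S) ≤ (#S : ℝ) ^ 2 := by
  rcases (G.adjForm_indVec_nonneg S S).eq_or_lt with h0 | h0
  · have := sq_nonneg (#S : ℝ)
    linarith
  · obtain ⟨x, hx, y, hy, hxy, hle⟩ := exists_adj_le_degIn_add_degIn h0
    have := h.degIn_add_degIn_le hx hy hxy
    have hS : (0 : ℝ) ≤ #S := Nat.cast_nonneg _
    nlinarith

lemma degIn_mul_degIn_add_adjForm_le {S I J : Finset V} (h : G.TriangleFreeOn S) (hI : I ⊆ S)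
    (hJ : J ⊆ S) {r : V} (hr : r ∈ S) :
    G.degIn I r * G.degIn J r + G.adjForm (indVec I) (indVec J) ≤ #I * #J := by
  rw [adjForm_indVec]
  simp only [degIn_eq_sum]
  rw [sum_mul_sum]
  simp only [← sum_add_distrib]
  calc _ ≤ ∑ x ∈ I, ∑ y ∈ J, (1 : ℝ) := by
        refine sum_le_sum fun x hx => sum_le_sum fun y hy => ?_
        have := h r hr x (hI hx) y (hJ hy)
        split_ifs <;> simp_all
    _ = _ := by simp

lemma mul_three_mul_add_le {ρ a u w : ℝ} (hρ : 0 ≤ ρ) (ha : 4 * ρ ≤ a) (hu : 0 ≤ u)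
    (huw : u ≤ w) (hw : w ≤ a) : ρ * (3 * u + w) ≤ ρ * a + u * w := by
  rcases le_total u ρ with h | h
  · nlinarith [mul_nonneg (sub_nonneg.2 h) (sub_nonneg.2 hw), mul_nonneg hu (sub_nonneg.2 ha)]
  · nlinarith [mul_nonneg (sub_nonneg.2 h) (sub_nonneg.2 huw), mul_nonneg hρ (sub_nonneg.2 ha),
      sq_nonneg (u - 2 * ρ)]

lemma nine_mul_sq_le {i j ρ m t : ℝ} (hm : 0 < m) (hρ : 0 ≤ ρ) (h : i + j + ρ = m)
    (hle : 2 * t ≤ m * (i + j)) (ht : 4 * m ^ 2 ≤ 9 * t) : 9 * ρ ^ 2 ≤ m ^ 2 - 2 * t := by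
  have h1 : m * ρ ≤ m ^ 2 - 2 * t := by
    rw [show i + j = m - ρ by linarith] at hle
    linarith
  have h0 : 0 ≤ m * ρ := by positivity
  have h2 : m ^ 2 * (9 * ρ ^ 2) ≤ m ^ 2 * (m ^ 2 - 2 * t) := by
    nlinarith [mul_le_mul h1 h1 h0 (h0.trans h1)]
  exact le_of_mul_le_mul_left h2 (by positivity)

/-- A triangle-free set can be split into two parts spanning few edges. -/
lemma TriangleFreeOn.exists_partition {S : Finset V} (h : G.TriangleFreeOn S)
    (hS : 0 < G.adjForm (indVec S) (indVec S)) :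
    ∃ P Q : Finset V, Disjoint P Q ∧ P ∪ Q = S ∧
      (∀ g : ℝ, (∀ x ∈ S, g ≤ G.degIn S x) → g ≤ #P ∧ g ≤ #Q) ∧
      2 * (#S : ℝ) ^ 2 * (G.adjForm (indVec P) (indVec P) + G.adjForm (indVec Q) (indVec Q))
        ≤ (#S : ℝ) ^ 4 - 4 * G.adjForm (indVec S) (indVec S) ^ 2 ∧
      (4 * (#S : ℝ) ^ 2 ≤ 9 * G.adjForm (indVec S) (indVec S) →
        3 * (G.adjForm (indVec P) (indVec P) + G.adjForm (indVec Q) (indVec Q))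
          ≤ (#S : ℝ) ^ 2 - 2 * G.adjForm (indVec S) (indVec S)) := by
  obtain ⟨x, hx, y, hy, hxy, hle⟩ := exists_adj_le_degIn_add_degIn hS
  set t := G.adjForm (indVec S) (indVec S) with ht
  set I : Finset V := {z ∈ S | G.Adj x z} with hI
  set J : Finset V := {z ∈ S | G.Adj y z} with hJ
  have hIS : I ⊆ S := filter_subset _ _
  have hJS : J ⊆ S := filter_subset _ _
  have hIJ : Disjoint I J := by
    rw [Finset.disjoint_left]
    intro z hz hz'
    rw [mem_filter] at hz hz'
    exact h x hx y hy z hz.1 hxy hz.2 hz'.2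
  set R := S \ (I ∪ J) with hR
  have hRS : R ⊆ S := sdiff_subset
  have hRIJ : Disjoint (I ∪ J) R := disjoint_sdiff
  have hS' : (I ∪ J) ∪ R = S := union_sdiff_of_subset (union_subset hIS hJS)
  have hRI : Disjoint I R := hRIJ.mono_left subset_union_left
  have hRJ : Disjoint J R := hRIJ.mono_left subset_union_right
  set R₁ : Finset V := {r ∈ R | G.degIn I r ≤ G.degIn J r} with hR₁
  set R₂ : Finset V := {r ∈ R | ¬ G.degIn I r ≤ G.degIn J r} with hR₂
  have hR₁R : R₁ ⊆ R := filter_subset _ _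
  have hR₂R : R₂ ⊆ R := filter_subset _ _
  have hR12 : Disjoint R₁ R₂ := disjoint_filter_filter_not _ _ _
  have hR' : R₁ ∪ R₂ = R := filter_union_filter_not_eq _ _
  have dIR₁ : Disjoint I R₁ := hRI.mono_right hR₁R
  have dJR₂ : Disjoint J R₂ := hRJ.mono_right hR₂R
  have hi : (#I : ℝ) = G.degIn S x := rfl
  have hj : (#J : ℝ) = G.degIn S y := rfl
  have hcard : (#I : ℝ) + #J + #R = #S := by
    rw [← hS', card_union_of_disjoint hRIJ, card_union_of_disjoint hIJ]; push_cast; ring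
  have hII : G.adjForm (indVec I) (indVec I) = 0 := by
    rw [adjForm_indVec]
    exact sum_eq_zero fun z hz => h.degIn_eq_zero_of_subset_neighbors hx subset_rfl hz
  have hJJ : G.adjForm (indVec J) (indVec J) = 0 := by
    rw [adjForm_indVec]
    exact sum_eq_zero fun z hz => h.degIn_eq_zero_of_subset_neighbors hy subset_rfl hz
  have hmant := (h.mono hRS).two_mul_adjForm_le
  set e := G.adjForm (indVec R) (indVec R) with he
  set b := G.adjForm (indVec I) (indVec J) with hb
  set mn : V → ℝ := fun r => min (G.degIn I r) (G.degIn J r) with hmn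
  set mx : V → ℝ := fun r => max (G.degIn I r) (G.degIn J r) with hmx
  have hsplit : ∀ f : V → ℝ, ∑ r ∈ R, f r = ∑ r ∈ R₁, f r + ∑ r ∈ R₂, f r := by
    intro f; rw [← hR', sum_union hR12]
  have ht' : t = 2 * b + 2 * ∑ r ∈ R, (mn r + mx r) + e := by
    have c1 := G.adjForm_comm (indVec J) (indVec I)
    have c2 := G.adjForm_comm (indVec I) (indVec R)
    have c3 := G.adjForm_comm (indVec J) (indVec R)
    have e1 := G.adjForm_indVec R I
    have e2 := G.adjForm_indVec R J
    have e3 : ∑ r ∈ R, (mn r + mx r) = ∑ r ∈ R, G.degIn I r + ∑ r ∈ R, G.degIn J r := by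
      rw [← sum_add_distrib]
      exact sum_congr rfl fun r _ => min_add_max _ _
    rw [e3, ← e1, ← e2, ht, ← hS', indVec_union hRIJ, indVec_union hIJ]
    simp only [map_add, LinearMap.add_apply]
    rw [hII, hJJ, c1, c2, c3]
    ring
  have hq : G.adjForm (indVec (I ∪ R₁)) (indVec (I ∪ R₁))
      + G.adjForm (indVec (J ∪ R₂)) (indVec (J ∪ R₂)) ≤ 2 * ∑ r ∈ R, mn r + e := by
    have c2 := G.adjForm_comm (indVec I) (indVec R₁)
    have c3 := G.adjForm_comm (indVec J) (indVec R₂)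
    have c4 := G.adjForm_comm (indVec R₂) (indVec R₁)
    have e1 : G.adjForm (indVec R₁) (indVec I) = ∑ r ∈ R₁, mn r := by
      rw [adjForm_indVec]
      exact sum_congr rfl fun r hr => (min_eq_left (mem_filter.1 hr).2).symm
    have e2 : G.adjForm (indVec R₂) (indVec J) = ∑ r ∈ R₂, mn r := by
      rw [adjForm_indVec]
      exact sum_congr rfl fun r hr => (min_eq_right (not_le.1 (mem_filter.1 hr).2).le).symm
    have n12 := G.adjForm_indVec_nonneg R₁ R₂
    rw [hsplit mn, ← e1, ← e2, he, ← hR', indVec_union hR12, indVec_union dIR₁,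
      indVec_union dJR₂]
    simp only [map_add, LinearMap.add_apply]
    rw [hII, hJJ, c2, c3, c4]
    linarith
  have hi0 : (0 : ℝ) ≤ #I := Nat.cast_nonneg _
  have hj0 : (0 : ℝ) ≤ #J := Nat.cast_nonneg _
  have hr0 : (0 : ℝ) ≤ #R := Nat.cast_nonneg _
  have hm0 : (0 : ℝ) < #S := by exact_mod_cast card_pos.2 ⟨x, hx⟩
  rw [← hi, ← hj] at hle
  set i : ℝ := (#I : ℝ)
  set j : ℝ := (#J : ℝ)
  set ρ : ℝ := (#R : ℝ) with hρ
  set m : ℝ := (#S : ℝ)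
  refine ⟨I ∪ R₁, J ∪ R₂, ?_, ?_, ?_, ?_, ?_⟩
  · rw [disjoint_union_left, disjoint_union_right, disjoint_union_right]
    exact ⟨⟨hIJ, hRI.mono_right hR₂R⟩, (hRJ.mono_right hR₁R).symm, hR12⟩
  · rw [← hS', ← hR', union_union_union_comm]
  · intro g hg
    have h1 : i ≤ (#(I ∪ R₁) : ℝ) := Nat.cast_le.2 (card_le_card subset_union_left)
    have h2 : j ≤ (#(J ∪ R₂) : ℝ) := Nat.cast_le.2 (card_le_card subset_union_left)
    exact ⟨(hg x hx).trans h1, (hg y hy).trans h2⟩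
  · have h1 : ∑ r ∈ R, mn r ≤ ρ * ((i + j) / 2) := by
      have : ∀ r ∈ R, mn r ≤ (i + j) / 2 := fun r _ => by
        have a1 : mn r ≤ i := (min_le_left _ _).trans (degIn_le_card _ _)
        have a2 : mn r ≤ j := (min_le_right _ _).trans (degIn_le_card _ _)
        linarith
      simpa [hρ] using sum_le_card_nsmul R mn _ this
    have hρ' : ρ = m - (i + j) := by linarith
    have h2 : G.adjForm (indVec (I ∪ R₁)) (indVec (I ∪ R₁))
      + G.adjForm (indVec (J ∪ R₂)) (indVec (J ∪ R₂)) ≤ (m ^ 2 - (i + j) ^ 2) / 2 := by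
      rw [hρ'] at h1 hmant
      nlinarith
    have h3 : (2 * t) ^ 2 ≤ (m * (i + j)) ^ 2 := pow_le_pow_left₀ (by linarith) hle 2
    nlinarith [mul_le_mul_of_nonneg_left h2 (by positivity : 0 ≤ 2 * m ^ 2)]
  · intro h49
    set a := max i j with ha
    have hij : 8 / 9 * m ≤ i + j := by nlinarith
    have hρ9 : 9 * ρ ≤ m := by linarith
    have haρ : 4 * ρ ≤ a := by
      have := le_max_left i j
      have := le_max_right i j
      linarith
    have hpt : ∀ r ∈ R, ρ * (3 * mn r + mx r) ≤ ρ * a + (i * j - b) := by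
      intro r hr
      have h1 := degIn_mul_degIn_add_adjForm_le h hIS hJS (hRS hr)
      have h2 : mn r * mx r = G.degIn I r * G.degIn J r := min_mul_max _ _
      have h3 : mn r ≤ mx r := min_le_max
      have h4 : mx r ≤ a := max_le_max (degIn_le_card _ _) (degIn_le_card _ _)
      have h5 : 0 ≤ mn r := le_min (degIn_nonneg _ _ _) (degIn_nonneg _ _ _)
      have h6 := mul_three_mul_add_le hr0 haρ h5 h3 h4
      linarith
    have hsum : 3 * ∑ r ∈ R, mn r + ∑ r ∈ R, mx r ≤ ρ * a + (i * j - b) := by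
      rcases hr0.eq_or_lt with h0 | h0
      · have : R = ∅ := by
          rw [← card_eq_zero]; rw [hρ] at h0; exact_mod_cast h0.symm
        have hb' : b ≤ i * j := by
          have := degIn_mul_degIn_add_adjForm_le h hIS hJS hx
          have h1 := mul_nonneg (G.degIn_nonneg I x) (G.degIn_nonneg J x)
          linarith
        rw [← h0, this]; simp; linarith
      · have := sum_le_card_nsmul R _ _ hpt
        rw [← mul_sum, sum_add_distrib, ← mul_sum, nsmul_eq_mul] at this
        exact le_of_mul_le_mul_left this h0
    rw [sum_add_distrib] at ht'
    clear_value mn mx a t e b i j ρ m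
    have hmax : ρ * a + i * j ≤ m ^ 2 / 4 := by
      rcases le_total i j with h1 | h1
      · rw [ha, max_eq_right h1, ← hcard]; nlinarith [sq_nonneg (i + ρ - j)]
      · rw [ha, max_eq_left h1, ← hcard]; nlinarith [sq_nonneg (j + ρ - i)]
    have hρ2 := nine_mul_sq_le hm0 hr0 hcard hle h49
    linarith

end

section

lemma card_le_one_add_card_of_forall_not_succ (p : Fin 5 → Prop) [DecidablePred p]
    (h : ∀ i, p i → ¬ p (i + 1)) : #{i | p i} ≤ 1 + #{i | p (i + 4) ∧ p (i + 1)} := by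
  have key : ∀ q : Fin 5 → Bool, (∀ i, q i = true → ¬ q (i + 1) = true) →
    #{i | q i = true} ≤ 1 + #{i | q (i + 4) = true ∧ q (i + 1) = true} := by decide
  simpa using key (fun i => decide (p i)) (by simpa using h)

lemma eq_of_forall_not_succ (p : Fin 5 → Prop) (h : ∀ i, p i → ¬ p (i + 1)) (i j : Fin 5)
    (hi : p (i + 4) ∧ p (i + 1)) (hj : p (j + 4) ∧ p (j + 1)) : i = j := by
  classical
  have key : ∀ q : Fin 5 → Bool, (∀ i, q i = true → ¬ q (i + 1) = true) →
    ∀ i j, q (i + 4) = true ∧ q (i + 1) = true → q (j + 4) = true ∧ q (j + 1) = true →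
      i = j := by decide
  exact key (fun i => decide (p i)) (by simpa using h) i j (by simpa using hi) (by simpa using hj)

variable {V : Type*} [Fintype V] [DecidableEq V] {G : SimpleGraph V} [DecidableRel G.Adj]

/-- A closed walk of length five inside `S`. -/
def IsFiveCycleIn (G : SimpleGraph V) (S : Finset V) (w : Fin 5 → V) : Prop :=
  ∀ i, w i ∈ S ∧ G.Adj (w i) (w (i + 1))

omit [Fintype V] in
lemma TriangleFreeOn.degIn_le_two_thirds {S : Finset V} (h : G.TriangleFreeOn S)
    (hdeg : ∀ x ∈ S, (#S : ℝ) < 3 * G.degIn S x) {y : V} (hy : y ∈ S) :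
    3 * G.degIn S y ≤ 2 * #S := by
  have hS : (0 : ℝ) ≤ #S := Nat.cast_nonneg _
  have hpos : 0 < G.degIn S y := by linarith [hdeg y hy]
  rw [degIn, Nat.cast_pos, card_pos] at hpos
  obtain ⟨z, hz⟩ := hpos
  rw [mem_filter] at hz
  have h1 := h.degIn_add_degIn_le hy hz.1 hz.2
  linarith [hdeg z hz.1]

lemma TriangleFreeOn.adjForm_le_of_isFiveCycleIn {S : Finset V} (h : G.TriangleFreeOn S)
    (hdeg : ∀ x ∈ S, (#S : ℝ) < 3 * G.degIn S x) {w₀ : Fin 5 → V}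
    (hw₀ : G.IsFiveCycleIn S w₀) :
    9 * G.adjForm (indVec S) (indVec S) ≤ 4 * (#S : ℝ) ^ 2 := by
  classical
  obtain ⟨w, hw, hmax⟩ := exists_max_image ({w | G.IsFiveCycleIn S w} : Finset (Fin 5 → V))
    (fun w => ∑ i, G.degIn S (w i)) ⟨w₀, by simpa using hw₀⟩
  rw [mem_filter] at hw
  replace hw := hw.2
  set m : ℝ := (#S : ℝ) with hm
  set b : Fin 5 → ℝ := fun i => G.degIn S (w i) with hb
  set A : Fin 5 → Finset V := fun i => {y ∈ S | G.Adj (w (i + 4)) y ∧ G.Adj (w (i + 1)) y} with hA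
  have e1 : ∀ i : Fin 5, i + 4 + 1 = i := by decide
  have hswap : ∀ i, ∀ y ∈ A i, G.degIn S y ≤ b i := by
    intro i y hy
    rw [mem_filter] at hy
    have hcyc : G.IsFiveCycleIn S (Function.update w i y) := by
      have e2 : ∀ i : Fin 5, i + 1 ≠ i := by decide
      intro j
      by_cases hj : j = i
      · subst hj
        simpa [e2] using ⟨hy.1, hy.2.2.symm⟩
      · by_cases hj' : j + 1 = i
        · have : j = i + 4 := (by decide : ∀ i j : Fin 5, j + 1 = i → j = i + 4) i j hj'
          subst this
          have e3 : i + 4 ≠ i := hj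
          simpa [e1, e3] using ⟨(hw _).1, hy.2.1⟩
        · simpa [hj, hj'] using hw j
    have h1 := hmax _ (by simpa using hcyc)
    rw [← add_sum_erase _ _ (mem_univ i), ← add_sum_erase (a := i) _ _ (mem_univ i)] at h1
    rw [Finset.sum_congr (g := fun j => G.degIn S (w j)) rfl] at h1
    · simp only [Function.update_self] at h1
      linarith
    · intro j hj
      simp [(mem_erase.1 hj).1]
  have hcons : ∀ y ∈ S, ∀ i, G.Adj (w i) y → ¬ G.Adj (w (i + 1)) y := fun y hy i h1 h2 =>
    h _ (hw i).1 _ (hw (i + 1)).1 y hy (hw i).2 h1 h2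
  have hAcard : ∀ i, 3 * (#(A i) : ℝ) ≤ m := by
    intro i
    have d1 : Disjoint (A i) {y ∈ S | G.Adj (w (i + 1 + 1)) y} := by
      rw [Finset.disjoint_left]
      intro y hy hy'
      rw [mem_filter] at hy hy'
      exact hcons y hy.1 _ hy.2.2 hy'.2
    have d2 : Disjoint (A i) {y ∈ S | G.Adj (w (i + 1 + 1 + 1)) y} := by
      rw [Finset.disjoint_left]
      intro y hy hy'
      rw [mem_filter] at hy hy'
      have e4 : i + 1 + 1 + 1 + 1 = i + 4 :=
        (by decide : ∀ i : Fin 5, i + 1 + 1 + 1 + 1 = i + 4) i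
      refine hcons y hy.1 _ hy'.2 ?_
      rw [e4]; exact hy.2.1
    have d3 : Disjoint {y ∈ S | G.Adj (w (i + 1 + 1)) y}
        {y ∈ S | G.Adj (w (i + 1 + 1 + 1)) y} := by
      rw [Finset.disjoint_left]
      intro y hy hy'
      rw [mem_filter] at hy hy'
      exact hcons y hy.1 _ hy.2 hy'.2
    have h1 := card_union_of_disjoint (disjoint_union_right.2 ⟨d1, d2⟩)
    rw [card_union_of_disjoint d3] at h1
    have h2 : #(A i ∪ ({y ∈ S | G.Adj (w (i + 1 + 1)) y} ∪
        {y ∈ S | G.Adj (w (i + 1 + 1 + 1)) y})) ≤ #S :=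
      card_le_card (union_subset (filter_subset _ _)
        (union_subset (filter_subset _ _) (filter_subset _ _)))
    rw [h1] at h2
    have h3 : (#(A i) : ℝ) + (b (i + 1 + 1) + b (i + 1 + 1 + 1)) ≤ m := by
      simp only [hb, degIn, hm]; exact_mod_cast h2
    have h4 := hdeg _ (hw (i + 1 + 1)).1
    have h5 := hdeg _ (hw (i + 1 + 1 + 1)).1
    simp only [hb] at h3
    linarith
  have hpt : ∀ y ∈ S, G.degIn S y ≤
      2 / 3 * m + ∑ i, (if y ∈ A i then (1 : ℝ) else 0) * (b i - 2 / 3 * m) := by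
    intro y hy
    by_cases hex : ∃ i, y ∈ A i
    · obtain ⟨i, hi⟩ := hex
      rw [sum_eq_single i]
      · have := hswap i y hi
        simp only [hi, if_true]; linarith
      · intro j _ hji
        have : y ∉ A j := fun hj => hji <|
          eq_of_forall_not_succ (fun i => G.Adj (w i) y) (hcons y hy) j i
            (mem_filter.1 hj).2 (mem_filter.1 hi).2
        simp [this]
      · simp
    · push Not at hex
      have := h.degIn_le_two_thirds hdeg hy
      simp only [hex, if_false, zero_mul, sum_const_zero]
      linarith
  have hpt2 : ∀ y ∈ S, ∑ i, (if G.Adj (w i) y then (1 : ℝ) else 0)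
      ≤ 1 + ∑ i, (if y ∈ A i then (1 : ℝ) else 0) := by
    intro y hy
    have := card_le_one_add_card_of_forall_not_succ (fun i => G.Adj (w i) y) (hcons y hy)
    simp only [Finset.sum_boole, hA, mem_filter, hy, true_and]
    exact_mod_cast this
  have hs1 := sum_le_sum hpt
  have hs2 := sum_le_sum hpt2
  have hAsum : ∀ i, ∑ y ∈ S, (if y ∈ A i then (1 : ℝ) else 0) = #(A i) := by
    intro i
    rw [Finset.sum_boole, filter_mem_eq_inter, inter_eq_right.2 (filter_subset _ _)]
  rw [sum_add_distrib, sum_comm] at hs1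
  rw [sum_add_distrib, sum_comm, sum_comm (s := S) (t := univ)] at hs2
  simp only [← sum_mul, hAsum, ← degIn_eq_sum, sum_const, nsmul_eq_mul, mul_one] at hs1 hs2
  rw [← adjForm_indVec, ← hm] at hs1
  rw [← hm] at hs2
  have hm0 : 0 ≤ m := Nat.cast_nonneg _
  have hterm : ∀ i, (#(A i) : ℝ) * (b i - 2 / 3 * m)
      ≤ m / 3 * (b i - m / 3) - #(A i) * (m / 3) := by
    intro i
    have h1 := hAcard i
    have h2 : m < 3 * b i := hdeg _ (hw i).1
    nlinarith
  have hs3 := sum_le_sum fun i (_ : i ∈ (univ : Finset (Fin 5))) => hterm i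
  rw [sum_sub_distrib, ← mul_sum, ← sum_mul, sum_sub_distrib] at hs3
  simp only [sum_const, card_univ, Fintype.card_fin, nsmul_eq_mul] at hs3
  simp only [hb] at hs3 hs1
  push_cast at hs3
  nlinarith

omit [Fintype V] in
lemma exists_isFiveCycleIn {S : Finset V} (h : G.TriangleFreeOn S)
    (hdeg : ∀ x ∈ S, (#S : ℝ) < 3 * G.degIn S x)
    (hcol : ¬ (G.induce (S : Set V)).Colorable 2) : ∃ w, G.IsFiveCycleIn S w := by
  classical
  rw [two_colorable_iff_forall_loop_even] at hcol
  set H := G.induce (S : Set V) with hH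
  have hex : ∃ L : ℕ, ¬ Even L ∧ ∃ u, ∃ p : H.Walk u u, p.length = L := by
    push Not at hcol
    obtain ⟨u, p, hp⟩ := hcol
    exact ⟨_, hp, u, p, rfl⟩
  obtain ⟨hodd, u, p, hp⟩ := Nat.find_spec hex
  have hmin : ∀ (v) (q : H.Walk v v), ¬ Even q.length → Nat.find hex ≤ q.length :=
    fun v q hq => Nat.find_min' hex ⟨hq, v, q, rfl⟩
  set L := Nat.find hex
  have hadjH : ∀ i < L, H.Adj (p.getVert i) (p.getVert (i + 1)) := fun i hi =>
    p.adj_getVert_succ (hp ▸ hi)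
  have hadj : ∀ i < L, G.Adj (p.getVert i) (p.getVert (i + 1)) := hadjH
  have h0 : p.getVert 0 = u := p.getVert_zero
  have hL : p.getVert L = u := hp ▸ p.getVert_length
  have hmem : ∀ i, (p.getVert i : V) ∈ S := fun i => (p.getVert i).2
  have hL0 : p.getVert L = p.getVert 0 := hL.trans h0.symm
  rw [Nat.not_even_iff_odd] at hodd
  have h1 : L ≠ 1 := by
    intro h1
    have := hadj 0 (by omega)
    rw [h1] at hL0
    rw [zero_add, hL0] at this
    exact G.irrefl this
  have h3 : L ≠ 3 := by
    intro h3
    have a1 : G.Adj (p.getVert 0) (p.getVert 1) := hadj 0 (by omega)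
    have a2 : G.Adj (p.getVert 1) (p.getVert 2) := hadj 1 (by omega)
    have a3 : G.Adj (p.getVert 2) (p.getVert 3) := hadj 2 (by omega)
    rw [h3] at hL0
    rw [hL0] at a3
    exact h _ (hmem 0) _ (hmem 1) _ (hmem 2) a1 a3.symm a2
  by_cases h5 : L = 5
  · refine ⟨fun i => p.getVert i, fun i => ⟨hmem _, ?_⟩⟩
    rw [h5] at hL0
    have a := hadj i (by omega)
    by_cases hi : i = 4
    · subst hi
      have a4 : G.Adj (p.getVert 4) (p.getVert 5) := hadj 4 (by omega)
      rw [hL0] at a4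
      exact a4
    · rwa [show (i : ℕ) + 1 = ((i + 1 : Fin 5) : ℕ) from
        (by decide : ∀ i : Fin 5, i ≠ 4 → (i : ℕ) + 1 = ((i + 1 : Fin 5) : ℕ)) i hi] at a
  · exfalso
    have h7 : 7 ≤ L := by
      obtain ⟨r, hr⟩ := hodd
      omega
    have d1 : Disjoint {y ∈ S | G.Adj (p.getVert 0) y} {y ∈ S | G.Adj (p.getVert 1) y} := by
      rw [Finset.disjoint_left]
      intro y hy hy'
      rw [mem_filter] at hy hy'
      exact h _ (hmem 0) _ (hmem 1) y hy.1 (hadj 0 (by omega)) hy.2 hy'.2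
    have d2 : Disjoint {y ∈ S | G.Adj (p.getVert 1) y} {y ∈ S | G.Adj (p.getVert 4) y} := by
      rw [Finset.disjoint_left]
      intro y hy hy'
      rw [mem_filter] at hy hy'
      have b1 : H.Adj (p.getVert 4) ⟨y, hy.1⟩ := hy'.2
      have b2 : H.Adj ⟨y, hy.1⟩ (p.getVert 1) := hy.2.symm
      have := hmin _ (.cons (hadjH 1 (by omega)) (.cons (hadjH 2 (by omega))
        (.cons (hadjH 3 (by omega)) (.cons b1 (.cons b2 .nil))))) (by simp; decide)
      simp at this
      omega
    have d3 : Disjoint {y ∈ S | G.Adj (p.getVert 0) y} {y ∈ S | G.Adj (p.getVert 4) y} := by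
      rw [Finset.disjoint_left]
      intro y hy hy'
      rw [mem_filter] at hy hy'
      have b1 : H.Adj ⟨y, hy.1⟩ (p.getVert 4) := hy'.2.symm
      have b2 : H.Adj u ⟨y, hy.1⟩ := by
        have := hy.2
        rw [h0] at this
        exact this
      have := hmin _ (.cons b2 (.cons b1 (p.drop 4))) (by
        obtain ⟨r, hr⟩ := hodd
        rw [Nat.not_even_iff_odd]
        exact ⟨r - 1, by simp [hp]; omega⟩)
      simp [hp] at this
      omega
    have c1 := card_union_of_disjoint (disjoint_union_left.2 ⟨d3, d2⟩)
    rw [card_union_of_disjoint d1] at c1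
    have c2 : #(({y ∈ S | G.Adj (p.getVert 0) y} ∪ {y ∈ S | G.Adj (p.getVert 1) y}) ∪
        {y ∈ S | G.Adj (p.getVert 4) y}) ≤ #S :=
      card_le_card (union_subset
        (union_subset (filter_subset _ _) (filter_subset _ _)) (filter_subset _ _))
    rw [c1] at c2
    have c3 : G.degIn S (p.getVert 0) + G.degIn S (p.getVert 1) + G.degIn S (p.getVert 4)
        ≤ #S := by
      simp only [degIn]; exact_mod_cast c2
    linarith [hdeg _ (hmem 0), hdeg _ (hmem 1), hdeg _ (hmem 4)]

/-- A dense triangle-free set of minimum degree more than a third of its size is bipartite. -/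
lemma TriangleFreeOn.exists_bipartition {S : Finset V} (h : G.TriangleFreeOn S)
    (hdeg : ∀ x ∈ S, (#S : ℝ) < 3 * G.degIn S x)
    (hS : 4 * (#S : ℝ) ^ 2 < 9 * G.adjForm (indVec S) (indVec S)) :
    ∃ P Q : Finset V, Disjoint P Q ∧ P ∪ Q = S ∧ (∀ x ∈ P, G.degIn P x = 0) ∧
      ∀ x ∈ Q, G.degIn Q x = 0 := by
  by_cases hcol : (G.induce (S : Set V)).Colorable 2
  · obtain ⟨c⟩ := hcol
    refine ⟨{x ∈ S | ∃ hx : x ∈ S, c ⟨x, hx⟩ = 0}, {x ∈ S | ¬ ∃ hx : x ∈ S, c ⟨x, hx⟩ = 0},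
      disjoint_filter_filter_not _ _ _, filter_union_filter_not_eq _ _, ?_, ?_⟩
    all_goals
      intro x hx
      rw [degIn, Nat.cast_eq_zero, card_eq_zero, filter_eq_empty_iff]
      intro y hy hxy
      rw [mem_filter] at hx hy
      have hne : c ⟨x, hx.1⟩ ≠ c ⟨y, hy.1⟩ := c.valid hxy
      have h1 := hx.2
      have h2 := hy.2
      simp only [hx.1, hy.1, exists_true_left] at h1 h2
      omega
  · obtain ⟨w, hw⟩ := exists_isFiveCycleIn h hdeg hcol
    linarith [h.adjForm_le_of_isFiveCycleIn hdeg hw]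

end

section

lemma lt_mul_of_sub_mul_lt_sq {c y D η : ℝ} (h : (c - 2 * y) * D < y ^ 2) (hy : 0 ≤ y)
    (hD : 0 < D) (hyD : y ≤ η * D) : c < (2 + η) * y := by
  by_contra! hc
  nlinarith [mul_le_mul_of_nonneg_left hyD hy, mul_le_mul_of_nonneg_right hc hD.le]

lemma false_of_sparse_bounds {d T y : ℝ} (hd : 4 / 9 < d) (hd' : d ≤ 1 / 2)
    (hT : 4 / 9 - 17 / 9 * d + 22 / 9 * d ^ 2 < T) (hT' : 2 * T ≤ d ^ 2) (hy : 0 ≤ y)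
    (hy1 : 2 * d ^ 2 * y ≤ d ^ 4 - 4 * T ^ 2)
    (h : (4 / 9 - d + T - 2 * y) * (d - T) < y ^ 2) : False := by
  have hy2 : y ≤ 145 / 162 * d ^ 2 - 16 / 9 * T := by
    have hd2 : 0 < 2 * d ^ 2 := by positivity
    refine le_of_mul_le_mul_left ?_ hd2
    nlinarith [sq_nonneg (T - 4 / 9 * d ^ 2)]
  have hyD : y ≤ 2 / 25 * (d - T) := by nlinarith [sq_nonneg (d - 48 / 100)]
  have := lt_mul_of_sub_mul_lt_sq h hy (by nlinarith) hyD
  nlinarith [sq_nonneg (1 / 2 - d)]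

lemma false_of_dense_bounds {d T y : ℝ} (hd : 1 / 2 ≤ d) (hd' : d ≤ 3 / 5)
    (hT : 4 / 9 * d ^ 2 < T)
    (hT2 : d ≤ 11 / 20 ∨ 22 / 9 + 32 / 3 * d ^ 2 - 28 / 3 * d < 4 * T)
    (hT' : 2 * T ≤ d ^ 2) (hy : 0 ≤ y) (hy1 : 3 * y ≤ d ^ 2 - 2 * T)
    (h : (4 / 9 - d + T - 2 * y) * (d - T) < y ^ 2) : False := by
  have hyD : y ≤ 4 / 125 * (d - T) := by nlinarith
  have := lt_mul_of_sub_mul_lt_sq h hy (by nlinarith) hyD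
  rcases hT2 with hT2 | hT2
  · nlinarith
  · nlinarith [sq_nonneg (d - 58 / 100)]

lemma false_of_bipartite_bounds {d c T T' : ℝ} (hd : 3 / 5 < d) (hT : T < d - 4 / 9)
    (hT' : T' < d - 4 / 9) (hc : d * c ≤ T)
    (h : 4 / 9 + 4 * d ^ 2 - 2 * d - 2 * (2 * d - 1) * (c - 2 * d + 1) < 2 * (T + T')) :
    False := by
  have h1 : d * (4 / 9 + 4 * d ^ 2 - 2 * d + 2 * (2 * d - 1) * (2 * d - 1) - 4 * (d - 4 / 9))
      < 2 * (2 * d - 1) * (d - 4 / 9) := by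
    have h2 : 4 / 9 + 4 * d ^ 2 - 2 * d + 2 * (2 * d - 1) * (2 * d - 1) - 4 * (d - 4 / 9)
      < 2 * (2 * d - 1) * c := by linarith
    have h3 := mul_lt_mul_of_pos_left h2 (by linarith : 0 < d)
    have h4 := mul_le_mul_of_nonneg_left (hc.trans hT.le) (by linarith : 0 ≤ 2 * (2 * d - 1))
    linarith
  nlinarith [mul_nonneg (sq_nonneg (d - 2 / 3)) (by linarith : 0 ≤ d - 1 / 6)]

variable {V : Type*} [Fintype V] [DecidableEq V] {G : SimpleGraph V} [DecidableRel G.Adj]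

lemma CliqueFree.triangleFreeOn_neighborFinset (hK4 : G.CliqueFree 4) (v : V) :
    G.TriangleFreeOn (G.neighborFinset v) := by
  intro x hx y hy z hz hxy hxz hyz
  rw [mem_neighborFinset] at hx hy hz
  refine hK4 _ ((is3Clique_triple_iff.2 ⟨hxy, hxz, hyz⟩).insert (a := v) fun b hb => ?_)
  simp only [mem_insert, mem_singleton] at hb
  rcases hb with rfl | rfl | rfl <;> assumption

/-- Twice the number of edges in the neighbourhood of `v`, divided by the square of the order. -/
noncomputable def nbhdDensity (G : SimpleGraph V) [DecidableRel G.Adj] (v : V) : ℝ :=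
  G.adjForm (indVec (G.neighborFinset v)) (indVec (G.neighborFinset v)) / (Fintype.card V : ℝ) ^ 2

lemma le_degIn_neighborFinset {k : ℕ} (hreg : G.IsRegularOfDegree k) (v x : V) :
    2 * (k : ℝ) - Fintype.card V ≤ G.degIn (G.neighborFinset v) x := by
  rw [← card_inter_neighborFinset]
  have h1 := card_union_add_card_inter (G.neighborFinset v) (G.neighborFinset x)
  rw [card_neighborFinset_eq_degree, card_neighborFinset_eq_degree, hreg v, hreg x] at h1
  have h2 := card_le_univ (G.neighborFinset v ∪ G.neighborFinset x)
  have h1' : (#(G.neighborFinset v ∪ G.neighborFinset x) : ℝ)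
    + #(G.neighborFinset v ∩ G.neighborFinset x) = k + k := by exact_mod_cast h1
  have h2' : (#(G.neighborFinset v ∪ G.neighborFinset x) : ℝ) ≤ Fintype.card V := by
    exact_mod_cast h2
  linarith

section

variable [Nonempty V] {k : ℕ} {d : ℝ}

lemma adjForm_neighborFinset (v : V) :
    G.adjForm (indVec (G.neighborFinset v)) (indVec (G.neighborFinset v))
      = G.nbhdDensity v * (Fintype.card V : ℝ) ^ 2 := by
  have : (Fintype.card V : ℝ) ≠ 0 := by exact_mod_cast Fintype.card_ne_zero
  rw [nbhdDensity]; field_simp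

lemma two_mul_nbhdDensity_le (hreg : G.IsRegularOfDegree k) (hK4 : G.CliqueFree 4)
    (hd : (k : ℝ) = d * Fintype.card V) (v : V) : 2 * G.nbhdDensity v ≤ d ^ 2 := by
  have h := (hK4.triangleFreeOn_neighborFinset v).two_mul_adjForm_le
  rw [adjForm_neighborFinset, card_neighborFinset_eq_degree, hreg v, hd] at h
  have hn : (0 : ℝ) < Fintype.card V ^ 2 := by
    have : (0 : ℝ) < Fintype.card V := by exact_mod_cast Fintype.card_pos
    positivity
  exact le_of_mul_le_mul_right (by linarith) hn

lemma nbhdDensity_mul_lt_of_partition (hreg : G.IsRegularOfDegree k) (hK4 : G.CliqueFree 4)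
    (hbad : G.FractionalCutsLarge k) (hd : (k : ℝ) = d * Fintype.card V) (hd1 : d < 1) (v : V)
    (hd0 : 0 < d) {P Q : Finset V} (hPQ : Disjoint P Q) (hU : P ∪ Q = G.neighborFinset v)
    (hP : 2 * (k : ℝ) - Fintype.card V ≤ #P) (hQ : 2 * (k : ℝ) - Fintype.card V ≤ #Q)
    {y : ℝ} (hy : G.adjForm (indVec P) (indVec P) + G.adjForm (indVec Q) (indVec Q)
      = y * (Fintype.card V : ℝ) ^ 2) :
    (4 / 9 - d + G.nbhdDensity v - 2 * y) * (d - G.nbhdDensity v) < y ^ 2 := by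
  have hn : (0 : ℝ) < Fintype.card V := by exact_mod_cast Fintype.card_pos
  have hT := two_mul_nbhdDensity_le hreg hK4 hd v
  have hcard : #(P ∪ Q) = k := by rw [hU, card_neighborFinset_eq_degree, hreg v]
  have hcard' : (#P : ℝ) + #Q = k := by
    rw [← hcard, card_union_of_disjoint hPQ]; push_cast; ring
  have hP0 : (0 : ℝ) ≤ #P := Nat.cast_nonneg _
  have hQ0 : (0 : ℝ) ≤ #Q := Nat.cast_nonneg _
  have ht : G.adjForm (indVec (P ∪ Q)) (indVec (P ∪ Q))
    = G.nbhdDensity v * (Fintype.card V : ℝ) ^ 2 := by rw [hU, adjForm_neighborFinset]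
  have hlt : G.nbhdDensity v < d := by nlinarith
  set n : ℝ := (Fintype.card V : ℝ) with hndef
  have h := adjForm_mul_lt_of_partition hreg hbad hPQ hcard (by rw [hd]; nlinarith)
    (by linarith) (by linarith) ht hy (by rw [hd]; nlinarith [mul_pos hn hn])
  rw [← hndef, hd] at h
  have h' : n ^ 4 * ((4 / 9 - d + G.nbhdDensity v - 2 * y) * (d - G.nbhdDensity v))
      < n ^ 4 * y ^ 2 := by linarith
  exact lt_of_mul_lt_mul_left h' (by positivity)

lemma exists_nbhdDensity_mul_lt (hreg : G.IsRegularOfDegree k) (hK4 : G.CliqueFree 4)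
    (hbad : G.FractionalCutsLarge k) (hd : (k : ℝ) = d * Fintype.card V) (hd1 : d < 1)
    (hd0 : 0 < d) {v : V} (hv : 0 < G.nbhdDensity v) :
    ∃ y, 0 ≤ y ∧ 2 * d ^ 2 * y ≤ d ^ 4 - 4 * G.nbhdDensity v ^ 2 ∧
      (4 * d ^ 2 ≤ 9 * G.nbhdDensity v → 3 * y ≤ d ^ 2 - 2 * G.nbhdDensity v) ∧
      (4 / 9 - d + G.nbhdDensity v - 2 * y) * (d - G.nbhdDensity v) < y ^ 2 := by
  have hn : (0 : ℝ) < Fintype.card V := by exact_mod_cast Fintype.card_pos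
  obtain ⟨P, Q, hPQ, hU, hg, h1, h2⟩ :=
    (hK4.triangleFreeOn_neighborFinset v).exists_partition
      (by rw [adjForm_neighborFinset]; positivity)
  obtain ⟨hP, hQ⟩ := hg _ fun x _ => le_degIn_neighborFinset hreg v x
  have nP := G.adjForm_indVec_nonneg P P
  have nQ := G.adjForm_indVec_nonneg Q Q
  obtain ⟨y, hy⟩ : ∃ y, G.adjForm (indVec P) (indVec P) + G.adjForm (indVec Q) (indVec Q)
      = y * (Fintype.card V : ℝ) ^ 2 :=
    ⟨(G.adjForm (indVec P) (indVec P) + G.adjForm (indVec Q) (indVec Q)) / Fintype.card V ^ 2,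
      by field_simp⟩
  rw [hy, adjForm_neighborFinset, card_neighborFinset_eq_degree, hreg v, hd] at h1 h2
  refine ⟨y, ?_, ?_, fun h => ?_,
    nbhdDensity_mul_lt_of_partition hreg hK4 hbad hd hd1 v hd0 hPQ hU hP hQ hy⟩
  · exact nonneg_of_mul_nonneg_left (by linarith) (by positivity : (0 : ℝ) < Fintype.card V ^ 2)
  · exact le_of_mul_le_mul_right (by linarith) (by positivity : (0 : ℝ) < Fintype.card V ^ 4)
  · have hn2 : (0 : ℝ) < Fintype.card V ^ 2 := by positivity
    have := h2 (by nlinarith [mul_le_mul_of_nonneg_right h hn2.le])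
    exact le_of_mul_le_mul_right (by linarith) hn2

lemma lt_nbhdDensity (hreg : G.IsRegularOfDegree k) (hbad : G.FractionalCutsLarge k)
    (hd : (k : ℝ) = d * Fintype.card V) (hd2 : 1 / 2 ≤ d) (v : V) :
    4 / 9 * d ^ 2 < G.nbhdDensity v := by
  have hn : (0 : ℝ) < Fintype.card V := by exact_mod_cast Fintype.card_pos
  have h := lt_adjForm_neighborFinset hreg hbad (by rw [hd]; nlinarith) Fintype.card_pos
    (S := G.neighborFinset v) (by rw [card_neighborFinset_eq_degree, hreg v])
  rw [adjForm_neighborFinset, hd] at h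
  exact lt_of_mul_lt_mul_right (by linarith) (by positivity : (0 : ℝ) ≤ Fintype.card V ^ 2)

lemma lt_nbhdDensity_of_sparse (hreg : G.IsRegularOfDegree k) (hbad : G.FractionalCutsLarge k)
    (hd : (k : ℝ) = d * Fintype.card V) (hd2 : d ≤ 1 / 2) (v : V) :
    4 / 9 - 17 / 9 * d + 22 / 9 * d ^ 2 < G.nbhdDensity v := by
  have hn : (0 : ℝ) < Fintype.card V := by exact_mod_cast Fintype.card_pos
  have h := lt_adjForm_neighborFinset_of_sparse hreg hbad (by rw [hd]; nlinarith)
    Fintype.card_pos (S := G.neighborFinset v) (by rw [card_neighborFinset_eq_degree, hreg v])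
  rw [adjForm_neighborFinset, hd] at h
  exact lt_of_mul_lt_mul_right (by linarith) (by positivity : (0 : ℝ) ≤ Fintype.card V ^ 4)

lemma lt_nbhdDensity_add_nbhdDensity (hreg : G.IsRegularOfDegree k) (hK4 : G.CliqueFree 4)
    (hbad : G.FractionalCutsLarge k) (hd : (k : ℝ) = d * Fintype.card V) (hd2 : 1 / 2 < d)
    {v x : V} (hx : x ∈ G.neighborFinset v) {c : ℝ}
    (hc : G.degIn (G.neighborFinset v) x = c * Fintype.card V) :
    4 / 9 + 4 * d ^ 2 - 2 * d - 2 * (2 * d - 1) * (c - 2 * d + 1)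
      < 2 * (G.nbhdDensity v + G.nbhdDensity x) := by
  have hn : (0 : ℝ) < Fintype.card V := by exact_mod_cast Fintype.card_pos
  have hle := le_degIn_neighborFinset hreg v x
  have hcard := G.card_inter_neighborFinset (G.neighborFinset v) x
  have h := lt_adjForm_add_adjForm hreg hbad (by rw [hd]; nlinarith)
    (S := G.neighborFinset v) (T := G.neighborFinset x)
    (by rw [card_neighborFinset_eq_degree, hreg v])
    (by rw [card_neighborFinset_eq_degree, hreg x]) (by
      have : (0 : ℝ) < #(G.neighborFinset v ∩ G.neighborFinset x) := by
        rw [hcard]; rw [hd] at hle; nlinarith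
      exact_mod_cast this) (by
      rw [adjForm_indVec]
      refine sum_eq_zero fun y hy => ?_
      refine (hK4.triangleFreeOn_neighborFinset v).degIn_eq_zero_of_subset_neighbors hx ?_ hy
      intro z hz
      simpa using hz)
  rw [adjForm_neighborFinset, adjForm_neighborFinset, hcard, hc, hd] at h
  exact lt_of_mul_lt_mul_right (by linarith) (by positivity : (0 : ℝ) ≤ Fintype.card V ^ 2)

lemma nbhdDensity_lt (hreg : G.IsRegularOfDegree k) (hK4 : G.CliqueFree 4)
    (hbad : G.FractionalCutsLarge k) (hd : (k : ℝ) = d * Fintype.card V) (hd1 : d < 1)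
    (hd2 : 1 / 2 ≤ d) {v : V}
    (hdeg : ∀ x ∈ G.neighborFinset v, (k : ℝ) < 3 * G.degIn (G.neighborFinset v) x) :
    G.nbhdDensity v < d - 4 / 9 := by
  have hn : (0 : ℝ) < Fintype.card V := by exact_mod_cast Fintype.card_pos
  have hT := lt_nbhdDensity hreg hbad hd hd2 v
  have hT' := two_mul_nbhdDensity_le hreg hK4 hd v
  have hcard : #(G.neighborFinset v) = k := by rw [card_neighborFinset_eq_degree, hreg v]
  have htf := hK4.triangleFreeOn_neighborFinset v
  have hn2 : (0 : ℝ) < Fintype.card V ^ 2 := by positivity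
  obtain ⟨P, Q, hPQ, hU, hP, hQ⟩ := htf.exists_bipartition (by simpa only [hcard] using hdeg) (by
    rw [hcard, adjForm_neighborFinset, hd]
    nlinarith [mul_lt_mul_of_pos_right hT hn2])
  have eP : G.adjForm (indVec P) (indVec P) = 0 := by
    rw [adjForm_indVec]; exact sum_eq_zero hP
  have eQ : G.adjForm (indVec Q) (indVec Q) = 0 := by
    rw [adjForm_indVec]; exact sum_eq_zero hQ
  have hpos : 0 < G.adjForm (indVec (G.neighborFinset v)) (indVec (G.neighborFinset v)) := by
    rw [adjForm_neighborFinset]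
    have : 0 < G.nbhdDensity v := by nlinarith
    positivity
  have hsize : ∀ A B : Finset V, Disjoint A B → A ∪ B = G.neighborFinset v →
      (∀ x ∈ A, G.degIn A x = 0) → G.adjForm (indVec B) (indVec B) = 0 →
      2 * (k : ℝ) - Fintype.card V ≤ #B := by
    intro A B hAB hAU hA hB
    rcases A.eq_empty_or_nonempty with h0 | ⟨x, hx⟩
    · rw [h0, empty_union] at hAU
      rw [hAU] at hB
      linarith
    · have h1 := le_degIn_neighborFinset hreg v x
      rw [← hAU, degIn_union hAB, hA x hx, zero_add] at h1
      exact h1.trans (degIn_le_card _ _)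
  have h := nbhdDensity_mul_lt_of_partition hreg hK4 hbad hd hd1 v (by linarith) hPQ hU
    (hsize Q P hPQ.symm (by rw [union_comm, hU]) hQ eP) (hsize P Q hPQ hU hP eQ)
    (y := 0) (by rw [eP, eQ]; ring)
  have hD : 0 < d - G.nbhdDensity v := by nlinarith
  by_contra! hcon
  nlinarith [mul_nonneg (sub_nonneg.2 hcon) hD.le]

lemma not_fractionalCutsLarge (hreg : G.IsRegularOfDegree k) (hK4 : G.CliqueFree 4) :
    ¬ G.FractionalCutsLarge k := by
  intro hbad
  have hn : (0 : ℝ) < Fintype.card V := by exact_mod_cast Fintype.card_pos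
  obtain ⟨d, hd⟩ : ∃ d : ℝ, (k : ℝ) = d * Fintype.card V :=
    ⟨k / Fintype.card V, by field_simp⟩
  obtain ⟨v, -, hv⟩ := exists_max_image univ G.nbhdDensity univ_nonempty
  have hd1 : d < 1 := by
    have h1 : (k : ℝ) < Fintype.card V := by
      rw [← hreg v]; exact_mod_cast G.degree_lt_card_verts v
    rw [hd] at h1
    nlinarith
  have hd0 : 4 / 9 < d := by
    have := hbad 0 (by simp) (by simp)
    rw [map_zero, hd] at this
    have h2 : (Fintype.card V : ℝ) ^ 2 * (4 / 9) < Fintype.card V ^ 2 * d := by linarith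
    exact lt_of_mul_lt_mul_left h2 (by positivity)
  have hT' := two_mul_nbhdDensity_le hreg hK4 hd v
  rcases le_total d (1 / 2) with h2 | h2
  · have hT := lt_nbhdDensity_of_sparse hreg hbad hd h2 v
    obtain ⟨y, hy, hy1, -, h⟩ := exists_nbhdDensity_mul_lt hreg hK4 hbad hd hd1 (by linarith)
      (v := v) (by nlinarith [sq_nonneg (d - 17 / 44)])
    exact false_of_sparse_bounds hd0 h2 hT hT' hy hy1 h
  have hT := lt_nbhdDensity hreg hbad hd h2
  rcases le_or_gt d (3 / 5) with h3 | h3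
  · obtain ⟨y, hy, -, hy1, h⟩ := exists_nbhdDensity_mul_lt hreg hK4 hbad hd hd1 (by linarith)
      (v := v) (by nlinarith [hT v])
    refine false_of_dense_bounds h2 h3 (hT v) ?_ hT' hy (hy1 (by linarith [hT v])) h
    by_contra! hcon
    by_cases hdeg : ∀ x ∈ G.neighborFinset v, (k : ℝ) < 3 * G.degIn (G.neighborFinset v) x
    · have := nbhdDensity_lt hreg hK4 hbad hd hd1 h2 hdeg
      nlinarith [hT v]
    · push Not at hdeg
      obtain ⟨x, hx, hxc⟩ := hdeg
      obtain ⟨c, hc⟩ : ∃ c : ℝ, G.degIn (G.neighborFinset v) x = c * Fintype.card V :=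
        ⟨G.degIn (G.neighborFinset v) x / Fintype.card V, by field_simp⟩
      have := lt_nbhdDensity_add_nbhdDensity hreg hK4 hbad hd (by linarith) hx hc
      have hvx := hv x (mem_univ x)
      rw [hc, hd] at hxc
      have hcd : 3 * c ≤ d := le_of_mul_le_mul_right (by linarith) hn
      nlinarith [mul_nonneg (by linarith : 0 ≤ 2 * d - 1) (sub_nonneg.2 hcd)]
  · have hlt : ∀ u, G.nbhdDensity u < d - 4 / 9 := fun u =>
      nbhdDensity_lt hreg hK4 hbad hd hd1 h2 fun x _ => by
        have := le_degIn_neighborFinset hreg u x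
        rw [hd] at this ⊢
        nlinarith
    have hcard : #(G.neighborFinset v) = k := by rw [card_neighborFinset_eq_degree, hreg v]
    have hne : (G.neighborFinset v).Nonempty := by
      rw [← card_pos, hcard]
      have : (0 : ℝ) < k := by rw [hd]; positivity
      exact_mod_cast this
    obtain ⟨x, hx, hmin⟩ := exists_min_image _ (G.degIn (G.neighborFinset v)) hne
    obtain ⟨c, hc⟩ : ∃ c : ℝ, G.degIn (G.neighborFinset v) x = c * Fintype.card V :=
      ⟨G.degIn (G.neighborFinset v) x / Fintype.card V, by field_simp⟩
    have hsum := card_nsmul_le_sum _ _ _ hmin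
    rw [← adjForm_indVec, adjForm_neighborFinset, hcard, nsmul_eq_mul, hc, hd] at hsum
    exact false_of_bipartite_bounds h3 (hlt v) (hlt x)
      (le_of_mul_le_mul_right (by linarith) (by positivity : (0 : ℝ) < Fintype.card V ^ 2))
      (lt_nbhdDensity_add_nbhdDensity hreg hK4 hbad hd (by linarith) hx hc)

end

end

end SimpleGraph

/-- For even `n`, every regular `K₄`-free graph on `n` vertices can be partitioned
into two parts of size exactly `n/2` spanning together at most `n²/9` edges. -/
theorem regular_K4_free_make_bipartite {n : ℕ} (hn : Even n) (G : SimpleGraph (Fin n))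
    [DecidableRel G.Adj] (hK4 : G.CliqueFree 4) (hreg : ∃ d, G.IsRegularOfDegree d) :
    ∃ A B : Finset (Fin n), Disjoint A B ∧ A ∪ B = Finset.univ ∧
      A.card = n / 2 ∧ B.card = n / 2 ∧
      (edgesIn G A : ℝ) + (edgesIn G B : ℝ) ≤ (n : ℝ) ^ 2 / 9 := by
  obtain ⟨k, hk⟩ := hreg
  obtain ⟨z, hz, hs, hQ⟩ : ∃ z : Fin n → ℝ, (∀ x, |z x| ≤ 1) ∧ ∑ x, z x = 0 ∧
      G.adjForm z z ≤ 4 / 9 * (n : ℝ) ^ 2 - k * n := by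
    rcases isEmpty_or_nonempty (Fin n) with h | h
    · have h0 : n = 0 := by
        rw [← Fintype.card_fin n]; exact Fintype.card_eq_zero
      refine ⟨0, by simp, by simp, ?_⟩
      rw [map_zero]
      simp [h0]
    · have := G.not_fractionalCutsLarge hk hK4
      simpa [SimpleGraph.FractionalCutsLarge] using this
  obtain ⟨A, B, h1, h2, h3, h4, h5⟩ := G.exists_balanced_cut (by simpa using hn) hk z hz hs
  rw [Fintype.card_fin] at h3 h4 h5
  exact ⟨A, B, h1, h2, h3, h4, by linarith⟩
end

section
/- Let α, c ∈ [0,1] satisfy α + c ≥ 1. Then every triangle-free graph G on n vertices with exactly cn² edges contains a vertex set S of size ⌊αn⌋ that spans at most (2α − 1)cn² edges. -/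
open Finset

/-- A finite set whose weights average at least `a` has a subset of any smaller size with the same
property. -/
theorem exists_subset_card_eq_mul_le_sum {ι : Type*} [DecidableEq ι] (w : ι → ℝ) (a : ℝ) (m : ℕ)
    (N : Finset ι) (hm : m ≤ N.card) (ha : a * N.card ≤ ∑ i ∈ N, w i) :
    ∃ T ⊆ N, T.card = m ∧ a * m ≤ ∑ i ∈ T, w i := by
  induction N using Finset.strongInduction with
  | H N ih =>
    rcases hm.eq_or_lt with h | h
    · exact ⟨N, Subset.rfl, h.symm, by rwa [h]⟩
    by_cases hu : ∃ u ∈ N, w u ≤ a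
    · obtain ⟨u, huN, hua⟩ := hu
      have hcard := card_erase_add_one huN
      have hsum := add_sum_erase N w huN
      have hcard' : ((N.erase u).card : ℝ) + 1 = N.card := by exact_mod_cast hcard
      obtain ⟨T, hT, hTm, hTa⟩ := ih (N.erase u) (erase_ssubset huN) (by omega)
        (by rw [← hcard'] at ha; linarith)
      exact ⟨T, hT.trans (erase_subset u N), hTm, hTa⟩
    · push Not at hu
      obtain ⟨T, hT, hTm⟩ := exists_subset_card_eq hm
      refine ⟨T, hT, hTm, ?_⟩
      have := card_nsmul_le_sum T w a fun i hi => (hu i (hT hi)).le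
      rwa [nsmul_eq_mul, hTm, mul_comm] at this

/-- Deleting a set `T` removes at least as many edges as the degree sum of any independent set
contained in `T`. -/
theorem edgesIn_compl_add_sum_degree_le {V : Type*} [Fintype V] [DecidableEq V]
    (G : SimpleGraph V) [DecidableRel G.Adj] {I T : Finset V} (hIT : I ⊆ T)
    (hI : ∀ u ∈ I, ∀ v ∈ I, ¬ G.Adj u v) :
    edgesIn G Tᶜ + ∑ u ∈ I, G.degree u ≤ G.edgeFinset.card := by
  have hdisj : (I : Set V).PairwiseDisjoint fun u => G.incidenceFinset u := by
    intro u hu v hv huv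
    rw [Function.onFun, Finset.disjoint_left]
    intro e heu hev
    rw [SimpleGraph.mem_incidenceFinset] at heu hev
    exact hI u hu v hv (G.adj_of_mem_incidenceSet huv heu hev)
  have hcard : (I.biUnion fun u => G.incidenceFinset u).card = ∑ u ∈ I, G.degree u := by
    rw [card_biUnion hdisj]
    simp
  rw [← hcard, edgesIn, ← card_union_of_disjoint]
  · refine card_le_card (union_subset (filter_subset _ _) (biUnion_subset.2 fun u _ => ?_))
    exact G.incidenceFinset_subset u
  · rw [Finset.disjoint_left]
    intro e he he'
    obtain ⟨u, hu, heu⟩ := mem_biUnion.1 he'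
    rw [SimpleGraph.mem_incidenceFinset] at heu
    exact mem_compl.1 ((mem_filter.1 he).2 u heu.2) (hIT hu)

/-- In a triangle-free graph the neighbours of a vertex are pairwise non-adjacent. -/
theorem not_adj_of_mem_neighborFinset {V : Type*} [Fintype V] (G : SimpleGraph V)
    [DecidableRel G.Adj] (h3 : G.CliqueFree 3) (v : V) :
    ∀ a ∈ G.neighborFinset v, ∀ b ∈ G.neighborFinset v, ¬ G.Adj a b := by
  classical
  intro a ha b hb hab
  rw [SimpleGraph.mem_neighborFinset] at ha hb
  exact h3 {v, a, b} (SimpleGraph.is3Clique_triple_iff.2 ⟨ha, hb, hab⟩)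

theorem sum_sum_neighborFinset_degree {V : Type*} [Fintype V] (G : SimpleGraph V)
    [DecidableRel G.Adj] :
    ∑ v, ∑ u ∈ G.neighborFinset v, (G.degree u : ℝ) = ∑ v, (G.degree v : ℝ) ^ 2 := by
  rw [sum_comm' (t' := univ) (s' := fun u => G.neighborFinset u)
    (by simp [SimpleGraph.adj_comm])]
  simp [sq]

/-- In a triangle-free graph of average degree `d`, for every `x ≤ d / 2` and every integer
`m ≥ x` there are `m` vertices meeting at least `x * d` edges. -/
theorem exists_card_eq_edgesIn_compl_add_le {V : Type*} [Fintype V] [DecidableEq V] [Nonempty V]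
    (G : SimpleGraph V) [DecidableRel G.Adj] (h3 : G.CliqueFree 3) {d x : ℝ} (hx : 0 ≤ x)
    (hxd : x ≤ d / 2) (hd : ∑ v, (G.degree v : ℝ) = d * Fintype.card V) {m : ℕ}
    (hxm : x ≤ m) (hm : m ≤ Fintype.card V) :
    ∃ T : Finset V, T.card = m ∧ (edgesIn G Tᶜ : ℝ) + x * d ≤ G.edgeFinset.card := by
  by_contra! hT
  have hcover : ∀ I T : Finset V, I ⊆ T → (∀ u ∈ I, ∀ v ∈ I, ¬ G.Adj u v) → T.card = m →
      ∑ u ∈ I, (G.degree u : ℝ) < x * d := by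
    intro I T hIT hI hTm
    have h : (edgesIn G Tᶜ : ℝ) + ∑ u ∈ I, (G.degree u : ℝ) ≤ G.edgeFinset.card := by
      exact_mod_cast edgesIn_compl_add_sum_degree_le G hIT hI
    linarith [hT T hTm]
  have hpt : ∀ v, ∑ u ∈ G.neighborFinset v, (G.degree u : ℝ)
      < (G.degree v : ℝ) ^ 2 - d * G.degree v + d ^ 2 := by
    intro v
    have hind := not_adj_of_mem_neighborFinset G h3 v
    rcases le_or_gt m (G.degree v) with hv | hv
    · suffices h : ∑ u ∈ G.neighborFinset v, (G.degree u : ℝ) < d * G.degree v by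
        nlinarith [sq_nonneg ((G.degree v : ℝ) - d)]
      by_contra! h
      obtain ⟨T, hTN, hTm, hTd⟩ := exists_subset_card_eq_mul_le_sum
        (fun u => (G.degree u : ℝ)) d m (G.neighborFinset v) (by simpa using hv) (by simpa using h)
      have := hcover T T Subset.rfl (fun a ha b hb => hind a (hTN ha) b (hTN hb)) hTm
      nlinarith
    · obtain ⟨T, hNT, hTm⟩ := exists_superset_card_eq (s := G.neighborFinset v)
        (by simpa using hv.le) hm
      have := hcover _ T hNT hind hTm
      nlinarith [sq_nonneg ((G.degree v : ℝ) - d / 2), sq_nonneg d]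
  have hsum := sum_lt_sum_of_nonempty univ_nonempty fun v _ => hpt v
  rw [sum_sum_neighborFinset_degree, sum_add_distrib, sum_sub_distrib, ← mul_sum, hd] at hsum
  simp only [sum_const, card_univ, nsmul_eq_mul] at hsum
  nlinarith

/-- If `α + c ≥ 1` with `α, c ∈ [0,1]`, every triangle-free graph on `n` vertices
with `cn²` edges contains a set of `⌊αn⌋` vertices spanning at most `(2α − 1)cn²` edges. -/
theorem local_density_triangle_free {α c : ℝ} (hα : 0 ≤ α ∧ α ≤ 1) (hc : 0 ≤ c ∧ c ≤ 1)
    (hαc : 1 ≤ α + c) {n : ℕ} (G : SimpleGraph (Fin n)) [DecidableRel G.Adj]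
    (h3 : G.CliqueFree 3) (he : (G.edgeFinset.card : ℝ) = c * (n : ℝ) ^ 2) :
    ∃ S : Finset (Fin n), S.card = ⌊α * (n : ℝ)⌋₊ ∧
      (edgesIn G S : ℝ) ≤ (2 * α - 1) * c * (n : ℝ) ^ 2 := by
  rcases n.eq_zero_or_pos with rfl | hn
  · have h0 : G.edgeFinset.card = 0 := by simpa using he
    have h1 : edgesIn G ∅ ≤ G.edgeFinset.card := card_filter_le _ _
    exact ⟨∅, by simp, by simp [show edgesIn G ∅ = 0 by omega]⟩
  have : Nonempty (Fin n) := ⟨⟨0, hn⟩⟩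
  have hn0 : (0 : ℝ) ≤ n := n.cast_nonneg
  have hfloor : (⌊α * (n : ℝ)⌋₊ : ℝ) ≤ α * n := Nat.floor_le (mul_nonneg hα.1 hn0)
  have hfloor_le : ⌊α * (n : ℝ)⌋₊ ≤ n := by
    have : (⌊α * (n : ℝ)⌋₊ : ℝ) ≤ n := by nlinarith
    exact_mod_cast this
  have hdeg : ∑ v, (G.degree v : ℝ) = 2 * c * n * Fintype.card (Fin n) := by
    have h : ∑ v, (G.degree v : ℝ) = 2 * G.edgeFinset.card := by
      exact_mod_cast G.sum_degrees_eq_twice_card_edges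
    rw [h, he, Fintype.card_fin]
    ring
  obtain ⟨T, hT, hTe⟩ := exists_card_eq_edgesIn_compl_add_le G h3 (x := (1 - α) * n)
    (m := n - ⌊α * (n : ℝ)⌋₊) (mul_nonneg (by linarith) hn0) (by nlinarith) hdeg
    (by rw [Nat.cast_sub hfloor_le]; linarith) (by simp)
  refine ⟨Tᶜ, ?_, ?_⟩
  · rw [card_compl, Fintype.card_fin, hT]
    omega
  · rw [he] at hTe
    linarith
end

section
/- Let G be a graph on n vertices with e edges and let A ∪ B = V(G) be a partition with |A| = αn ≤ n/2, where (1/2 − α)n ∈ ℕ. Then there exists S ⊆ B with |S| = (1/2 − α)n such that e(A ∪ S) ≤ e(A) + ((1/2 − α)/(1 − α))·e(A,B) + ((1/2 − α)/(1 − α))²·e(B). -/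
open Finset

/-- A uniformly random `k`-subset of `B` contains a fixed set `T ⊆ B` with probability at most
`(k / |B|) ^ |T|`. -/
theorem card_filter_subset_powersetCard_le {V : Type*} [DecidableEq V] (T : Finset V) :
    ∀ (B : Finset V) (k : ℕ), T ⊆ B → k ≤ B.card →
      (((B.powersetCard k).filter fun S => T ⊆ S).card : ℝ)
        ≤ ((k : ℝ) / B.card) ^ T.card * (B.powersetCard k).card := by
  induction T using Finset.induction_on with
  | empty => intro B k _ _; simp
  | insert a T ha ih =>
    intro B k hT hk
    have haB : a ∈ B := hT (mem_insert_self a T)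
    rcases k with _ | k
    · simp
    obtain ⟨m, hm⟩ : ∃ m, B.card = m + 1 := ⟨B.card - 1, by have := card_pos.2 ⟨a, haB⟩; omega⟩
    have hm' : (B.erase a).card = m := by rw [card_erase_of_mem haB, hm]; rfl
    have hkm : k ≤ m := by omega
    have hle : ((B.powersetCard (k + 1)).filter fun S => insert a T ⊆ S).card
        ≤ (((B.erase a).powersetCard k).filter fun S => T ⊆ S).card := by
      refine card_le_card_of_injOn (fun S => S.erase a) ?_ ?_
      · intro S hS
        simp only [coe_filter, mem_powersetCard, Set.mem_ofPred_eq, insert_subset_iff] at hS ⊢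
        obtain ⟨⟨hSB, hSc⟩, haS, hTS⟩ := hS
        refine ⟨⟨erase_subset_erase a hSB, by rw [card_erase_of_mem haS, hSc]; rfl⟩, ?_⟩
        exact subset_erase.2 ⟨hTS, ha⟩
      · intro S hS S' hS' h
        simp only [coe_filter, Set.mem_ofPred_eq, insert_subset_iff] at hS hS'
        rw [← insert_erase hS.2.1, ← insert_erase hS'.2.1]
        exact congrArg (insert a) h
    have hih := ih (B.erase a) k
      (subset_erase.2 ⟨(subset_insert a T).trans hT, ha⟩) (by omega)
    rw [hm', card_powersetCard, hm'] at hih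
    rw [card_powersetCard, hm, card_insert_of_notMem ha]
    have hchoose : ((m.choose k : ℕ) : ℝ)
        = (((k + 1 : ℕ) : ℝ) / ((m + 1 : ℕ) : ℝ)) * ((m + 1).choose (k + 1) : ℕ) := by
      have h : ((m + 1 : ℕ) : ℝ) * (m.choose k : ℕ)
          = ((m + 1).choose (k + 1) : ℕ) * ((k + 1 : ℕ) : ℝ) := by
        exact_mod_cast Nat.add_one_mul_choose_eq m k
      field_simp
      linarith
    have hratio : (k : ℝ) / m ≤ ((k + 1 : ℕ) : ℝ) / ((m + 1 : ℕ) : ℝ) := by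
      rcases Nat.eq_zero_or_pos m with rfl | hpos
      · simp; positivity
      · have : (0 : ℝ) < m := by exact_mod_cast hpos
        have : (k : ℝ) ≤ m := by exact_mod_cast hkm
        rw [div_le_div_iff₀ (by assumption) (by positivity)]
        push_cast
        nlinarith
    calc (((B.powersetCard (k + 1)).filter fun S => insert a T ⊆ S).card : ℝ)
        ≤ ((k : ℝ) / m) ^ T.card * (m.choose k : ℕ) := le_trans (by exact_mod_cast hle) hih
      _ ≤ (((k + 1 : ℕ) : ℝ) / ((m + 1 : ℕ) : ℝ)) ^ T.card * (m.choose k : ℕ) := by gcongr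
      _ = _ := by rw [hchoose, pow_succ]; ring

/-- For a partition `A ∪ B` of the vertices and `k ≤ |B|`, some `k`-subset `S` of `B` spans
together with `A` at most the expected number of edges when each vertex of `B` is kept with
probability `k / |B|`. -/
theorem exists_powersetCard_edgesIn_union_le {V : Type*} [Fintype V] [DecidableEq V]
    (G : SimpleGraph V) [DecidableRel G.Adj] {A B : Finset V} (hdisj : Disjoint A B)
    (hunion : A ∪ B = Finset.univ) {k : ℕ} (hk : k ≤ B.card) :
    ∃ S ∈ B.powersetCard k, (edgesIn G (A ∪ S) : ℝ) ≤ (edgesIn G A : ℝ)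
      + ((k : ℝ) / B.card) * (edgesBetween G A B : ℝ)
      + ((k : ℝ) / B.card) ^ 2 * (edgesIn G B : ℝ) := by
  have hne : (B.powersetCard k).Nonempty := powersetCard_nonempty.2 hk
  refine exists_le_of_sum_le hne ?_
  rw [sum_const, nsmul_eq_mul]
  have hedge : ∀ e ∈ G.edgeFinset,
      (∑ S ∈ B.powersetCard k, if ∀ v ∈ e, v ∈ A ∪ S then (1 : ℝ) else 0)
        ≤ (B.powersetCard k).card * ((if ∀ v ∈ e, v ∈ A then (1 : ℝ) else 0)
          + ((k : ℝ) / B.card) * (if ∃ a ∈ A, ∃ b ∈ B, e = s(a, b) then (1 : ℝ) else 0)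
          + ((k : ℝ) / B.card) ^ 2 * (if ∀ v ∈ e, v ∈ B then (1 : ℝ) else 0)) := by
    intro e he
    rw [← natCast_card_filter]
    have hmem : ∀ v, v ∈ B ↔ v ∉ A := fun v =>
      ⟨fun hB hA => disjoint_left.1 hdisj hA hB, fun hA => by
        have := mem_univ v
        rw [← hunion, mem_union] at this
        exact this.resolve_left hA⟩
    induction e with
    | _ x y =>
    have hxy : x ≠ y := (G.mem_edgeFinset.1 he : G.Adj x y).ne
    have hbound : ∀ T ⊆ B, (∀ S : Finset V, (∀ v ∈ s(x, y), v ∈ A ∪ S) → T ⊆ S) →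
        (((B.powersetCard k).filter fun S => ∀ v ∈ s(x, y), v ∈ A ∪ S).card : ℝ)
          ≤ ((k : ℝ) / B.card) ^ T.card * (B.powersetCard k).card := fun T hT h =>
      le_trans (by exact_mod_cast card_le_card (monotone_filter_right _ fun S _ hS => h S hS))
        (card_filter_subset_powersetCard_le T B k hT hk)
    have hbetween : (∃ a ∈ A, ∃ b ∈ B, s(x, y) = s(a, b)) ↔ x ∈ A ∧ y ∉ A ∨ x ∉ A ∧ y ∈ A := by
      constructor
      · rintro ⟨a, ha, b, hb, h⟩
        rw [hmem] at hb
        rcases Sym2.eq_iff.1 h with ⟨rfl, rfl⟩ | ⟨rfl, rfl⟩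
        · exact Or.inl ⟨ha, hb⟩
        · exact Or.inr ⟨hb, ha⟩
      · rintro (⟨hx, hy⟩ | ⟨hx, hy⟩)
        · exact ⟨x, hx, y, (hmem y).2 hy, rfl⟩
        · exact ⟨y, hy, x, (hmem x).2 hx, Sym2.eq_swap⟩
    simp only [hbetween]
    simp only [Sym2.mem_iff, forall_eq_or_imp, forall_eq, mem_union] at hbound ⊢
    simp only [hmem x, hmem y]
    by_cases hx : x ∈ A <;> by_cases hy : y ∈ A
    · simp [hx, hy]
    · simpa [hx, hy, mul_comm] using hbound {y} (by simp [hmem, hy]) (by simp [hx, hy])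
    · simpa [hx, hy, mul_comm] using hbound {x} (by simp [hmem, hx]) (by simp [hx, hy])
    · simpa [hx, hy, mul_comm, hxy] using
        hbound {x, y} (by simp [insert_subset_iff, hmem, hx, hy])
          (by simp [insert_subset_iff, hx, hy])
  simp only [edgesIn, edgesBetween, natCast_card_filter]
  rw [sum_comm]
  refine (sum_le_sum hedge).trans_eq ?_
  rw [← mul_sum, sum_add_distrib, sum_add_distrib, mul_sum, mul_sum]

/-- Given a partition `A ∪ B = V(G)` with `|A| = αn ≤ n/2` and `(1/2 − α)n ∈ ℕ`,
there is `S ⊆ B` with `|S| = (1/2 − α)n` such that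
`e(A ∪ S) ≤ e(A) + ((1/2−α)/(1−α))·e(A,B) + ((1/2−α)/(1−α))²·e(B)`. -/
theorem extend_to_sparse_half {n : ℕ} (G : SimpleGraph (Fin n)) [DecidableRel G.Adj]
    {α : ℝ} {A B : Finset (Fin n)} (hdisj : Disjoint A B) (hunion : A ∪ B = Finset.univ)
    (hA : (A.card : ℝ) = α * (n : ℝ)) (hα : α ≤ 1 / 2) {k : ℕ}
    (hk : (k : ℝ) = (1 / 2 - α) * (n : ℝ)) :
    ∃ S ⊆ B, S.card = k ∧
      (edgesIn G (A ∪ S) : ℝ) ≤ (edgesIn G A : ℝ)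
        + ((1 / 2 - α) / (1 - α)) * (edgesBetween G A B : ℝ)
        + ((1 / 2 - α) / (1 - α)) ^ 2 * (edgesIn G B : ℝ) := by
  have hcard : (A.card : ℝ) + B.card = n := by
    have h := card_union_of_disjoint hdisj
    rw [hunion, card_univ, Fintype.card_fin] at h
    exact_mod_cast h.symm
  have hB : (B.card : ℝ) = (1 - α) * n := by linarith
  have hkB : k ≤ B.card := by
    have : (k : ℝ) ≤ B.card := by
      rw [hk, hB]
      have : (0 : ℝ) ≤ n := by positivity
      nlinarith
    exact_mod_cast this
  obtain ⟨S, hS, hle⟩ := exists_powersetCard_edgesIn_union_le G hdisj hunion hkB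
  rw [mem_powersetCard] at hS
  refine ⟨S, hS.1, hS.2, ?_⟩
  rcases Nat.eq_zero_or_pos n with rfl | hn
  · have hempty : ∀ T : Finset (Fin 0), T = ∅ := fun T => eq_empty_of_isEmpty T
    have hzero : edgesIn G (A ∪ S) = edgesIn G A := by rw [hempty (A ∪ S), hempty A]
    rw [hzero, add_assoc]
    have : (0 : ℝ) ≤ (1 / 2 - α) / (1 - α) := div_nonneg (by linarith) (by linarith)
    exact le_add_of_nonneg_right (by positivity)
  · have hn' : (n : ℝ) ≠ 0 := by positivity
    rwa [hk, hB, mul_div_mul_right _ _ hn'] at hle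
end

section
/- Every graph G on n ≥ 1 vertices contains a bipartite subgraph G' (equivalently, a partition V(G) = A ∪ B) such that e(A,B) ≥ (1/n)·Σ_{v∈V(G)} d(v)² − (2/n)·Σ_{v∈V(G)} e(N(v)), and moreover this quantity is at least 4·e(G)²/n² − 6·t(G)/n, where t(G) is the number of triangles in G. -/
open Finset

/-- Summing degrees over `S` counts each edge leaving `S` once and each edge inside `S` twice. -/
theorem sum_degree_eq_edgesBetween_compl_add {V : Type*} [Fintype V] [DecidableEq V]
    (G : SimpleGraph V) [DecidableRel G.Adj] (S : Finset V) :
    ∑ u ∈ S, G.degree u = edgesBetween G S Sᶜ + 2 * edgesIn G S := by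
  have hdeg : ∀ u, G.degree u = ∑ e ∈ G.edgeFinset, if u ∈ e then 1 else 0 := by
    intro u
    rw [← G.card_incidenceFinset_eq_degree, G.incidenceFinset_eq_filter, card_filter]
  simp only [hdeg, edgesBetween, edgesIn, card_filter]
  rw [sum_comm, mul_sum, ← sum_add_distrib]
  refine sum_congr rfl fun e he => ?_
  induction e with
  | _ a b =>
    have hab : a ≠ b := (SimpleGraph.mem_edgeFinset.1 he : G.Adj a b).ne
    have hsplit : ∀ u, (if u ∈ s(a, b) then 1 else 0)
        = (if u = a then 1 else 0) + (if u = b then 1 else 0) := by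
      intro u
      by_cases hua : u = a <;> by_cases hub : u = b <;> simp_all
    have hbetween : (∃ x ∈ S, ∃ y ∈ Sᶜ, s(a, b) = s(x, y)) ↔
        (a ∈ S ∧ b ∉ S) ∨ (b ∈ S ∧ a ∉ S) := by
      simp only [Sym2.eq_iff, mem_compl]
      grind
    simp only [hsplit, sum_add_distrib, sum_ite_eq', hbetween]
    simp only [Sym2.mem_iff, forall_eq_or_imp, forall_eq]
    by_cases ha : a ∈ S <;> by_cases hb : b ∈ S <;> simp [ha, hb]

/-- The edges inside the neighborhood of `v` correspond to the triangles through `v`. -/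
theorem edgesIn_neighborFinset {V : Type*} [Fintype V] [DecidableEq V]
    (G : SimpleGraph V) [DecidableRel G.Adj] (v : V) :
    edgesIn G (G.neighborFinset v) = #{T ∈ G.cliqueFinset 3 | v ∈ T} := by
  refine card_bij (fun e _ => insert v e.toFinset) ?_ ?_ ?_
  · intro e he
    induction e with
    | _ a b =>
      simp only [mem_filter, SimpleGraph.mem_edgeFinset, SimpleGraph.mem_edgeSet, Sym2.mem_iff,
        forall_eq_or_imp, forall_eq, SimpleGraph.mem_neighborFinset] at he
      obtain ⟨hab, hva, hvb⟩ := he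
      simp [Sym2.toFinset_mk_eq, SimpleGraph.mem_cliqueFinset_iff,
        SimpleGraph.is3Clique_triple_iff, hab, hva, hvb]
  · intro e he f hf h
    have hnot : ∀ e ∈ G.edgeFinset.filter fun e => ∀ u ∈ e, u ∈ G.neighborFinset v,
        v ∉ e.toFinset := by
      intro e he hv
      simpa using (mem_filter.1 he).2 v (Sym2.mem_toFinset.1 hv)
    have h' := congrArg (fun T => T.erase v) h
    simp only [erase_insert (hnot e he), erase_insert (hnot f hf)] at h'
    ext x
    rw [← Sym2.mem_toFinset, h', Sym2.mem_toFinset]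
  · intro T hT
    obtain ⟨hT, hv⟩ := mem_filter.1 hT
    have hcard : #(T.erase v) = 2 := by
      rw [card_erase_of_mem hv, (SimpleGraph.mem_cliqueFinset_iff.1 hT).card_eq]
    obtain ⟨a, b, -, hab⟩ := card_eq_two.1 hcard
    obtain rfl : insert v {a, b} = T := by rw [← hab, insert_erase hv]
    rw [SimpleGraph.mem_cliqueFinset_iff, SimpleGraph.is3Clique_triple_iff] at hT
    exact ⟨s(a, b), by simp [hT], by simp [Sym2.toFinset_mk_eq]⟩

/-- Every triangle is counted once from each of its three vertices. -/
theorem sum_edgesIn_neighborFinset {V : Type*} [Fintype V] [DecidableEq V]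
    (G : SimpleGraph V) [DecidableRel G.Adj] :
    ∑ v, edgesIn G (G.neighborFinset v) = 3 * #(G.cliqueFinset 3) := by
  simp only [edgesIn_neighborFinset, card_filter]
  rw [sum_comm, mul_comm, ← smul_eq_mul, ← sum_const]
  refine sum_congr rfl fun T hT => ?_
  simpa using (SimpleGraph.mem_cliqueFinset_iff.1 hT).card_eq

/-- Summing degrees over all neighborhoods counts `d(u)` once for each neighbor of `u`. -/
theorem sum_sum_degree_neighborFinset {V : Type*} [Fintype V] [DecidableEq V]
    (G : SimpleGraph V) [DecidableRel G.Adj] :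
    ∑ v, ∑ u ∈ G.neighborFinset v, G.degree u = ∑ u, G.degree u ^ 2 := by
  rw [sum_comm' (t' := univ) (s' := fun u => G.neighborFinset u)
    (by simp [SimpleGraph.adj_comm])]
  simp [sq]

/-- Every graph on `n ≥ 1` vertices has a bipartition `A ∪ B` with
`e(A,B) ≥ (1/n)·Σ d(v)² − (2/n)·Σ e(N(v))`, and this quantity is at least
`4e(G)²/n² − 6t(G)/n`. -/
theorem max_cut_lower_bound {n : ℕ} (hn : 1 ≤ n) (G : SimpleGraph (Fin n))
    [DecidableRel G.Adj] :
    ∃ A B : Finset (Fin n), Disjoint A B ∧ A ∪ B = Finset.univ ∧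
      (1 / (n : ℝ)) * ∑ v : Fin n, (G.degree v : ℝ) ^ 2
          - (2 / (n : ℝ)) * ∑ v : Fin n, (edgesIn G (G.neighborFinset v) : ℝ)
        ≤ (edgesBetween G A B : ℝ) ∧
      4 * (G.edgeFinset.card : ℝ) ^ 2 / (n : ℝ) ^ 2
          - 6 * ((G.cliqueFinset 3).card : ℝ) / (n : ℝ)
        ≤ (1 / (n : ℝ)) * ∑ v : Fin n, (G.degree v : ℝ) ^ 2
          - (2 / (n : ℝ)) * ∑ v : Fin n, (edgesIn G (G.neighborFinset v) : ℝ) := by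
  have hn' : (0 : ℝ) < n := by exact_mod_cast hn
  have : NeZero n := ⟨by omega⟩
  have hsum : ∑ v, (edgesBetween G (G.neighborFinset v) (G.neighborFinset v)ᶜ : ℝ)
      = ∑ v, (G.degree v : ℝ) ^ 2 - 2 * ∑ v, (edgesIn G (G.neighborFinset v) : ℝ) := by
    have h := sum_sum_degree_neighborFinset G
    simp only [sum_degree_eq_edgesBetween_compl_add, sum_add_distrib, ← mul_sum] at h
    rw [eq_sub_iff_add_eq]
    exact_mod_cast h
  obtain ⟨v, -, hv⟩ := exists_le_of_sum_le (s := (univ : Finset (Fin n))) univ_nonempty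
    (f := fun _ => (1 / (n : ℝ)) * ∑ v : Fin n, (G.degree v : ℝ) ^ 2
      - (2 / (n : ℝ)) * ∑ v : Fin n, (edgesIn G (G.neighborFinset v) : ℝ))
    (g := fun v => (edgesBetween G (G.neighborFinset v) (G.neighborFinset v)ᶜ : ℝ)) (by
      rw [hsum, sum_const, card_univ, Fintype.card_fin, nsmul_eq_mul]
      apply le_of_eq
      field_simp)
  refine ⟨G.neighborFinset v, (G.neighborFinset v)ᶜ, disjoint_compl_right, union_compl _, hv, ?_⟩
  have htri : ∑ v, (edgesIn G (G.neighborFinset v) : ℝ) = 3 * (#(G.cliqueFinset 3) : ℝ) := by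
    exact_mod_cast sum_edgesIn_neighborFinset G
  have hshake : ∑ v, (G.degree v : ℝ) = 2 * (#G.edgeFinset : ℝ) := by
    exact_mod_cast G.sum_degrees_eq_twice_card_edges
  have hcs : (2 * (#G.edgeFinset : ℝ)) ^ 2 ≤ n * ∑ v, (G.degree v : ℝ) ^ 2 := by
    simpa [hshake] using
      sq_sum_le_card_mul_sum_sq (s := (univ : Finset (Fin n))) (f := fun v => (G.degree v : ℝ))
  have hmain : 4 * (#G.edgeFinset : ℝ) ^ 2 / (n : ℝ) ^ 2
      ≤ (1 / (n : ℝ)) * ∑ v, (G.degree v : ℝ) ^ 2 := by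
    rw [div_le_iff₀ (by positivity)]
    calc 4 * (#G.edgeFinset : ℝ) ^ 2 = (2 * (#G.edgeFinset : ℝ)) ^ 2 := by ring
      _ ≤ n * ∑ v, (G.degree v : ℝ) ^ 2 := hcs
      _ = _ := by field_simp
  rw [htri]
  calc _ ≤ (1 / (n : ℝ)) * ∑ v, (G.degree v : ℝ) ^ 2
        - 6 * (#(G.cliqueFinset 3) : ℝ) / n := by gcongr
    _ = _ := by ring
end

section
/- Every K_4-free graph G on n ≥ 1 vertices with minimum degree at least 1 contains a bipartite subgraph (equivalently, a partition V(G) = A ∪ B) such that e(A,B) ≥ e(G)/2 + (1/n)·Σ_{v∈V(G)} ( 4·e(N(v))²/d(v)² − e(N(v))/2 ). -/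
open Finset

theorem exists_cut_extending_on_union {V : Type*} [DecidableEq V] (f : V → V → ℝ)
    (hsymm : ∀ a b, f a b = f b a) (hdiag : ∀ a, f a a = 0) {A B : Finset V}
    (hAB : Disjoint A B) (T : Finset V) :
    ∃ A' B' : Finset V, Disjoint A' B' ∧ A' ∪ B' = A ∪ B ∪ T ∧
      ∑ a ∈ A, ∑ b ∈ B, f a b
          + (∑ a ∈ A ∪ B ∪ T, ∑ b ∈ A ∪ B ∪ T, f a b
              - ∑ a ∈ A ∪ B, ∑ b ∈ A ∪ B, f a b) / 4
        ≤ ∑ a ∈ A', ∑ b ∈ B', f a b := by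
  induction T using Finset.induction with
  | empty => exact ⟨A, B, hAB, by simp, by simp⟩
  | insert x T _ ih =>
    obtain ⟨A', B', hd, hu, hle⟩ := ih
    rw [union_insert, ← hu]
    rw [← hu] at hle
    by_cases hx : x ∈ A' ∪ B'
    · rw [insert_eq_of_mem hx]
      exact ⟨A', B', hd, rfl, hle⟩
    have hxA : x ∉ A' := fun h => hx (mem_union_left _ h)
    have hxB : x ∉ B' := fun h => hx (mem_union_right _ h)
    have htot : ∑ a ∈ insert x (A' ∪ B'), ∑ b ∈ insert x (A' ∪ B'), f a b
        = ∑ a ∈ A' ∪ B', ∑ b ∈ A' ∪ B', f a b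
          + 2 * (∑ b ∈ A', f b x + ∑ b ∈ B', f x b) := by
      simp only [sum_insert hx, sum_add_distrib, hdiag, hsymm x]
      rw [sum_union hd (f := fun i => f i x)]
      ring
    by_cases hcmp : ∑ b ∈ A', f b x ≤ ∑ b ∈ B', f x b
    · refine ⟨insert x A', B', disjoint_insert_left.2 ⟨hxB, hd⟩, insert_union .., ?_⟩
      rw [htot, sum_insert hxA]
      linarith
    · refine ⟨A', insert x B', disjoint_insert_right.2 ⟨hxA, hd⟩, union_insert .., ?_⟩
      rw [htot]
      simp only [sum_insert hxB, sum_add_distrib]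
      linarith

/-- A cut of a vertex subset extends to a cut of the whole vertex set that contains at least half
of the remaining weight. Ordered pairs count each edge twice, hence the factor `1 / 4`. -/
theorem exists_cut_extending {V : Type*} [Fintype V] [DecidableEq V] (f : V → V → ℝ)
    (hsymm : ∀ a b, f a b = f b a) (hdiag : ∀ a, f a a = 0) {A B : Finset V}
    (hAB : Disjoint A B) :
    ∃ A' B' : Finset V, Disjoint A' B' ∧ A' ∪ B' = univ ∧
      ∑ a ∈ A, ∑ b ∈ B, f a b
          + (∑ a, ∑ b, f a b - ∑ a ∈ A ∪ B, ∑ b ∈ A ∪ B, f a b) / 4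
        ≤ ∑ a ∈ A', ∑ b ∈ B', f a b := by
  have h := exists_cut_extending_on_union f hsymm hdiag hAB univ
  rwa [union_eq_right.2 (subset_univ (A ∪ B))] at h

section Counting

variable {V : Type*} [Fintype V] [DecidableEq V] (G : SimpleGraph V) [DecidableRel G.Adj]

theorem two_mul_edgesIn (S : Finset V) :
    2 * (edgesIn G S : ℝ) = ∑ a ∈ S, ∑ b ∈ S, if G.Adj a b then (1 : ℝ) else 0 := by
  let H : SimpleGraph V :=
    { Adj := fun a b => G.Adj a b ∧ a ∈ S ∧ b ∈ S
      symm := ⟨fun _ _ h => ⟨h.1.symm, h.2.2, h.2.1⟩⟩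
      loopless := ⟨fun _ h => G.irrefl h.1⟩ }
  have : DecidableRel H.Adj := fun a b =>
    inferInstanceAs (Decidable (G.Adj a b ∧ a ∈ S ∧ b ∈ S))
  have hE : H.edgeFinset = G.edgeFinset.filter fun e => ∀ v ∈ e, v ∈ S := by
    ext e
    induction e with
    | _ a b => simp [H]
  have hdeg : ∀ a, (H.degree a : ℝ)
      = if a ∈ S then ∑ b ∈ S, if G.Adj a b then (1 : ℝ) else 0 else 0 := by
    intro a
    rw [← SimpleGraph.card_neighborFinset_eq_degree, SimpleGraph.neighborFinset_eq_filter]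
    split_ifs with ha
    · rw [sum_boole]
      congr 2
      ext b
      simp [H, ha, and_comm]
    · simp [H, ha]
  have h := H.sum_degrees_eq_twice_card_edges
  rw [hE] at h
  have h' : (∑ a, (H.degree a : ℝ)) = 2 * (edgesIn G S : ℝ) := by
    unfold edgesIn
    exact_mod_cast h
  rw [← h', sum_congr rfl fun a _ => hdeg a, sum_ite_mem, univ_inter]

theorem edgesBetween_eq_sum {A B : Finset V} (hAB : Disjoint A B) :
    (edgesBetween G A B : ℝ) = ∑ a ∈ A, ∑ b ∈ B, if G.Adj a b then (1 : ℝ) else 0 := by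
  rw [← sum_product', sum_boole, edgesBetween]
  congr 1
  symm
  apply card_bij fun p _ => s(p.1, p.2)
  · rintro ⟨a, b⟩ h
    simp only [mem_filter, mem_product] at h
    simp only [mem_filter, SimpleGraph.mem_edgeFinset, SimpleGraph.mem_edgeSet]
    exact ⟨h.2, a, h.1.1, b, h.1.2, rfl⟩
  · rintro ⟨a, b⟩ h ⟨c, d⟩ h' heq
    simp only [mem_filter, mem_product] at h h'
    rcases Sym2.eq_iff.1 heq with ⟨rfl, rfl⟩ | ⟨rfl, rfl⟩
    · rfl
    · exact (disjoint_left.1 hAB h.1.1 h'.1.2).elim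
  · rintro e h
    obtain ⟨he, a, ha, b, hb, rfl⟩ := mem_filter.1 h
    exact ⟨(a, b), by simpa [ha, hb] using he, rfl⟩

theorem edgesIn_univ : edgesIn G univ = G.edgeFinset.card := by
  simp [edgesIn]

/-- If the neighborhoods within `N` of the vertices of `N` are independent, some vertex of `N`
yields a cut of `N` with at least `4 e(N)² / |N|²` edges. -/
theorem exists_cut_of_triangleFree {N : Finset V} (hN : N.Nonempty)
    (hfree : ∀ u ∈ N, ∀ a ∈ N, ∀ b ∈ N, G.Adj u a → G.Adj u b → ¬ G.Adj a b) :
    ∃ A B : Finset V, Disjoint A B ∧ A ∪ B = N ∧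
      4 * (edgesIn G N : ℝ) ^ 2 / (N.card : ℝ) ^ 2 ≤ (edgesBetween G A B : ℝ) := by
  set f : V → V → ℝ := fun a b => if G.Adj a b then 1 else 0 with hf
  set h : V → ℝ := fun a => ∑ b ∈ N, f a b with hh
  have hcard : (0 : ℝ) < N.card := by exact_mod_cast hN.card_pos
  have hswap : ∑ u ∈ N, ∑ w ∈ N, f u w * h w = ∑ w ∈ N, h w ^ 2 := by
    rw [sum_comm]
    refine sum_congr rfl fun w _ => ?_
    rw [← sum_mul, sq]
    congr 1
    exact sum_congr rfl fun u _ => by simp [hf, G.adj_comm]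
  have hcs : (2 * (edgesIn G N : ℝ)) ^ 2 ≤ N.card * ∑ w ∈ N, h w ^ 2 := by
    rw [two_mul_edgesIn]
    exact sq_sum_le_card_mul_sum_sq
  obtain ⟨u, hu, hule⟩ : ∃ u ∈ N, (∑ w ∈ N, h w ^ 2) / N.card ≤ ∑ w ∈ N, f u w * h w := by
    apply exists_le_of_sum_le hN
    rw [hswap, sum_const, nsmul_eq_mul, mul_div_cancel₀ _ hcard.ne']
  refine ⟨N.filter (G.Adj u), N.filter fun b => ¬ G.Adj u b, disjoint_filter_filter_not _ _ _,
    filter_union_filter_not_eq _ _, ?_⟩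
  have hcut : (edgesBetween G (N.filter (G.Adj u)) (N.filter fun b => ¬ G.Adj u b) : ℝ)
      = ∑ w ∈ N, f u w * h w := by
    rw [edgesBetween_eq_sum G (disjoint_filter_filter_not _ _ _), sum_filter]
    refine sum_congr rfl fun a ha => ?_
    by_cases hua : G.Adj u a
    · simp only [hf, hh, hua, if_true, one_mul]
      rw [sum_filter]
      refine sum_congr rfl fun b hb => ?_
      by_cases hub : G.Adj u b
      · simp [hub, hfree u hu a ha b hb hua hub]
      · simp [hub]
    · simp [hf, hua]
  rw [hcut]
  refine le_trans ?_ hule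
  rw [div_le_div_iff₀ (by positivity) hcard]
  nlinarith

theorem exists_cut_of_neighborFinset (hK4 : G.CliqueFree 4) {v : V} (hv : 1 ≤ G.degree v) :
    ∃ A B : Finset V, Disjoint A B ∧ A ∪ B = univ ∧
      (G.edgeFinset.card : ℝ) / 2
          + (4 * (edgesIn G (G.neighborFinset v) : ℝ) ^ 2 / (G.degree v : ℝ) ^ 2
            - (edgesIn G (G.neighborFinset v) : ℝ) / 2)
        ≤ (edgesBetween G A B : ℝ) := by
  have hN : (G.neighborFinset v).Nonempty := by
    rw [← card_pos, SimpleGraph.card_neighborFinset_eq_degree]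
    exact hv
  obtain ⟨A, B, hd, hu, hle⟩ := exists_cut_of_triangleFree G hN (by
    intro u hu a ha b hb hua hub hab
    rw [SimpleGraph.mem_neighborFinset] at hu ha hb
    refine hK4 {v, u, a, b} ?_
    exact (SimpleGraph.is3Clique_triple_iff.2 ⟨hua, hub, hab⟩).insert (by simp [hu, ha, hb]))
  obtain ⟨A', B', hd', hu', hle'⟩ :=
    exists_cut_extending (fun a b => if G.Adj a b then (1 : ℝ) else 0)
      (by simp [G.adj_comm]) (by simp) hd
  refine ⟨A', B', hd', hu', ?_⟩
  rw [hu, ← edgesBetween_eq_sum G hd, ← edgesBetween_eq_sum G hd', ← two_mul_edgesIn,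
    ← two_mul_edgesIn, edgesIn_univ] at hle'
  rw [SimpleGraph.card_neighborFinset_eq_degree] at hle
  linarith

end Counting

/-- Every `K₄`-free graph on `n ≥ 1` vertices with minimum degree at least `1` has
a bipartition `A ∪ B` with
`e(A,B) ≥ e(G)/2 + (1/n)·Σ (4·e(N(v))²/d(v)² − e(N(v))/2)`. -/
theorem max_cut_K4_free {n : ℕ} (hn : 1 ≤ n) (G : SimpleGraph (Fin n)) [DecidableRel G.Adj]
    (hK4 : G.CliqueFree 4) (hδ : ∀ v, 1 ≤ G.degree v) :
    ∃ A B : Finset (Fin n), Disjoint A B ∧ A ∪ B = Finset.univ ∧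
      (G.edgeFinset.card : ℝ) / 2
          + (1 / (n : ℝ)) * ∑ v : Fin n,
              (4 * (edgesIn G (G.neighborFinset v) : ℝ) ^ 2 / (G.degree v : ℝ) ^ 2
                - (edgesIn G (G.neighborFinset v) : ℝ) / 2)
        ≤ (edgesBetween G A B : ℝ) := by
  have hn0 : (n : ℝ) ≠ 0 := by positivity
  have : Nonempty (Fin n) := ⟨⟨0, hn⟩⟩
  set g : Fin n → ℝ := fun v =>
    4 * (edgesIn G (G.neighborFinset v) : ℝ) ^ 2 / (G.degree v : ℝ) ^ 2
      - (edgesIn G (G.neighborFinset v) : ℝ) / 2 with hg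
  obtain ⟨v, -, hv⟩ : ∃ v ∈ (univ : Finset (Fin n)), 1 / (n : ℝ) * ∑ w, g w ≤ g v := by
    apply exists_le_of_sum_le univ_nonempty
    rw [sum_const, card_univ, Fintype.card_fin, nsmul_eq_mul, ← mul_assoc,
      mul_one_div_cancel hn0, one_mul]
  obtain ⟨A, B, hd, hu, hle⟩ := exists_cut_of_neighborFinset G hK4 (hδ v)
  exact ⟨A, B, hd, hu, le_trans (add_le_add_right hv _) hle⟩
end
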